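/- arXiv:1307.3472 — 6 statements merged into one kernel-verified Lean document; each statement's English description precedes it below -/
import Mathlib

section
/- There exist two convex subsets P₁, P₂ of the rectangle R = [0,4] × [0,1] ⊆ ℝ² with disjoint interiors whose union is R, such that the area of P₁ equals one quarter of the area of R (so the areas of P₁ and P₂ are in ratio 1:3) and the perimeter of P₁ divided by the perimeter of P₂ equals 1/√3. -/
open MeasureTheory

/-- The rectangle `[0,4] × [0,1]` in the Euclidean plane. -/
def rectR : Set (EuclideanSpace ℝ (Fin 2)) :=
  {p | p 0 ∈ Set.Icc (0 : ℝ) 4 ∧ p 1 ∈ Set.Icc (0 : ℝ) 1}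

/-- The closed half-plane `a x + b y ≤ c`. -/
def halfPlane (a b c : ℝ) : Set (EuclideanSpace ℝ (Fin 2)) :=
  {p | a * p 0 + b * p 1 ≤ c}

/-- The linear functional `(x, y) ↦ a x + b y`. -/
noncomputable def planeFunctional (a b : ℝ) : EuclideanSpace ℝ (Fin 2) →L[ℝ] ℝ :=
  a • EuclideanSpace.proj 0 + b • EuclideanSpace.proj 1

theorem planeFunctional_apply (a b : ℝ) (p : EuclideanSpace ℝ (Fin 2)) :
    planeFunctional a b p = a * p 0 + b * p 1 := by
  simp [planeFunctional]

theorem halfPlane_eq_preimage (a b c : ℝ) :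
    halfPlane a b c = planeFunctional a b ⁻¹' Set.Iic c := by
  ext p
  simp [halfPlane, planeFunctional_apply]

theorem convex_halfPlane (a b c : ℝ) : Convex ℝ (halfPlane a b c) := by
  rw [halfPlane_eq_preimage]
  exact (convex_Iic c).linear_preimage (planeFunctional a b).toLinearMap

theorem isClosed_halfPlane (a b c : ℝ) : IsClosed (halfPlane a b c) := by
  rw [halfPlane_eq_preimage]
  exact isClosed_Iic.preimage (planeFunctional a b).continuous

theorem interior_halfPlane {a b : ℝ} (hab : a ≠ 0 ∨ b ≠ 0) (c : ℝ) :
    interior (halfPlane a b c) = {p | a * p 0 + b * p 1 < c} := by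
  have hne : planeFunctional a b ≠ 0 := by
    intro h
    have h0 := DFunLike.congr_fun h !₂[1, 0]
    have h1 := DFunLike.congr_fun h !₂[0, 1]
    simp [planeFunctional_apply] at h0 h1
    tauto
  rw [halfPlane_eq_preimage,
    ← ((planeFunctional a b).isOpenMap_of_ne_zero hne).preimage_interior_eq_interior_preimage
      (planeFunctional a b).continuous, interior_Iic]
  ext p
  simp [planeFunctional_apply]

theorem mem_segment_plane {a b c d : ℝ} {p : EuclideanSpace ℝ (Fin 2)} :
    p ∈ segment ℝ !₂[a, b] !₂[c, d] ↔
      ∃ t ∈ Set.Icc (0 : ℝ) 1, p 0 = (1 - t) * a + t * c ∧ p 1 = (1 - t) * b + t * d := by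
  rw [segment_eq_image]
  constructor
  · rintro ⟨t, ht, rfl⟩
    exact ⟨t, ht, by simp, by simp⟩
  · rintro ⟨t, ht, h0, h1⟩
    refine ⟨t, ht, ?_⟩
    ext i
    fin_cases i
    · simp [h0]
    · simp [h1]

theorem hausdorffMeasure_segment_plane (a b c d : ℝ) :
    μH[1] (segment ℝ (!₂[a, b] : EuclideanSpace ℝ (Fin 2)) !₂[c, d]) =
      ENNReal.ofReal (Real.sqrt ((a - c) ^ 2 + (b - d) ^ 2)) := by
  rw [hausdorffMeasure_segment, edist_dist, EuclideanSpace.dist_eq]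
  simp [Real.dist_eq, sq_abs]

theorem segment_horizontal {a c : ℝ} (h : a ≤ c) (b : ℝ) :
    segment ℝ (!₂[a, b] : EuclideanSpace ℝ (Fin 2)) !₂[c, b] =
      {p | a ≤ p 0 ∧ p 0 ≤ c ∧ p 1 = b} := by
  ext p
  rw [mem_segment_plane]
  constructor
  · rintro ⟨t, ⟨ht0, ht1⟩, h0, h1⟩
    refine ⟨?_, ?_, by rw [h1]; ring⟩ <;> rw [h0] <;> nlinarith
  · rintro ⟨ha, hc, hb⟩
    rcases h.eq_or_lt with rfl | h
    · exact ⟨0, by simp, by linarith, by linarith⟩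
    have hd : 0 < c - a := sub_pos.mpr h
    refine ⟨(p 0 - a) / (c - a), ⟨by apply div_nonneg <;> linarith, ?_⟩, ?_, by rw [hb]; ring⟩
    · rw [div_le_one hd]; linarith
    · field_simp; ring

theorem segment_vertical {b d : ℝ} (h : b ≤ d) (a : ℝ) :
    segment ℝ (!₂[a, b] : EuclideanSpace ℝ (Fin 2)) !₂[a, d] =
      {p | b ≤ p 1 ∧ p 1 ≤ d ∧ p 0 = a} := by
  ext p
  rw [mem_segment_plane]
  constructor
  · rintro ⟨t, ⟨ht0, ht1⟩, h0, h1⟩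
    refine ⟨?_, ?_, by rw [h0]; ring⟩ <;> rw [h1] <;> nlinarith
  · rintro ⟨hb, hd, ha⟩
    rcases h.eq_or_lt with rfl | h
    · exact ⟨0, by simp, by linarith, by linarith⟩
    have hd' : 0 < d - b := sub_pos.mpr h
    refine ⟨(p 1 - b) / (d - b), ⟨by apply div_nonneg <;> linarith, ?_⟩, by rw [ha]; ring, ?_⟩
    · rw [div_le_one hd']; linarith
    · field_simp; ring

theorem segment_hypotenuse {x y : ℝ} (hx : 0 < x) (hy : 0 < y) :
    segment ℝ (!₂[x, 0] : EuclideanSpace ℝ (Fin 2)) !₂[0, y] =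
      {p | 0 ≤ p 0 ∧ 0 ≤ p 1 ∧ y * p 0 + x * p 1 = x * y} := by
  ext p
  rw [mem_segment_plane]
  constructor
  · rintro ⟨t, ⟨ht0, ht1⟩, h0, h1⟩
    have : 0 ≤ 1 - t := by linarith
    refine ⟨?_, ?_, by rw [h0, h1]; ring⟩
    · rw [h0]; positivity
    · rw [h1]; positivity
  · rintro ⟨h0, h1, h⟩
    refine ⟨p 1 / y, ⟨by positivity, ?_⟩, ?_, ?_⟩
    · rw [div_le_one hy]; nlinarith
    · field_simp; linarith
    · field_simp; ring

theorem hausdorffMeasure_horizontal {a c : ℝ} (h : a ≤ c) (b : ℝ) :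
    μH[1] {p : EuclideanSpace ℝ (Fin 2) | a ≤ p 0 ∧ p 0 ≤ c ∧ p 1 = b} =
      ENNReal.ofReal (c - a) := by
  rw [← segment_horizontal h, hausdorffMeasure_segment_plane]
  congr 1
  rw [sub_self, zero_pow two_ne_zero, add_zero, Real.sqrt_sq_eq_abs, abs_sub_comm,
    abs_of_nonneg (sub_nonneg.mpr h)]

theorem hausdorffMeasure_vertical {b d : ℝ} (h : b ≤ d) (a : ℝ) :
    μH[1] {p : EuclideanSpace ℝ (Fin 2) | b ≤ p 1 ∧ p 1 ≤ d ∧ p 0 = a} =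
      ENNReal.ofReal (d - b) := by
  rw [← segment_vertical h, hausdorffMeasure_segment_plane]
  congr 1
  rw [sub_self, zero_pow two_ne_zero, zero_add, Real.sqrt_sq_eq_abs, abs_sub_comm,
    abs_of_nonneg (sub_nonneg.mpr h)]

theorem hausdorffMeasure_hypotenuse {x y : ℝ} (hx : 0 < x) (hy : 0 < y) :
    μH[1] {p : EuclideanSpace ℝ (Fin 2) | 0 ≤ p 0 ∧ 0 ≤ p 1 ∧ y * p 0 + x * p 1 = x * y} =
      ENNReal.ofReal (Real.sqrt (x ^ 2 + y ^ 2)) := by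
  rw [← segment_hypotenuse hx hy, hausdorffMeasure_segment_plane]
  simp

theorem measurableSet_segment_plane (p q : EuclideanSpace ℝ (Fin 2)) :
    MeasurableSet (segment ℝ p q) := by
  rw [segment_eq_image]
  exact (isCompact_Icc.image (by fun_prop)).measurableSet

theorem hausdorffMeasure_union_of_inter_subset_finite
    {s t f : Set (EuclideanSpace ℝ (Fin 2))} (hs : MeasurableSet s) (hf : f.Finite)
    (h : s ∩ t ⊆ f) : (μH[1] (s ∪ t) : ENNReal) = μH[1] s + μH[1] t := by
  have := Measure.nullSingletonClass_hausdorff (EuclideanSpace ℝ (Fin 2)) (d := 1) one_pos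
  have hd : AEDisjoint (μH[1]) s t := measure_mono_null h (hf.measure_zero _)
  rw [Set.union_comm, measure_union₀ hs.nullMeasurableSet hd.symm, add_comm]

/-- The right triangle with legs `x` and `y` along the coordinate axes. -/
def cornerTriangle (x y : ℝ) : Set (EuclideanSpace ℝ (Fin 2)) :=
  halfPlane (-1) 0 0 ∩ (halfPlane 0 (-1) 0 ∩ halfPlane y x (x * y))

/-- The part of `[0,4] × [0,1]` beyond the hypotenuse of `cornerTriangle x y`. -/
def cutRectangle (x y : ℝ) : Set (EuclideanSpace ℝ (Fin 2)) :=
  halfPlane (-1) 0 0 ∩ (halfPlane 0 (-1) 0 ∩ (halfPlane 1 0 4 ∩ (halfPlane 0 1 1 ∩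
    halfPlane (-y) (-x) (-(x * y)))))

theorem interior_cornerTriangle {x : ℝ} (hx : 0 < x) (y : ℝ) :
    interior (cornerTriangle x y) =
      {p | 0 < p 0 ∧ 0 < p 1 ∧ y * p 0 + x * p 1 < x * y} := by
  rw [cornerTriangle, interior_inter, interior_inter, interior_halfPlane (by simp),
    interior_halfPlane (by simp), interior_halfPlane (Or.inr hx.ne')]
  ext p
  simp

theorem interior_cutRectangle {x : ℝ} (hx : 0 < x) (y : ℝ) :
    interior (cutRectangle x y) =
      {p | 0 < p 0 ∧ 0 < p 1 ∧ p 0 < 4 ∧ p 1 < 1 ∧ x * y < y * p 0 + x * p 1} := by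
  rw [cutRectangle, interior_inter, interior_inter, interior_inter, interior_inter,
    interior_halfPlane (by simp), interior_halfPlane (by simp), interior_halfPlane (by simp),
    interior_halfPlane (by simp), interior_halfPlane (Or.inr (neg_ne_zero.mpr hx.ne'))]
  ext p
  simp only [Set.mem_inter_iff, Set.mem_ofPred_eq]
  constructor
  · rintro ⟨h1, h2, h3, h4, h5⟩
    refine ⟨?_, ?_, ?_, ?_, ?_⟩ <;> linarith
  · rintro ⟨h1, h2, h3, h4, h5⟩
    refine ⟨?_, ?_, ?_, ?_, ?_⟩ <;> linarith

theorem mem_cornerTriangle {x y : ℝ} {p : EuclideanSpace ℝ (Fin 2)} :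
    p ∈ cornerTriangle x y ↔ 0 ≤ p 0 ∧ 0 ≤ p 1 ∧ y * p 0 + x * p 1 ≤ x * y := by
  simp [cornerTriangle, halfPlane]

theorem mem_cutRectangle {x y : ℝ} {p : EuclideanSpace ℝ (Fin 2)} :
    p ∈ cutRectangle x y ↔
      0 ≤ p 0 ∧ 0 ≤ p 1 ∧ p 0 ≤ 4 ∧ p 1 ≤ 1 ∧ x * y ≤ y * p 0 + x * p 1 := by
  simp only [cutRectangle, halfPlane, Set.mem_inter_iff, Set.mem_ofPred_eq]
  constructor
  · rintro ⟨h1, h2, h3, h4, h5⟩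
    refine ⟨?_, ?_, ?_, ?_, ?_⟩ <;> linarith
  · rintro ⟨h1, h2, h3, h4, h5⟩
    refine ⟨?_, ?_, ?_, ?_, ?_⟩ <;> linarith

theorem frontier_cornerTriangle {x y : ℝ} (hx : 0 < x) (hy : 0 < y) :
    frontier (cornerTriangle x y) =
      {p | 0 ≤ p 0 ∧ p 0 ≤ x ∧ p 1 = 0} ∪ ({p | 0 ≤ p 1 ∧ p 1 ≤ y ∧ p 0 = 0} ∪
        {p | 0 ≤ p 0 ∧ 0 ≤ p 1 ∧ y * p 0 + x * p 1 = x * y}) := by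
  have hc : IsClosed (cornerTriangle x y) :=
    (isClosed_halfPlane _ _ _).inter ((isClosed_halfPlane _ _ _).inter (isClosed_halfPlane _ _ _))
  rw [hc.frontier_eq, interior_cornerTriangle hx]
  ext p
  simp only [Set.mem_sdiff, mem_cornerTriangle, Set.mem_union, Set.mem_ofPred_eq]
  constructor
  · rintro ⟨⟨h0, h1, h2⟩, hn⟩
    rcases h0.eq_or_lt with e0 | l0
    · exact Or.inr (Or.inl ⟨h1, by rw [← e0] at h2; nlinarith, e0.symm⟩)
    rcases h1.eq_or_lt with e1 | l1
    · exact Or.inl ⟨h0, by rw [← e1] at h2; nlinarith, e1.symm⟩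
    exact Or.inr (Or.inr ⟨h0, h1, h2.eq_of_not_lt fun h => hn ⟨l0, l1, h⟩⟩)
  · rintro (⟨h0, h1, h2⟩ | ⟨h0, h1, h2⟩ | ⟨h0, h1, h2⟩)
    · exact ⟨⟨h0, h2.ge, by rw [h2]; nlinarith⟩, fun h => h.2.1.ne' h2⟩
    · exact ⟨⟨h2.ge, h0, by rw [h2]; nlinarith⟩, fun h => h.1.ne' h2⟩
    · exact ⟨⟨h0, h1, h2.le⟩, fun h => h.2.2.ne h2⟩

theorem frontier_cutRectangle {x y : ℝ} (hx : 0 < x) (hx4 : x ≤ 4) (hy : 0 < y) (hy1 : y ≤ 1) :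
    frontier (cutRectangle x y) =
      {p | x ≤ p 0 ∧ p 0 ≤ 4 ∧ p 1 = 0} ∪ ({p | y ≤ p 1 ∧ p 1 ≤ 1 ∧ p 0 = 0} ∪
        ({p | 0 ≤ p 0 ∧ p 0 ≤ 4 ∧ p 1 = 1} ∪ ({p | 0 ≤ p 1 ∧ p 1 ≤ 1 ∧ p 0 = 4} ∪
          {p | 0 ≤ p 0 ∧ 0 ≤ p 1 ∧ y * p 0 + x * p 1 = x * y}))) := by
  have hc : IsClosed (cutRectangle x y) :=
    (isClosed_halfPlane _ _ _).inter ((isClosed_halfPlane _ _ _).inter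
      ((isClosed_halfPlane _ _ _).inter
        ((isClosed_halfPlane _ _ _).inter (isClosed_halfPlane _ _ _))))
  rw [hc.frontier_eq, interior_cutRectangle hx]
  ext p
  simp only [Set.mem_sdiff, mem_cutRectangle, Set.mem_union, Set.mem_ofPred_eq]
  constructor
  · rintro ⟨⟨h0, h1, h2, h3, h4⟩, hn⟩
    rcases h0.eq_or_lt with e0 | l0
    · exact Or.inr (Or.inl ⟨by rw [← e0] at h4; nlinarith, h3, e0.symm⟩)
    rcases h1.eq_or_lt with e1 | l1
    · exact Or.inl ⟨by rw [← e1] at h4; nlinarith, h2, e1.symm⟩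
    rcases h2.eq_or_lt with e2 | l2
    · exact Or.inr (Or.inr (Or.inr (Or.inl ⟨h1, h3, e2⟩)))
    rcases h3.eq_or_lt with e3 | l3
    · exact Or.inr (Or.inr (Or.inl ⟨h0, h2, e3⟩))
    exact Or.inr (Or.inr (Or.inr (Or.inr
      ⟨h0, h1, (h4.eq_of_not_lt fun h => hn ⟨l0, l1, l2, l3, h⟩).symm⟩)))
  · rintro (⟨h0, h1, h2⟩ | ⟨h0, h1, h2⟩ | ⟨h0, h1, h2⟩ | ⟨h0, h1, h2⟩ | ⟨h0, h1, h2⟩)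
    · exact ⟨⟨by linarith, h2.ge, h1, by linarith, by rw [h2]; nlinarith⟩,
        fun h => h.2.1.ne' h2⟩
    · exact ⟨⟨h2.ge, by linarith, by linarith, h1, by rw [h2]; nlinarith⟩,
        fun h => h.1.ne' h2⟩
    · exact ⟨⟨h0, by linarith, h1, h2.le, by rw [h2]; nlinarith⟩,
        fun h => h.2.2.2.1.ne h2⟩
    · exact ⟨⟨by linarith, h0, h2.le, h1, by rw [h2]; nlinarith⟩,
        fun h => h.2.2.1.ne h2⟩
    · exact ⟨⟨h0, h1, by nlinarith, by nlinarith, h2.ge⟩, fun h => h.2.2.2.2.ne' h2⟩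

theorem eq_plane_of_coords {p : EuclideanSpace ℝ (Fin 2)} {a b : ℝ} (h0 : p 0 = a)
    (h1 : p 1 = b) : p = !₂[a, b] := by
  ext i
  fin_cases i
  · simpa using h0
  · simpa using h1

theorem perimeter_cornerTriangle {x y : ℝ} (hx : 0 < x) (hy : 0 < y) :
    (μH[1] (frontier (cornerTriangle x y))).toReal = x + y + Real.sqrt (x ^ 2 + y ^ 2) := by
  rw [frontier_cornerTriangle hx hy,
    hausdorffMeasure_union_of_inter_subset_finite (f := {!₂[0, 0], !₂[x, 0]})
      (segment_horizontal hx.le 0 ▸ measurableSet_segment_plane _ _) (Set.toFinite _),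
    hausdorffMeasure_union_of_inter_subset_finite (f := {!₂[0, y]})
      (segment_vertical hy.le 0 ▸ measurableSet_segment_plane _ _) (Set.toFinite _),
    hausdorffMeasure_horizontal hx.le, hausdorffMeasure_vertical hy.le,
    hausdorffMeasure_hypotenuse hx hy, ← ENNReal.ofReal_add (by linarith) (by positivity),
    ← ENNReal.ofReal_add (by linarith) (by positivity), ENNReal.toReal_ofReal (by positivity)]
  · ring
  · rintro p ⟨⟨_, _, h⟩, ⟨_, _, h'⟩⟩
    refine eq_plane_of_coords h ?_
    rw [h] at h'
    exact mul_left_cancel₀ hx.ne' (by linarith)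
  · rintro p ⟨⟨_, _, h⟩, ⟨_, _, h'⟩ | ⟨_, _, h'⟩⟩
    · exact Or.inl (eq_plane_of_coords h' h)
    · refine Or.inr (eq_plane_of_coords ?_ h)
      rw [h] at h'
      exact mul_left_cancel₀ hy.ne' (by linarith)

theorem perimeter_cutRectangle {x y : ℝ} (hx : 0 < x) (hx4 : x ≤ 4) (hy : 0 < y)
    (hy1 : y ≤ 1) :
    (μH[1] (frontier (cutRectangle x y))).toReal =
      10 - x - y + Real.sqrt (x ^ 2 + y ^ 2) := by
  have h4 : (0 : ℝ) ≤ 4 := by norm_num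
  rw [frontier_cutRectangle hx hx4 hy hy1,
    hausdorffMeasure_union_of_inter_subset_finite (f := {!₂[4, 0], !₂[x, 0]})
      (segment_horizontal hx4 0 ▸ measurableSet_segment_plane _ _) (Set.toFinite _),
    hausdorffMeasure_union_of_inter_subset_finite (f := {!₂[0, 1], !₂[0, y]})
      (segment_vertical hy1 0 ▸ measurableSet_segment_plane _ _) (Set.toFinite _),
    hausdorffMeasure_union_of_inter_subset_finite (f := {!₂[4, 1], !₂[x - x / y, 1]})
      (segment_horizontal h4 1 ▸ measurableSet_segment_plane _ _) (Set.toFinite _),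
    hausdorffMeasure_union_of_inter_subset_finite (f := {!₂[4, y - 4 * y / x]})
      (segment_vertical zero_le_one 4 ▸ measurableSet_segment_plane _ _) (Set.toFinite _),
    hausdorffMeasure_horizontal hx4, hausdorffMeasure_vertical hy1,
    hausdorffMeasure_horizontal h4, hausdorffMeasure_vertical zero_le_one,
    hausdorffMeasure_hypotenuse hx hy, ← ENNReal.ofReal_add (by linarith) (by positivity),
    ← ENNReal.ofReal_add (by linarith) (by positivity),
    ← ENNReal.ofReal_add (by linarith) (by positivity),
    ← ENNReal.ofReal_add (by linarith) (add_nonneg (by linarith) (by positivity)),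
    ENNReal.toReal_ofReal
      (add_nonneg (by linarith) (add_nonneg (by linarith) (by positivity)))]
  · ring
  · rintro p ⟨⟨_, _, h⟩, ⟨_, _, h'⟩⟩
    refine eq_plane_of_coords h ?_
    rw [h] at h'
    field_simp
    linarith
  · rintro p ⟨⟨_, _, h⟩, ⟨_, _, h'⟩ | ⟨_, _, h'⟩⟩
    · exact Or.inl (eq_plane_of_coords h' h)
    · refine Or.inr (eq_plane_of_coords ?_ h)
      rw [h] at h'
      field_simp
      linarith
  · rintro p ⟨⟨_, _, h⟩, ⟨_, _, h'⟩ | ⟨_, _, h'⟩ | ⟨_, _, h'⟩⟩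
    · exact Or.inl (eq_plane_of_coords h h')
    · linarith
    · refine Or.inr (eq_plane_of_coords h ?_)
      rw [h] at h'
      exact mul_left_cancel₀ hx.ne' (by linarith)
  · rintro p ⟨⟨_, _, h⟩, ⟨_, _, h'⟩ | ⟨_, _, h'⟩ | ⟨_, _, h'⟩ | ⟨_, _, h'⟩⟩
    · linarith
    · linarith
    · exact Or.inl (eq_plane_of_coords h' h)
    · refine Or.inr (eq_plane_of_coords ?_ h)
      rw [h] at h'
      exact mul_left_cancel₀ hy.ne' (by linarith)

theorem volume_plane_eq {s : Set (EuclideanSpace ℝ (Fin 2))} {t : Set (ℝ × ℝ)}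
    (h : ∀ p, p ∈ s ↔ (p 0, p 1) ∈ t) : volume s = volume t := by
  have hm := (volume_preserving_finTwoArrow ℝ).comp
    (EuclideanSpace.volume_preserving_symm_measurableEquiv_toLp (Fin 2))
  have hs : s = ((MeasurableEquiv.toLp 2 (Fin 2 → ℝ)).symm.trans
      MeasurableEquiv.finTwoArrow) ⁻¹' t := by
    ext p
    exact h p
  rw [hs]
  exact MeasurePreserving.measure_preimage_equiv hm t

theorem volume_rectR : volume rectR = 4 := by
  rw [volume_plane_eq (s := rectR) (t := Set.Icc 0 4 ×ˢ Set.Icc 0 1) (fun p => Iff.rfl),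
    Measure.volume_eq_prod, Measure.prod_prod]
  simp

theorem volume_cornerTriangle {x y : ℝ} (hx : 0 < x) (hy : 0 < y) :
    volume (cornerTriangle x y) = ENNReal.ofReal (x * y / 2) := by
  have hclosed : IsClosed {q : ℝ × ℝ | 0 ≤ q.1 ∧ 0 ≤ q.2 ∧ y * q.1 + x * q.2 ≤ x * y} := by
    simp only [Set.ofPred_and]
    exact (isClosed_le (by fun_prop) (by fun_prop)).inter
      ((isClosed_le (by fun_prop) (by fun_prop)).inter
        (isClosed_le (by fun_prop) (by fun_prop)))
  rw [volume_plane_eq (t := {q : ℝ × ℝ | 0 ≤ q.1 ∧ 0 ≤ q.2 ∧ y * q.1 + x * q.2 ≤ x * y})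
    (fun p => mem_cornerTriangle), Measure.volume_eq_prod,
    Measure.prod_apply hclosed.measurableSet]
  have hslice : ∀ u : ℝ, volume (Prod.mk u ⁻¹'
      {q : ℝ × ℝ | 0 ≤ q.1 ∧ 0 ≤ q.2 ∧ y * q.1 + x * q.2 ≤ x * y}) =
      (Set.Icc 0 x).indicator (fun u => ENNReal.ofReal (y - y / x * u)) u := by
    intro u
    by_cases hu : 0 ≤ u
    · have hset : Prod.mk u ⁻¹' {q : ℝ × ℝ | 0 ≤ q.1 ∧ 0 ≤ q.2 ∧ y * q.1 + x * q.2 ≤ x * y} =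
          Set.Icc 0 (y - y / x * u) := by
        ext v
        have hiff : y * u + x * v ≤ x * y ↔ v ≤ y - y / x * u := by
          rw [← mul_le_mul_iff_right₀ hx (b := v)]
          have : x * (y - y / x * u) = x * y - y * u := by field_simp
          rw [this]
          constructor <;> intro h <;> linarith
        simp [hu, hiff]
      rw [hset, Real.volume_Icc, sub_zero]
      by_cases hux : u ≤ x
      · rw [Set.indicator_of_mem (Set.mem_Icc.mpr ⟨hu, hux⟩)]
      · rw [Set.indicator_of_notMem (fun h => hux h.2), ENNReal.ofReal_eq_zero]
        have : y = y / x * x := by field_simp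
        have : 0 < y / x := by positivity
        nlinarith
    · rw [Set.indicator_of_notMem (fun h => hu h.1)]
      convert measure_empty (μ := (volume : Measure ℝ))
      ext v
      simp [hu]
  simp_rw [hslice]
  rw [lintegral_indicator measurableSet_Icc, ← ofReal_integral_eq_lintegral_ofReal]
  · congr 1
    rw [integral_Icc_eq_integral_Ioc, ← intervalIntegral.integral_of_le hx.le,
      intervalIntegral.integral_sub (by simp) ((by fun_prop : Continuous _).intervalIntegrable _ _),
      intervalIntegral.integral_const, intervalIntegral.integral_const_mul, integral_id]
    simp only [smul_eq_mul]
    field_simp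
    ring
  · exact (by fun_prop : Continuous fun u : ℝ => y - y / x * u).continuousOn.integrableOn_Icc
  · refine (ae_restrict_iff' measurableSet_Icc).mpr (Filter.Eventually.of_forall fun u hu => ?_)
    have : y = y / x * x := by field_simp
    have : 0 < y / x := by positivity
    have := hu.2
    simp only [Pi.zero_apply]
    nlinarith

theorem cornerTriangle_union_cutRectangle {x y : ℝ} (hx : 0 < x) (hx4 : x ≤ 4) (hy : 0 < y)
    (hy1 : y ≤ 1) : cornerTriangle x y ∪ cutRectangle x y = rectR := by
  ext p
  simp only [Set.mem_union, mem_cornerTriangle, mem_cutRectangle, rectR, Set.mem_ofPred_eq,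
    Set.mem_Icc]
  constructor
  · rintro (⟨h0, h1, h2⟩ | ⟨h0, h1, h2, h3, _⟩)
    · exact ⟨⟨h0, by nlinarith⟩, h1, by nlinarith⟩
    · exact ⟨⟨h0, h2⟩, h1, h3⟩
  · rintro ⟨⟨h0, h2⟩, h1, h3⟩
    rcases le_total (y * p 0 + x * p 1) (x * y) with h | h
    · exact Or.inl ⟨h0, h1, h⟩
    · exact Or.inr ⟨h0, h1, h2, h3, h⟩

/-- Some right triangle of area `1` whose legs fit the rectangle has the required perimeter. -/
theorem exists_legs : ∃ x y : ℝ, 0 < x ∧ x ≤ 4 ∧ 0 < y ∧ y ≤ 1 ∧ x * y = 2 ∧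
    Real.sqrt 3 * (x + y + Real.sqrt (x ^ 2 + y ^ 2)) =
      10 - x - y + Real.sqrt (x ^ 2 + y ^ 2) := by
  let g : ℝ → ℝ := fun t => Real.sqrt 3 * (t + 2 / t + Real.sqrt (t ^ 2 + (2 / t) ^ 2)) -
    (10 - t - 2 / t + Real.sqrt (t ^ 2 + (2 / t) ^ 2))
  have hdiv : ContinuousOn (fun t : ℝ => 2 / t) (Set.Icc 2 4) :=
    continuousOn_const.div continuousOn_id fun t ht => by
      have := ht.1
      linarith
  have hg : ContinuousOn g (Set.Icc 2 4) := by
    dsimp only [g]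
    fun_prop
  have hs3 : Real.sqrt 3 < 1.7321 := by
    rw [Real.sqrt_lt' (by norm_num)]; norm_num
  have hs3' : 1.7 < Real.sqrt 3 := by
    rw [Real.lt_sqrt (by norm_num)]; norm_num
  have h2 : g 2 ≤ 0 := by
    have hs5 : Real.sqrt 5 < 2.2361 := by
      rw [Real.sqrt_lt' (by norm_num)]; norm_num
    have hs5' : 0 ≤ Real.sqrt 5 := Real.sqrt_nonneg 5
    have : (2 : ℝ) ^ 2 + (2 / 2) ^ 2 = 5 := by norm_num
    simp only [g, this]
    nlinarith
  have h4 : 0 ≤ g 4 := by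
    have hs : 4 ≤ Real.sqrt ((4 : ℝ) ^ 2 + (2 / 4) ^ 2) := by
      apply Real.le_sqrt_of_sq_le; norm_num
    simp only [g]
    nlinarith
  obtain ⟨t, ⟨ht2, ht4⟩, ht⟩ := intermediate_value_Icc (by norm_num) hg ⟨h2, h4⟩
  have ht0 : 0 < t := by linarith
  refine ⟨t, 2 / t, ht0, ht4, by positivity, ?_, by field_simp, sub_eq_zero.mp ht⟩
  rw [div_le_one ht0]
  exact ht2

/-- There exist two convex pieces `P₁, P₂` partitioning the rectangle `[0,4] × [0,1]`
(disjoint interiors, union the whole rectangle) with area of `P₁` equal to a quarter of the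
area of the rectangle (areas in ratio `1 : 3`) and with the perimeters of the pieces in ratio
`1 : √3`. -/
theorem scaled_fair_partition_of_1x4_rectangle :
    ∃ P₁ P₂ : Set (EuclideanSpace ℝ (Fin 2)),
      Convex ℝ P₁ ∧ Convex ℝ P₂ ∧
      interior P₁ ∩ interior P₂ = ∅ ∧
      P₁ ∪ P₂ = rectR ∧
      volume P₁ = volume rectR / 4 ∧
      (μH[1] (frontier P₁)).toReal / (μH[1] (frontier P₂)).toReal = 1 / Real.sqrt 3 := by
  obtain ⟨x, y, hx, hx4, hy, hy1, hxy, hper⟩ := exists_legs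
  refine ⟨cornerTriangle x y, cutRectangle x y, ?_, ?_, ?_,
    cornerTriangle_union_cutRectangle hx hx4 hy hy1, ?_, ?_⟩
  · exact (convex_halfPlane _ _ _).inter ((convex_halfPlane _ _ _).inter (convex_halfPlane _ _ _))
  · exact (convex_halfPlane _ _ _).inter ((convex_halfPlane _ _ _).inter
      ((convex_halfPlane _ _ _).inter
        ((convex_halfPlane _ _ _).inter (convex_halfPlane _ _ _))))
  · rw [interior_cornerTriangle hx, interior_cutRectangle hx, Set.eq_empty_iff_forall_notMem]
    rintro p ⟨⟨_, _, h⟩, _, _, _, _, h'⟩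
    exact lt_asymm h h'
  · rw [volume_cornerTriangle hx hy, volume_rectR, hxy,
      ENNReal.div_self (by norm_num) (by norm_num)]
    simp
  · rw [perimeter_cornerTriangle hx hy, perimeter_cutRectangle hx hx4 hy hy1, ← hper]
    field_simp
end

section
/- Let K and L be compact convex subsets of ℝ² of constant width 1. Then for every real number a with area(K) ≤ a ≤ area(L), there exists a compact convex subset of ℝ² of constant width 1 whose area equals a. In particular, the set of areas of constant-width-1 planar convex bodies contains the full interval between the area of any two such bodies. -/
open MeasureTheory
open scoped RealInnerProductSpace

/-- The width of a planar set `K` in the direction `u`: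
`sup {⟪u, x⟫ : x ∈ K} − inf {⟪u, x⟫ : x ∈ K}`. -/
noncomputable def dirWidth (K : Set (EuclideanSpace ℝ (Fin 2)))
    (u : EuclideanSpace ℝ (Fin 2)) : ℝ :=
  sSup ((fun x => ⟪u, x⟫) '' K) - sInf ((fun x => ⟪u, x⟫) '' K)

open scoped Pointwise Topology
open Set Filter

section MinkowskiInterpolation

variable {E : Type*} [NormedAddCommGroup E] [NormedSpace ℝ E] {K L : Set E}

/-- The Minkowski interpolation `(1 - t) K + t L`. -/
def minkowskiInterp (K L : Set E) (t : ℝ) : Set E := (1 - t) • K + t • L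

lemma minkowskiInterp_swap (K L : Set E) (t : ℝ) :
    minkowskiInterp L K (1 - t) = minkowskiInterp K L t := by
  simp [minkowskiInterp, add_comm]

lemma IsCompact.minkowskiInterp (hK : IsCompact K) (hL : IsCompact L) (t : ℝ) :
    IsCompact (minkowskiInterp K L t) :=
  (hK.smul _).add (hL.smul _)

lemma Convex.minkowskiInterp (hK : Convex ℝ K) (hL : Convex ℝ L) (t : ℝ) :
    Convex ℝ (minkowskiInterp K L t) :=
  (hK.smul _).add (hL.smul _)

/-- The interpolation parameters together with the points of the interpolated bodies form a
compact set. -/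
lemma isCompact_minkowskiInterp_graph (hK : IsCompact K) (hL : IsCompact L) :
    IsCompact {p : ℝ × E | p.1 ∈ Icc (0 : ℝ) 1 ∧ p.2 ∈ minkowskiInterp K L p.1} := by
  have h : IsCompact ((fun q : ℝ × E × E => (q.1, (1 - q.1) • q.2.1 + q.1 • q.2.2)) ''
      (Icc (0 : ℝ) 1 ×ˢ (K ×ˢ L))) :=
    (isCompact_Icc.prod (hK.prod hL)).image (by fun_prop)
  convert h using 1
  ext ⟨t, x⟩
  constructor
  · rintro ⟨ht, _, ⟨k, hk, rfl⟩, _, ⟨l, hl, rfl⟩, h⟩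
    exact ⟨(t, k, l), ⟨ht, hk, hl⟩, Prod.ext rfl h⟩
  · rintro ⟨⟨s, k, l⟩, ⟨hs, hk, hl⟩, h⟩
    obtain ⟨rfl, rfl⟩ := Prod.mk.inj h
    exact ⟨hs, add_mem_add (smul_mem_smul_set hk) (smul_mem_smul_set hl)⟩

lemma eventually_notMem_minkowskiInterp (hK : IsCompact K) (hL : IsCompact L) {s : ℝ} {x : E}
    (hx : x ∉ minkowskiInterp K L s) :
    ∀ᶠ t in 𝓝[Icc 0 1] s, x ∉ minkowskiInterp K L t := by
  have h := (isCompact_minkowskiInterp_graph hK hL).isClosed.isOpen_compl.mem_nhds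
    (x := (s, x)) (fun h => hx h.2)
  have hc : ContinuousAt (fun t : ℝ => (t, x)) s := by fun_prop
  filter_upwards [nhdsWithin_le_nhds (hc h), self_mem_nhdsWithin] with t ht ht' hxt
  exact ht ⟨ht', hxt⟩

lemma eventually_mem_minkowskiInterp_right (hL : Convex ℝ L) (hLne : L.Nonempty) {s : ℝ}
    (hs : s ∈ Icc (0 : ℝ) 1) {x : E} (hx : x ∈ interior (minkowskiInterp K L s)) :
    ∀ᶠ t in 𝓝[Icc 0 1] s, s ≤ t → x ∈ minkowskiInterp K L t := by
  obtain ⟨l, hl⟩ := hLne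
  have hc : ContinuousAt (fun t : ℝ =>
      (1 - (t - s) / (1 - s))⁻¹ • (x - ((t - s) / (1 - s)) • l)) s := by
    refine ContinuousAt.smul (ContinuousAt.inv₀ (by fun_prop) (by simp)) (by fun_prop)
  have hmem := hc.preimage_mem_nhds (t := minkowskiInterp K L s)
    (by simpa using mem_interior_iff_mem_nhds.1 hx)
  have hlt : ∀ᶠ t in 𝓝 s, (t - s) / (1 - s) < 1 := by
    have hc' : ContinuousAt (fun t : ℝ => (t - s) / (1 - s)) s := by fun_prop
    exact hc'.eventually_lt continuousAt_const (by simp)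
  filter_upwards [nhdsWithin_le_nhds hmem, nhdsWithin_le_nhds hlt, self_mem_nhdsWithin]
    with t ht hr1 ht1 hst
  have hr0 : 0 ≤ (t - s) / (1 - s) := div_nonneg (sub_nonneg.2 hst) (sub_nonneg.2 hs.2)
  have hr : (t - s) / (1 - s) * (1 - s) = t - s := by
    rcases eq_or_ne (1 - s) 0 with h | h
    · rw [h]; linarith [ht1.2]
    · field_simp
  simp only [mem_preimage] at ht
  set r := (t - s) / (1 - s)
  obtain ⟨_, ⟨k, hk, rfl⟩, _, ⟨l', hl', rfl⟩, h⟩ := ht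
  have hxe : x = (1 - t) • k + (((1 - r) * s) • l' + r • l) := by
    have h' : (1 - r) • ((1 - s) • k + s • l') = x - r • l := by
      have := congrArg ((1 - r) • ·) h
      simpa [smul_smul, mul_inv_cancel₀ (sub_pos.2 hr1).ne'] using this
    have hk' : 1 - t = (1 - r) * (1 - s) := by linear_combination hr
    rw [hk', ← add_assoc, mul_smul, mul_smul, ← smul_add, h', sub_add_cancel]
  have hts : t = (1 - r) * s + r := by linear_combination -hr
  rw [hxe]
  refine add_mem_add (smul_mem_smul_set hk) ?_
  rw [hts, hL.add_smul (mul_nonneg (sub_nonneg.2 hr1.le) hs.1) hr0]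
  exact add_mem_add (smul_mem_smul_set hl') (smul_mem_smul_set hl)

lemma eventually_mem_minkowskiInterp (hK : Convex ℝ K) (hL : Convex ℝ L) (hKne : K.Nonempty)
    (hLne : L.Nonempty) {s : ℝ} (hs : s ∈ Icc (0 : ℝ) 1) {x : E}
    (hx : x ∈ interior (minkowskiInterp K L s)) :
    ∀ᶠ t in 𝓝[Icc 0 1] s, x ∈ minkowskiInterp K L t := by
  have hleft := eventually_mem_minkowskiInterp_right (K := L) hK hKne (s := 1 - s)
    ⟨sub_nonneg.2 hs.2, sub_le_self _ hs.1⟩ (x := x) (by rwa [minkowskiInterp_swap])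
  have htend : Tendsto (fun t : ℝ => 1 - t) (𝓝[Icc 0 1] s) (𝓝[Icc 0 1] (1 - s)) := by
    refine ContinuousWithinAt.tendsto_nhdsWithin (by fun_prop) ?_
    exact fun t ht => ⟨sub_nonneg.2 ht.2, sub_le_self _ ht.1⟩
  filter_upwards [eventually_mem_minkowskiInterp_right hL hLne hs hx, htend.eventually hleft]
    with t h₁ h₂
  rcases le_total s t with h | h
  · exact h₁ h
  · rw [← minkowskiInterp_swap]
    exact h₂ (by linarith)

/-- The volume of `(1 - t) K + t L` depends continuously on `t ∈ [0, 1]`. -/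
lemma continuousOn_volume_minkowskiInterp [FiniteDimensional ℝ E] [MeasurableSpace E]
    [BorelSpace E] (μ : Measure E) [μ.IsAddHaarMeasure]
    (hKc : IsCompact K) (hLc : IsCompact L) (hK : Convex ℝ K) (hL : Convex ℝ L)
    (hKne : K.Nonempty) (hLne : L.Nonempty) :
    ContinuousOn (fun t => (μ (minkowskiInterp K L t)).toReal) (Icc 0 1) := by
  intro s hs
  have hB := (isCompact_minkowskiInterp_graph hKc hLc).image continuous_snd
  refine (ENNReal.tendsto_toReal (hKc.minkowskiInterp hLc s).measure_ne_top).comp ?_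
  refine tendsto_measure_of_ae_tendsto_indicator _ (hKc.minkowskiInterp hLc s).measurableSet
    (fun t => (hKc.minkowskiInterp hLc t).measurableSet) hB.measurableSet hB.measure_ne_top ?_ ?_
  · filter_upwards [self_mem_nhdsWithin] with t ht x hx
    exact ⟨(t, x), ⟨ht, hx⟩, rfl⟩
  · have hfr : ∀ᵐ x ∂μ, x ∉ frontier (minkowskiInterp K L s) :=
      measure_eq_zero_iff_ae_notMem.1 ((hK.minkowskiInterp hL s).addHaar_frontier μ)
    filter_upwards [hfr] with x hx
    by_cases hxs : x ∈ minkowskiInterp K L s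
    · have hxi : x ∈ interior (minkowskiInterp K L s) := by
        by_contra h
        exact hx ⟨subset_closure hxs, h⟩
      filter_upwards [eventually_mem_minkowskiInterp hK hL hKne hLne hs hxi] with t ht
      exact iff_of_true ht hxs
    · filter_upwards [eventually_notMem_minkowskiInterp hKc hLc hxs] with t ht
      exact iff_of_false ht hxs

end MinkowskiInterpolation

lemma nonempty_of_dirWidth_eq_one {K : Set (EuclideanSpace ℝ (Fin 2))}
    (hK : ∀ u : EuclideanSpace ℝ (Fin 2), ‖u‖ = 1 → dirWidth K u = 1) : K.Nonempty := by
  by_contra h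
  rw [not_nonempty_iff_eq_empty] at h
  have := hK (EuclideanSpace.single 0 1) (by simp)
  simp [dirWidth, h] at this

lemma dirWidth_minkowskiInterp {K L : Set (EuclideanSpace ℝ (Fin 2))}
    (hK : IsCompact K) (hL : IsCompact L) (hKne : K.Nonempty) (hLne : L.Nonempty) {t : ℝ}
    (ht : t ∈ Icc (0 : ℝ) 1) (u : EuclideanSpace ℝ (Fin 2)) :
    dirWidth (minkowskiInterp K L t) u = (1 - t) * dirWidth K u + t * dirWidth L u := by
  have himg : (fun x => ⟪u, x⟫) '' minkowskiInterp K L t =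
      (1 - t) • ((fun x => ⟪u, x⟫) '' K) + t • ((fun x => ⟪u, x⟫) '' L) := by
    change innerSL ℝ u '' _ = (1 - t) • (innerSL ℝ u '' K) + t • (innerSL ℝ u '' L)
    rw [minkowskiInterp, image_add, image_smul_set, image_smul_set]
  have hc (s : Set (EuclideanSpace ℝ (Fin 2))) (hs : IsCompact s) (c : ℝ) :
      IsCompact (c • ((fun x => ⟪u, x⟫) '' s)) :=
    (hs.image (by fun_prop)).smul c
  have hn (s : Set (EuclideanSpace ℝ (Fin 2))) (hs : s.Nonempty) (c : ℝ) :
      (c • ((fun x => ⟪u, x⟫) '' s)).Nonempty := (hs.image _).smul_set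
  have ht' : 0 ≤ 1 - t := sub_nonneg.2 ht.2
  unfold dirWidth
  rw [himg, csSup_add (hn K hKne _) (hc K hK _).bddAbove (hn L hLne _) (hc L hL _).bddAbove,
    csInf_add (hn K hKne _) (hc K hK _).bddBelow (hn L hLne _) (hc L hL _).bddBelow,
    Real.sSup_smul_of_nonneg ht', Real.sSup_smul_of_nonneg ht.1,
    Real.sInf_smul_of_nonneg ht', Real.sInf_smul_of_nonneg ht.1]
  simp only [smul_eq_mul]
  ring

/-- If `K` and `L` are compact convex planar bodies of constant width `1`, then every real
number `a` between `area K` and `area L` is the area of some compact convex planar body of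
constant width `1`. -/
theorem exists_constant_width_body_of_intermediate_area
    (K L : Set (EuclideanSpace ℝ (Fin 2)))
    (hKcomp : IsCompact K) (hKconv : Convex ℝ K)
    (hLcomp : IsCompact L) (hLconv : Convex ℝ L)
    (hKw : ∀ u : EuclideanSpace ℝ (Fin 2), ‖u‖ = 1 → dirWidth K u = 1)
    (hLw : ∀ u : EuclideanSpace ℝ (Fin 2), ‖u‖ = 1 → dirWidth L u = 1)
    (a : ℝ) (ha : (volume K).toReal ≤ a) (ha' : a ≤ (volume L).toReal) :
    ∃ M : Set (EuclideanSpace ℝ (Fin 2)),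
      IsCompact M ∧ Convex ℝ M ∧
      (∀ u : EuclideanSpace ℝ (Fin 2), ‖u‖ = 1 → dirWidth M u = 1) ∧
      (volume M).toReal = a := by
  have hKne := nonempty_of_dirWidth_eq_one hKw
  have hLne := nonempty_of_dirWidth_eq_one hLw
  have h0 : minkowskiInterp K L 0 = K := by
    simp [minkowskiInterp, zero_smul_set hLne]
  have h1 : minkowskiInterp K L 1 = L := by
    simp [minkowskiInterp, zero_smul_set hKne]
  obtain ⟨t, ht, hta⟩ := intermediate_value_Icc zero_le_one
    (continuousOn_volume_minkowskiInterp volume hKcomp hLcomp hKconv hLconv hKne hLne)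
    (show a ∈ Icc _ _ by simpa only [h0, h1, mem_Icc] using And.intro ha ha')
  refine ⟨minkowskiInterp K L t, hKcomp.minkowskiInterp hLcomp t,
    hKconv.minkowskiInterp hLconv t, fun u hu => ?_, hta⟩
  rw [dirWidth_minkowskiInterp hKcomp hLcomp hKne hLne ht, hKw u hu, hLw u hu]
  ring
end

section
/- For every compact convex set K ⊆ ℝ² with nonempty interior, the diameter of K is at least the perimeter of K divided by π. -/
open MeasureTheory

/-- The one-dimensional Hausdorff measure of a curve is at most its total variation. -/
theorem hausdorffMeasure_image_le_eVariationOn {E : Type*} [MetricSpace E] [MeasurableSpace E]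
    [BorelSpace E] (f : ℝ → E) (s : Set ℝ) : μH[1] (f '' s) ≤ eVariationOn f s := by
  rcases s.eq_empty_or_nonempty with rfl | ⟨a, ha⟩
  · simp
  by_cases hfin : BoundedVariationOn f s
  swap
  · rw [BoundedVariationOn, not_not] at hfin
    simp [hfin]
  have hloc := hfin.locallyBoundedVariationOn
  set V := variationOnFromTo f s a with hV
  set φ := naturalParameterization f s a with hφ
  have hunit : HasUnitSpeedOn φ (V '' s) := has_unit_speed_naturalParameterization f hloc ha
  have hlip : LipschitzOnWith 1 φ (V '' s) := by
    have key : ∀ x ∈ V '' s, ∀ y ∈ V '' s, x ≤ y → edist (φ x) (φ y) ≤ edist x y := by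
      intro x hx y hy hxy
      have h := (hasConstantSpeedOnWith_iff_ordered.1 hunit) hx hy hxy
      calc edist (φ x) (φ y) ≤ eVariationOn φ (V '' s ∩ Set.Icc x y) :=
            eVariationOn.edist_le _ ⟨hx, le_rfl, hxy⟩ ⟨hy, hxy, le_rfl⟩
        _ = edist x y := by
            rw [h, edist_comm, edist_dist, Real.dist_eq, abs_of_nonneg (sub_nonneg.2 hxy)]
            simp
    intro x hx y hy
    rw [ENNReal.coe_one, one_mul]
    rcases le_total x y with h | h
    · exact key x hx y hy h
    · rw [edist_comm, edist_comm x]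
      exact key y hy x hx h
  have himage : f '' s = φ '' (V '' s) := by
    rw [Set.image_image]
    refine Set.image_congr fun x hx => ?_
    exact (edist_eq_zero.1 (edist_naturalParameterization_eq_zero hloc ha hx)).symm
  have hsub : ∀ x ∈ s, ∀ y ∈ s, x ≤ y → edist (V x) (V y) ≤ eVariationOn f s := by
    intro x hx y hy hxy
    have h1 : V y - V x = variationOnFromTo f s x y :=
      variationOnFromTo.sub_right hloc ha hy hx
    rw [edist_comm, edist_dist, Real.dist_eq, h1]
    refine ENNReal.ofReal_le_of_le_toReal ?_
    exact variationOnFromTo.abs_le_eVariationOn hfin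
  calc μH[1] (f '' s) ≤ μH[1] (V '' s) := by
        rw [himage]
        simpa using hlip.hausdorffMeasure_image_le zero_le_one
    _ = volume (V '' s) := by rw [hausdorffMeasure_real]
    _ ≤ Metric.ediam (V '' s) := Real.volume_le_diam _
    _ ≤ eVariationOn f s := by
        refine Metric.ediam_le ?_
        rintro _ ⟨x, hx, rfl⟩ _ ⟨y, hy, rfl⟩
        rcases le_total x y with h | h
        · exact hsub x hx y hy h
        · rw [edist_comm]
          exact hsub y hy x hx h

/-- A monotone sequence in `[a, b]` can be extended to one which starts at `a` and ends at `b`. -/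
theorem exists_monotone_endpoints_sum_edist_le {E : Type*} [PseudoEMetricSpace E] (f : ℝ → E)
    {a b : ℝ} {u : ℕ → ℝ} (hu : Monotone u) (hmem : ∀ i, u i ∈ Set.Icc a b) (n : ℕ) :
    ∃ w : ℕ → ℝ, ∃ m : ℕ, Monotone w ∧ (∀ i, w i ∈ Set.Icc a b) ∧ w 0 = a ∧ w m = b ∧
      ∑ i ∈ Finset.range n, edist (f (u (i + 1))) (f (u i)) ≤
        ∑ i ∈ Finset.range m, edist (f (w (i + 1))) (f (w i)) := by
  have hab : a ≤ b := (hmem 0).1.trans (hmem 0).2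
  refine ⟨fun i => if i = 0 then a else if i ≤ n + 1 then u (i - 1) else b, n + 2, ?_, ?_,
    by simp, by simp, ?_⟩
  · refine monotone_nat_of_le_succ fun i => ?_
    have h1 := hmem i
    have h2 := hmem (i - 1)
    have h3 : u (i - 1) ≤ u i := hu (Nat.sub_le _ _)
    simp only [Set.mem_Icc] at h1 h2
    split_ifs <;> simp_all
    omega
  · intro i
    have h2 := hmem (i - 1)
    simp only [Set.mem_Icc] at h2 ⊢
    split_ifs <;> simp_all
  · rw [Finset.sum_range_succ, Finset.sum_range_succ']
    refine le_trans (le_of_eq ?_) (le_self_add.trans le_self_add)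
    refine Finset.sum_congr rfl fun i hi => ?_
    have := Finset.mem_range.1 hi
    simp [this, this.le]

/-- The sum of two total variations and a constant is bounded by testing on partitions containing both
endpoints. -/
theorem eVariationOn_Icc_add_le {E F : Type*} [PseudoEMetricSpace E] [PseudoEMetricSpace F]
    {f : ℝ → E} {g : ℝ → F} {a b : ℝ} (hab : a ≤ b) {c C : ENNReal}
    (h : ∀ (v w : ℕ → ℝ) (m n : ℕ), Monotone v → (∀ i, v i ∈ Set.Icc a b) → v 0 = a → v m = b →
      Monotone w → (∀ i, w i ∈ Set.Icc a b) → w 0 = a → w n = b →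
      ∑ i ∈ Finset.range m, edist (f (v (i + 1))) (f (v i)) +
        ∑ i ∈ Finset.range n, edist (g (w (i + 1))) (g (w i)) + c ≤ C) :
    eVariationOn f (Set.Icc a b) + eVariationOn g (Set.Icc a b) + c ≤ C := by
  have : Nonempty {u : ℕ → ℝ // Monotone u ∧ ∀ i, u i ∈ Set.Icc a b} :=
    ⟨fun _ => a, monotone_const, fun _ => ⟨le_rfl, hab⟩⟩
  rw [add_assoc, eVariationOn, eVariationOn, ENNReal.iSup_add (a := c)]
  refine ENNReal.iSup_add_iSup_le ?_
  rintro ⟨m, u, hu, hmem⟩ ⟨n, u', hu', hmem'⟩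
  obtain ⟨v, m', hv, hvmem, hv0, hvm, hle⟩ := exists_monotone_endpoints_sum_edist_le f hu hmem m
  obtain ⟨w, n', hw, hwmem, hw0, hwn, hle'⟩ :=
    exists_monotone_endpoints_sum_edist_le g hu' hmem' n
  rw [← add_assoc]
  exact (add_le_add_left (add_le_add hle hle') c).trans (h v w m' n' hv hvmem hv0 hvm hw hwmem hw0 hwn)

/-- The variation of a unimodal finite sequence bounded above by `M`. -/
theorem sum_abs_sub_le_of_unimodal (x : ℕ → ℝ) (n : ℕ) :
    ∀ M : ℝ, (∀ i ≤ n, x i ≤ M) →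
      (∀ i j k, i ≤ j → j ≤ k → k ≤ n → min (x i) (x k) ≤ x j) →
      ∑ i ∈ Finset.range n, |x (i + 1) - x i| ≤ 2 * M - x 0 - x n := by
  induction n with
  | zero =>
    intro M hM _
    have := hM 0 le_rfl
    simp only [Finset.range_zero, Finset.sum_empty]
    linarith
  | succ n ih =>
    intro M hM hx
    have hx' : ∀ i j k, i ≤ j → j ≤ k → k ≤ n → min (x i) (x k) ≤ x j :=
      fun i j k hij hjk hk => hx i j k hij hjk (by omega)
    rw [Finset.sum_range_succ]
    rcases le_or_gt (x (n + 1)) (x n) with h | h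
    · have := ih M (fun i hi => hM i (by omega)) hx'
      rw [abs_of_nonpos (by linarith)]
      linarith
    · have := ih (x n) (fun i hi => by
        rcases min_le_iff.1 (hx i n (n + 1) hi (by omega) le_rfl) with h' | h'
        · exact h'
        · linarith) hx'
      have := hM (n + 1) le_rfl
      rw [abs_of_pos (by linarith)]
      linarith

/-- Up to a factor two, the norm of a planar vector is the integral of the absolute values of its
components in all directions. -/
theorem integral_abs_cos_add_sin (v : EuclideanSpace ℝ (Fin 2)) :
    ∫ θ in (0 : ℝ)..Real.pi, |v 0 * Real.cos θ + v 1 * Real.sin θ| = 2 * ‖v‖ := by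
  set z : ℂ := ⟨v 0, v 1⟩ with hz
  have hnorm : ‖z‖ = ‖v‖ := by
    rw [Complex.norm_eq_sqrt_sq_add_sq, EuclideanSpace.norm_eq]
    simp [hz, Fin.sum_univ_two]
  have h0 : v 0 = ‖v‖ * Real.cos z.arg := by rw [← hnorm, Complex.norm_mul_cos_arg]
  have h1 : v 1 = ‖v‖ * Real.sin z.arg := by rw [← hnorm, Complex.norm_mul_sin_arg]
  have hfun : ∀ θ, |v 0 * Real.cos θ + v 1 * Real.sin θ| = ‖v‖ * |Real.cos (θ - z.arg)| := by
    intro θ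
    rw [Real.cos_sub, ← abs_of_nonneg (norm_nonneg v), ← abs_mul]
    congr 1
    linear_combination Real.cos θ * h0 + Real.sin θ * h1
  have hper : Function.Periodic (fun θ => |Real.cos θ|) Real.pi := by
    intro θ
    simp [Real.cos_add_pi]
  have hcos : ∫ θ in (-(Real.pi / 2))..(Real.pi / 2), |Real.cos θ| = 2 := by
    have : ∫ θ in (-(Real.pi / 2))..(Real.pi / 2), |Real.cos θ|
        = ∫ θ in (-(Real.pi / 2))..(Real.pi / 2), Real.cos θ := by
      refine intervalIntegral.integral_congr fun θ hθ => ?_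
      rw [Set.uIcc_of_le (by linarith [Real.pi_pos])] at hθ
      exact abs_of_nonneg (Real.cos_nonneg_of_mem_Icc hθ)
    rw [this, integral_cos]
    simp
    norm_num
  simp_rw [hfun]
  rw [intervalIntegral.integral_const_mul,
    intervalIntegral.integral_comp_sub_right (fun θ => |Real.cos θ|)]
  have := hper.intervalIntegral_add_eq (0 - z.arg) (-(Real.pi / 2))
  rw [show 0 - z.arg + Real.pi = Real.pi - z.arg by ring,
    show -(Real.pi / 2) + Real.pi = Real.pi / 2 by ring, hcos] at this
  rw [this, mul_comm]

/-- A finite family of planar vectors whose total component in each direction of the upper half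
circle is at most `C` has total length at most `π / 2 * C`. -/
theorem sum_norm_le_of_sum_abs_le {ι : Type*} (s : Finset ι) (v : ι → EuclideanSpace ℝ (Fin 2))
    (C : ℝ) (h : ∀ θ ∈ Set.Icc 0 Real.pi,
      ∑ i ∈ s, |v i 0 * Real.cos θ + v i 1 * Real.sin θ| ≤ C) :
    ∑ i ∈ s, ‖v i‖ ≤ Real.pi / 2 * C := by
  have hint : ∀ i ∈ s, IntervalIntegrable
      (fun θ => |v i 0 * Real.cos θ + v i 1 * Real.sin θ|) volume 0 Real.pi :=
    fun i _ => Continuous.intervalIntegrable (by fun_prop) _ _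
  have hsum : ∫ θ in (0 : ℝ)..Real.pi, ∑ i ∈ s, |v i 0 * Real.cos θ + v i 1 * Real.sin θ|
      = 2 * ∑ i ∈ s, ‖v i‖ := by
    rw [intervalIntegral.integral_finsetSum hint, Finset.mul_sum]
    simp_rw [integral_abs_cos_add_sin]
  have hle := intervalIntegral.integral_mono_on (μ := volume) Real.pi_pos.le
    (Continuous.intervalIntegrable (by fun_prop) _ _)
    (Continuous.intervalIntegrable continuous_const _ _) h
  rw [hsum, intervalIntegral.integral_const, sub_zero, smul_eq_mul] at hle
  linarith

/-- The points of a compact set with prescribed first coordinate include a highest one. -/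
theorem IsCompact.exists_top_point {K : Set (EuclideanSpace ℝ (Fin 2))} (hK : IsCompact K) {x : ℝ}
    (hx : x ∈ (fun p : EuclideanSpace ℝ (Fin 2) => p 0) '' K) :
    ∃ p ∈ K, p 0 = x ∧ ∀ q ∈ K, q 0 = x → q 1 ≤ p 1 := by
  obtain ⟨p₀, hp₀, hp₀x⟩ := hx
  have hcl : IsClosed {p : EuclideanSpace ℝ (Fin 2) | p 0 = x} :=
    isClosed_eq (by fun_prop) continuous_const
  obtain ⟨p, hp, hmax⟩ := (hK.inter_right hcl).exists_isMaxOn ⟨p₀, hp₀, hp₀x⟩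
    (f := fun p : EuclideanSpace ℝ (Fin 2) => p 1) (by fun_prop)
  exact ⟨p, hp.1, hp.2, fun q hq hqx => hmax ⟨hq, hqx⟩⟩

/-- The points of a compact set with prescribed first coordinate include a lowest one. -/
theorem IsCompact.exists_bottom_point {K : Set (EuclideanSpace ℝ (Fin 2))} (hK : IsCompact K)
    {x : ℝ} (hx : x ∈ (fun p : EuclideanSpace ℝ (Fin 2) => p 0) '' K) :
    ∃ p ∈ K, p 0 = x ∧ ∀ q ∈ K, q 0 = x → p 1 ≤ q 1 := by
  obtain ⟨p₀, hp₀, hp₀x⟩ := hx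
  have hcl : IsClosed {p : EuclideanSpace ℝ (Fin 2) | p 0 = x} :=
    isClosed_eq (by fun_prop) continuous_const
  obtain ⟨p, hp, hmin⟩ := (hK.inter_right hcl).exists_isMinOn ⟨p₀, hp₀, hp₀x⟩
    (f := fun p : EuclideanSpace ℝ (Fin 2) => p 1) (by fun_prop)
  exact ⟨p, hp.1, hp.2, fun q hq hqx => hmin ⟨hq, hqx⟩⟩

/-- A point of a convex body lying strictly inside a vertical chord, whose first coordinate is not
extremal, is an interior point. -/
theorem Convex.mem_interior_of_vertical_chord {K : Set (EuclideanSpace ℝ (Fin 2))}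
    (hK : Convex ℝ K) (hint : (interior K).Nonempty) {p t d l r : EuclideanSpace ℝ (Fin 2)}
    (ht : t ∈ K) (hd : d ∈ K) (hl : l ∈ K) (hr : r ∈ K) (ht0 : t 0 = p 0) (hd0 : d 0 = p 0)
    (hdp : d 1 < p 1) (hpt : p 1 < t 1) (hlp : l 0 < p 0) (hpr : p 0 < r 0) :
    p ∈ interior K := by
  by_contra hp
  obtain ⟨f, hf⟩ := geometric_hahn_banach_open_point hK.interior isOpen_interior hp
  have hfle : ∀ y ∈ K, f y ≤ f p := by
    have hsub : closure (interior K) ⊆ {y | f y ≤ f p} :=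
      closure_minimal (fun y hy => (hf y hy).le) (isClosed_le f.continuous continuous_const)
    rw [hK.closure_interior_eq_closure_of_nonempty_interior hint] at hsub
    exact fun y hy => hsub (subset_closure hy)
  set e₀ := f (EuclideanSpace.single 0 1)
  set e₁ := f (EuclideanSpace.single 1 1)
  have hcoord : ∀ y, f y = y 0 * e₀ + y 1 * e₁ := by
    intro y
    have hy : y = y 0 • EuclideanSpace.single 0 (1 : ℝ) + y 1 • EuclideanSpace.single 1 (1 : ℝ) := by
      ext i
      fin_cases i <;> simp
    conv_lhs => rw [hy]
    simp [e₀, e₁]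
  have h1 := hfle t ht
  have h2 := hfle d hd
  have h3 := hfle l hl
  have h4 := hfle r hr
  rw [hcoord, hcoord p] at h1 h2 h3 h4
  rw [ht0] at h1
  rw [hd0] at h2
  have he₁ : e₁ = 0 := le_antisymm (by nlinarith) (by nlinarith)
  rw [he₁] at h3 h4
  have he₀ : e₀ = 0 := le_antisymm (by nlinarith) (by nlinarith)
  obtain ⟨y, hy⟩ := hint
  have := hf y hy
  rw [hcoord, hcoord p, he₀, he₁] at this
  simp at this

/-- A point between two others on a vertical line belongs to their segment. -/
theorem mem_segment_of_vertical {p d t : EuclideanSpace ℝ (Fin 2)} (hd0 : d 0 = p 0)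
    (ht0 : t 0 = p 0) (hd : d 1 ≤ p 1) (ht : p 1 ≤ t 1) : p ∈ segment ℝ d t := by
  have hp : p 1 ∈ segment ℝ (d 1) (t 1) := by
    rw [segment_eq_Icc (hd.trans ht)]
    exact ⟨hd, ht⟩
  obtain ⟨α, β, hα, hβ, hαβ, h⟩ := hp
  refine ⟨α, β, hα, hβ, hαβ, ?_⟩
  ext i
  fin_cases i
  · simp only [Fin.zero_eta, PiLp.add_apply, PiLp.smul_apply, smul_eq_mul, hd0, ht0]
    rw [← add_mul, hαβ, one_mul]
  · simpa using h

/-- Along the upper boundary of a convex set, linear functionals increasing in the second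
coordinate are quasiconcave. -/
theorem Convex.min_le_of_top_point {K : Set (EuclideanSpace ℝ (Fin 2))} (hK : Convex ℝ K)
    {p q r : EuclideanSpace ℝ (Fin 2)} (hp : p ∈ K) (hr : r ∈ K)
    (hq : ∀ q' ∈ K, q' 0 = q 0 → q' 1 ≤ q 1) (hpq : p 0 ≤ q 0) (hqr : q 0 ≤ r 0) {c s : ℝ}
    (hs : 0 ≤ s) : min (p 0 * c + p 1 * s) (r 0 * c + r 1 * s) ≤ q 0 * c + q 1 * s := by
  have hmem : q 0 ∈ segment ℝ (p 0) (r 0) := by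
    rw [segment_eq_Icc (hpq.trans hqr)]
    exact ⟨hpq, hqr⟩
  obtain ⟨α, β, hα, hβ, hαβ, h⟩ := hmem
  have hle := hq _ (hK hp hr hα hβ hαβ) (by simpa using h)
  simp only [PiLp.add_apply, PiLp.smul_apply, smul_eq_mul] at hle h
  have hmul := mul_le_mul_of_nonneg_right hle hs
  set m := min (p 0 * c + p 1 * s) (r 0 * c + r 1 * s)
  have h1 : α * m ≤ α * (p 0 * c + p 1 * s) := mul_le_mul_of_nonneg_left (min_le_left _ _) hα
  have h2 : β * m ≤ β * (r 0 * c + r 1 * s) := mul_le_mul_of_nonneg_left (min_le_right _ _) hβ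
  have h3 : m = α * m + β * m := by rw [← add_mul, hαβ, one_mul]
  rw [← h]
  linarith

/-- Along the lower boundary of a convex set, linear functionals decreasing in the second
coordinate are quasiconcave. -/
theorem Convex.min_le_of_bottom_point {K : Set (EuclideanSpace ℝ (Fin 2))} (hK : Convex ℝ K)
    {p q r : EuclideanSpace ℝ (Fin 2)} (hp : p ∈ K) (hr : r ∈ K)
    (hq : ∀ q' ∈ K, q' 0 = q 0 → q 1 ≤ q' 1) (hpq : p 0 ≤ q 0) (hqr : q 0 ≤ r 0) {c s : ℝ}
    (hs : 0 ≤ s) : min (-(p 0 * c + p 1 * s)) (-(r 0 * c + r 1 * s)) ≤ -(q 0 * c + q 1 * s) := by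
  have hmem : q 0 ∈ segment ℝ (p 0) (r 0) := by
    rw [segment_eq_Icc (hpq.trans hqr)]
    exact ⟨hpq, hqr⟩
  obtain ⟨α, β, hα, hβ, hαβ, h⟩ := hmem
  have hle := hq _ (hK hp hr hα hβ hαβ) (by simpa using h)
  simp only [PiLp.add_apply, PiLp.smul_apply, smul_eq_mul] at hle h
  have hmul := mul_le_mul_of_nonneg_right hle hs
  set m := min (-(p 0 * c + p 1 * s)) (-(r 0 * c + r 1 * s))
  have h1 : α * m ≤ α * -(p 0 * c + p 1 * s) := mul_le_mul_of_nonneg_left (min_le_left _ _) hα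
  have h2 : β * m ≤ β * -(r 0 * c + r 1 * s) := mul_le_mul_of_nonneg_left (min_le_right _ _) hβ
  have h3 : m = α * m + β * m := by rw [← add_mul, hαβ, one_mul]
  rw [← h]
  linarith

/-- The width of a compact set in a direction is at most its diameter. -/
theorem IsCompact.exists_width_bounds {K : Set (EuclideanSpace ℝ (Fin 2))} (hK : IsCompact K)
    (hne : K.Nonempty) (θ : ℝ) :
    ∃ m M : ℝ, M - m ≤ Metric.diam K ∧ ∀ p ∈ K,
      m ≤ p 0 * Real.cos θ + p 1 * Real.sin θ ∧ p 0 * Real.cos θ + p 1 * Real.sin θ ≤ M := by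
  have hcont : ContinuousOn
      (fun p : EuclideanSpace ℝ (Fin 2) => p 0 * Real.cos θ + p 1 * Real.sin θ) K := by fun_prop
  obtain ⟨p, hp, hmin⟩ := hK.exists_isMinOn hne hcont
  obtain ⟨q, hq, hmax⟩ := hK.exists_isMaxOn hne hcont
  refine ⟨_, _, ?_, fun r hr => ⟨hmin hr, hmax hr⟩⟩
  refine le_trans ?_ (Metric.dist_le_diam_of_mem hK.isBounded hq hp)
  rw [EuclideanSpace.dist_eq, Fin.sum_univ_two, Real.dist_eq, Real.dist_eq, sq_abs, sq_abs]
  refine Real.le_sqrt_of_sq_le ?_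
  nlinarith [sq_nonneg ((q 0 - p 0) * Real.sin θ - (q 1 - p 1) * Real.cos θ),
    Real.sin_sq_add_cos_sq θ, sq_nonneg (q 0 - p 0), sq_nonneg (q 1 - p 1)]

/-- An inscribed polygon of a compact convex set, with vertices on its upper and lower boundaries
and vertical sides at its extreme abscissas, has perimeter at most `π` times the diameter. -/
theorem sum_dist_inscribed_le {K : Set (EuclideanSpace ℝ (Fin 2))} (hKcomp : IsCompact K)
    (hKconv : Convex ℝ K) {a b : ℝ} {T B : ℝ → EuclideanSpace ℝ (Fin 2)}
    (hT : ∀ x ∈ Set.Icc a b, T x ∈ K ∧ T x 0 = x ∧ ∀ q ∈ K, q 0 = x → q 1 ≤ T x 1)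
    (hB : ∀ x ∈ Set.Icc a b, B x ∈ K ∧ B x 0 = x ∧ ∀ q ∈ K, q 0 = x → B x 1 ≤ q 1)
    {v w : ℕ → ℝ} {m n : ℕ} (hv : Monotone v) (hvmem : ∀ i, v i ∈ Set.Icc a b) (hv0 : v 0 = a)
    (hvm : v m = b) (hw : Monotone w) (hwmem : ∀ i, w i ∈ Set.Icc a b) (hw0 : w 0 = a)
    (hwn : w n = b) :
    ∑ i ∈ Finset.range m, dist (T (v (i + 1))) (T (v i)) +
      (∑ i ∈ Finset.range n, dist (B (w (i + 1))) (B (w i)) +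
        (dist (T a) (B a) + dist (T b) (B b))) ≤ Real.pi * Metric.diam K := by
  have ha : a ∈ Set.Icc a b := hv0 ▸ hvmem 0
  have hb : b ∈ Set.Icc a b := hvm ▸ hvmem m
  have key := sum_norm_le_of_sum_abs_le
    ((Finset.range m).disjSum ((Finset.range n).disjSum (Finset.univ : Finset Bool)))
    (Sum.elim (fun i => T (v (i + 1)) - T (v i)) (Sum.elim (fun i => B (w (i + 1)) - B (w i))
      (fun c => if c then T a - B a else T b - B b))) (2 * Metric.diam K) ?_
  · simp only [Finset.sum_disjSum, Sum.elim_inl, Sum.elim_inr, Fintype.sum_bool, if_true,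
      Bool.false_eq_true, if_false] at key
    simp only [dist_eq_norm]
    linarith
  intro θ hθ
  have hs : 0 ≤ Real.sin θ := Real.sin_nonneg_of_mem_Icc hθ
  obtain ⟨lo, hi, hwidth, hbound⟩ := hKcomp.exists_width_bounds ⟨T a, (hT a ha).1⟩ θ
  set L : EuclideanSpace ℝ (Fin 2) → ℝ := fun p => p 0 * Real.cos θ + p 1 * Real.sin θ with hL
  have hsub : ∀ p q : EuclideanSpace ℝ (Fin 2),
      (p - q) 0 * Real.cos θ + (p - q) 1 * Real.sin θ = L p - L q := by
    intro p q
    simp only [hL, PiLp.sub_apply]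
    ring
  have htop := sum_abs_sub_le_of_unimodal (fun i => L (T (v i))) m hi
    (fun i _ => (hbound _ (hT _ (hvmem i)).1).2) (by
      intro i j k hij hjk _
      obtain ⟨-, hj0, hj⟩ := hT _ (hvmem j)
      refine hKconv.min_le_of_top_point (hT _ (hvmem i)).1 (hT _ (hvmem k)).1
        (fun q hq h => hj q hq (h.trans hj0)) ?_ ?_ hs
      · rw [(hT _ (hvmem i)).2.1, hj0]
        exact hv hij
      · rw [(hT _ (hvmem k)).2.1, hj0]
        exact hv hjk)
  have hbot := sum_abs_sub_le_of_unimodal (fun i => -L (B (w i))) n (-lo)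
    (fun i _ => neg_le_neg (hbound _ (hB _ (hwmem i)).1).1) (by
      intro i j k hij hjk _
      obtain ⟨-, hj0, hj⟩ := hB _ (hwmem j)
      refine hKconv.min_le_of_bottom_point (hB _ (hwmem i)).1 (hB _ (hwmem k)).1
        (fun q hq h => hj q hq (h.trans hj0)) ?_ ?_ hs
      · rw [(hB _ (hwmem i)).2.1, hj0]
        exact hw hij
      · rw [(hB _ (hwmem k)).2.1, hj0]
        exact hw hjk)
  have hneg : ∀ i, |-L (B (w (i + 1))) - -L (B (w i))| = |L (B (w (i + 1))) - L (B (w i))| := by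
    intro i
    rw [← abs_neg]
    congr 1
    ring
  simp only [hneg, hv0, hvm, hw0, hwn] at htop hbot
  have hvert : ∀ x ∈ Set.Icc a b, |L (T x) - L (B x)| = L (T x) - L (B x) := by
    intro x hx
    have h := (hT x hx).2.2 _ (hB x hx).1 (hB x hx).2.1
    refine abs_of_nonneg ?_
    simp only [hL, (hT x hx).2.1, (hB x hx).2.1]
    have := mul_le_mul_of_nonneg_right h hs
    linarith
  simp only [Finset.sum_disjSum, Sum.elim_inl, Sum.elim_inr, Fintype.sum_bool, if_true,
    Bool.false_eq_true, if_false, hsub, hvert a ha, hvert b hb]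
  linarith

/-- For every compact convex planar body `K` (nonempty interior), the diameter of `K` is at
least its perimeter divided by `π`. -/
theorem diam_ge_perimeter_div_pi
    (K : Set (EuclideanSpace ℝ (Fin 2)))
    (hKcomp : IsCompact K) (hKconv : Convex ℝ K) (hKint : (interior K).Nonempty) :
    (μH[1] (frontier K)).toReal / Real.pi ≤ Metric.diam K := by
  have hne : K.Nonempty := hKint.mono interior_subset
  set P := (fun p : EuclideanSpace ℝ (Fin 2) => p 0) '' K with hP
  have hcont : Continuous (fun p : EuclideanSpace ℝ (Fin 2) => p 0) := by fun_prop
  have hPIcc : P = Set.Icc (sInf P) (sSup P) :=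
    eq_Icc_of_connected_compact ((hKconv.isConnected hne).image _ hcont.continuousOn)
      (hKcomp.image hcont)
  set a := sInf P
  set b := sSup P
  have hab : a ≤ b := by
    rw [← Set.nonempty_Icc, ← hPIcc]
    exact hne.image _
  have hTex : ∀ x, ∃ p, x ∈ Set.Icc a b → p ∈ K ∧ p 0 = x ∧ ∀ q ∈ K, q 0 = x → q 1 ≤ p 1 := by
    intro x
    by_cases hx : x ∈ Set.Icc a b
    · obtain ⟨p, hp⟩ := hKcomp.exists_top_point (hPIcc ▸ hx : x ∈ P)
      exact ⟨p, fun _ => hp⟩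
    · exact ⟨0, fun h => absurd h hx⟩
  have hBex : ∀ x, ∃ p, x ∈ Set.Icc a b → p ∈ K ∧ p 0 = x ∧ ∀ q ∈ K, q 0 = x → p 1 ≤ q 1 := by
    intro x
    by_cases hx : x ∈ Set.Icc a b
    · obtain ⟨p, hp⟩ := hKcomp.exists_bottom_point (hPIcc ▸ hx : x ∈ P)
      exact ⟨p, fun _ => hp⟩
    · exact ⟨0, fun h => absurd h hx⟩
  choose T hT using hTex
  choose B hB using hBex
  have ha : a ∈ Set.Icc a b := ⟨le_rfl, hab⟩
  have hb : b ∈ Set.Icc a b := ⟨hab, le_rfl⟩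
  have hfrontier : frontier K ⊆ (T '' Set.Icc a b ∪ B '' Set.Icc a b) ∪
      (segment ℝ (B a) (T a) ∪ segment ℝ (B b) (T b)) := by
    intro p hp
    have hpK : p ∈ K := hKcomp.isClosed.frontier_subset hp
    have hpx : p 0 ∈ Set.Icc a b := hPIcc ▸ Set.mem_image_of_mem _ hpK
    obtain ⟨hTK, hT0, hTmax⟩ := hT _ hpx
    obtain ⟨hBK, hB0, hBmin⟩ := hB _ hpx
    have hpT := hTmax p hpK rfl
    have hpB := hBmin p hpK rfl
    have hext : ∀ q : EuclideanSpace ℝ (Fin 2), q 0 = p 0 → q 1 = p 1 → q = p := by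
      intro q h0 h1
      ext i
      fin_cases i <;> assumption
    rcases hpx.1.eq_or_lt with hpa | hpa
    · rw [← hpa] at hT0 hB0 hpT hpB
      exact Or.inr (Or.inl (mem_segment_of_vertical (hB0.trans hpa) (hT0.trans hpa) hpB hpT))
    rcases hpx.2.eq_or_lt with hpb | hpb
    · rw [hpb] at hT0 hB0 hpT hpB
      exact Or.inr (Or.inr
        (mem_segment_of_vertical (hB0.trans hpb.symm) (hT0.trans hpb.symm) hpB hpT))
    rcases hpT.eq_or_lt with hpT | hpT
    · exact Or.inl (Or.inl ⟨_, hpx, hext _ hT0 hpT.symm⟩)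
    rcases hpB.eq_or_lt with hpB | hpB
    · exact Or.inl (Or.inr ⟨_, hpx, hext _ hB0 hpB⟩)
    exact absurd (hKconv.mem_interior_of_vertical_chord hKint hTK hBK (hT a ha).1 (hT b hb).1 hT0
      hB0 hpB hpT ((hT a ha).2.1.trans_lt hpa) (hpb.trans_eq (hT b hb).2.1.symm)) hp.2
  have hvar : eVariationOn T (Set.Icc a b) + eVariationOn B (Set.Icc a b) +
      (edist (B a) (T a) + edist (B b) (T b)) ≤ ENNReal.ofReal (Real.pi * Metric.diam K) := by
    refine eVariationOn_Icc_add_le hab fun v w m n hv hvmem hv0 hvm hw hwmem hw0 hwn => ?_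
    have h := sum_dist_inscribed_le hKcomp hKconv hT hB hv hvmem hv0 hvm hw hwmem hw0 hwn
    simp only [edist_dist]
    rw [← ENNReal.ofReal_sum_of_nonneg fun _ _ => dist_nonneg,
      ← ENNReal.ofReal_sum_of_nonneg fun _ _ => dist_nonneg,
      ← ENNReal.ofReal_add (by positivity) (by positivity),
      ← ENNReal.ofReal_add (by positivity) (by positivity),
      ← ENNReal.ofReal_add (by positivity) (by positivity)]
    refine ENNReal.ofReal_le_ofReal ?_
    rw [dist_comm (B a), dist_comm (B b)]
    linarith
  have hmeasure : μH[1] (frontier K) ≤ ENNReal.ofReal (Real.pi * Metric.diam K) :=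
    calc μH[1] (frontier K) ≤ (μH[1] (T '' Set.Icc a b) + μH[1] (B '' Set.Icc a b)) +
          (μH[1] (segment ℝ (B a) (T a)) + μH[1] (segment ℝ (B b) (T b))) :=
        (measure_mono hfrontier).trans ((measure_union_le _ _).trans
          (add_le_add (measure_union_le _ _) (measure_union_le _ _)))
      _ ≤ (eVariationOn T (Set.Icc a b) + eVariationOn B (Set.Icc a b)) +
          (edist (B a) (T a) + edist (B b) (T b)) := by
        rw [hausdorffMeasure_segment, hausdorffMeasure_segment]
        gcongr <;> exact hausdorffMeasure_image_le_eVariationOn _ _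
      _ ≤ _ := hvar
  rw [div_le_iff₀ Real.pi_pos, mul_comm]
  exact ENNReal.toReal_le_of_le_ofReal (mul_nonneg Real.pi_pos.le Metric.diam_nonneg) hmeasure
end

section
/- If K ⊆ ℝ² is a compact convex set with nonempty interior whose perimeter equals π and whose area is strictly less than (π − √3)/2 (the area of the Reuleaux triangle of width 1), then the diameter of K is strictly greater than 1. -/
open MeasureTheory

open scoped Pointwise RealInnerProductSpace ENNReal

/-- The euclidean plane. -/
local notation "Plane" => EuclideanSpace ℝ (Fin 2)

section DifferenceBody

variable {E : Type*} [NormedAddCommGroup E] [NormedSpace ℝ E] [MeasurableSpace E] [BorelSpace E]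
  [FiniteDimensional ℝ E] {μ : Measure E} [μ.IsAddHaarMeasure]

/-- Cutting a compact set by a closed half-space decreases `μ (Q - Q) - 2 * μ Q`. -/
lemma measure_sub_self_inter_halfSpace_le {Q : Set E} (hQ : IsCompact Q) (l : E →L[ℝ] ℝ) (c : ℝ)
    (hne : (Q ∩ {x | l x ≤ c}).Nonempty) :
    μ ((Q ∩ {x | l x ≤ c}) - (Q ∩ {x | l x ≤ c})) + 2 * μ Q ≤
      μ (Q - Q) + 2 * μ (Q ∩ {x | l x ≤ c}) := by
  set H : Set E := {x | l x ≤ c} with hH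
  have hHc : IsClosed H := isClosed_le l.continuous continuous_const
  have hcomp : IsCompact (Q ∩ H) := hQ.inter_right hHc
  obtain ⟨y, hy, hmin⟩ := hcomp.exists_isMinOn hne l.continuous.continuousOn
  have hmin' : ∀ z ∈ Q ∩ H, l y ≤ l z := fun z hz => hmin hz
  have hyc : l y ≤ c := hy.2
  have hT : MeasurableSet (Q \ H) := hQ.measurableSet.diff hHc.measurableSet
  set U : Set E := (fun x => x + y) ⁻¹' (Q \ H) with hU
  have hUm : MeasurableSet U := (measurable_id.add_const y) hT
  have hUμ : μ U = μ (Q \ H) := measure_preimage_add_right μ y (Q \ H)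
  have hUl : ∀ x ∈ U, c - l y < l x := by
    rintro x ⟨-, hx⟩
    have : c < l (x + y) := not_le.1 hx
    rw [map_add] at this
    linarith
  have hUQ : U ⊆ Q - Q := fun x hx => ⟨x + y, hx.1, y, hy.1, by simp⟩
  have hl : ∀ x ∈ (Q ∩ H) - (Q ∩ H), l x ≤ c - l y := by
    rintro _ ⟨a, ha, b, hb, rfl⟩
    have h1 : l a ≤ c := ha.2
    have h2 := hmin' b hb
    simp only [map_sub]
    linarith
  have hl' : ∀ x ∈ (Q ∩ H) - (Q ∩ H), -x ∈ (Q ∩ H) - (Q ∩ H) := by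
    rintro _ ⟨a, ha, b, hb, rfl⟩
    exact ⟨b, hb, a, ha, by simp⟩
  have hd1 : Disjoint ((Q ∩ H) - (Q ∩ H)) U :=
    Set.disjoint_left.2 fun x h1 h2 => (hl x h1).not_gt (hUl x h2)
  have hd2 : Disjoint (((Q ∩ H) - (Q ∩ H)) ∪ U) (-U) := by
    refine Set.disjoint_left.2 fun x h1 h2 => ?_
    have h3 := hUl _ h2
    rcases h1 with h1 | h1
    · exact (hl _ (hl' x h1)).not_gt h3
    · have := hUl _ h1
      rw [map_neg] at h3
      linarith
  have hsub : (((Q ∩ H) - (Q ∩ H)) ∪ U) ∪ (-U) ⊆ Q - Q := by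
    refine Set.union_subset (Set.union_subset ?_ hUQ) ?_
    · exact Set.sub_subset_sub Set.inter_subset_left Set.inter_subset_left
    · intro x hx
      obtain ⟨a, ha, b, hb, hab⟩ := hUQ hx
      exact ⟨b, hb, a, ha, by simp only at hab ⊢; rw [← neg_sub, hab, neg_neg]⟩
  have key := measure_mono (μ := μ) hsub
  rw [measure_union hd2 hUm.neg, measure_union hd1 hUm, Measure.measure_neg, hUμ] at key
  rw [← measure_inter_add_sdiff Q hHc.measurableSet (μ := μ)]
  calc _ = μ ((Q ∩ H) - (Q ∩ H)) + μ (Q \ H) + μ (Q \ H) + 2 * μ (Q ∩ H) := by ring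
    _ ≤ _ := by gcongr

/-- The quantity `μ (Q - Q) - 2 * μ Q` is monotone in the convex body `Q`. -/
lemma measure_sub_self_add_le {K H : Set E}
    (hK : IsCompact K) (hKc : Convex ℝ K) (hKn : K.Nonempty) (hH : IsCompact H) (hKH : K ⊆ H) :
    μ (K - K) + 2 * μ H ≤ μ (H - H) + 2 * μ K := by
  obtain ⟨l, c, hlc⟩ := RCLike.iInter_countable_halfSpaces_eq (𝕜 := ℝ) hKc hK.isClosed
  simp only [RCLike.re_to_real] at hlc
  let Q : ℕ → Set E := fun n => Nat.rec H (fun k S => S ∩ {x | l k x ≤ c k}) n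
  have hQ0 : Q 0 = H := rfl
  have hQs : ∀ n, Q (n + 1) = Q n ∩ {x | l n x ≤ c n} := fun n => rfl
  have hKQ : ∀ n, K ⊆ Q n := by
    intro n
    induction n with
    | zero => exact hKH
    | succ n ih =>
      rw [hQs]
      refine Set.subset_inter ih ?_
      rw [← hlc]
      exact Set.iInter_subset _ n
  have hQc : ∀ n, IsCompact (Q n) := by
    intro n
    induction n with
    | zero => exact hH
    | succ n ih =>
      rw [hQs]
      exact ih.inter_right (isClosed_le (l n).continuous continuous_const)
  have hfin : ∀ n, μ (Q n) ≠ ∞ := fun n => (hQc n).measure_lt_top.ne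
  have hstep : ∀ n, μ (Q n - Q n) + 2 * μ H ≤ μ (H - H) + 2 * μ (Q n) := by
    intro n
    induction n with
    | zero => exact le_rfl
    | succ n ih =>
      have h1 := measure_sub_self_inter_halfSpace_le (μ := μ) (hQc n) (l n) (c n)
        (hKn.mono (hQs n ▸ hKQ (n + 1)))
      rw [← hQs] at h1
      have h2 : 2 * μ (Q n) ≠ ∞ := ENNReal.mul_ne_top (by simp) (hfin n)
      refine (ENNReal.add_le_add_iff_right h2).1 ?_
      calc _ = μ (Q (n + 1) - Q (n + 1)) + 2 * μ (Q n) + 2 * μ H := by ring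
        _ ≤ μ (Q n - Q n) + 2 * μ (Q (n + 1)) + 2 * μ H := by gcongr
        _ = (μ (Q n - Q n) + 2 * μ H) + 2 * μ (Q (n + 1)) := by ring
        _ ≤ (μ (H - H) + 2 * μ (Q n)) + 2 * μ (Q (n + 1)) := by gcongr
        _ = _ := by ring
  have hanti : Antitone Q := antitone_nat_of_succ_le fun n => by
    rw [hQs]
    exact Set.inter_subset_left
  have hInter : ⋂ n, Q n = K := by
    refine Set.Subset.antisymm ?_ (Set.subset_iInter hKQ)
    rw [← hlc]
    refine Set.iInter_mono' fun n => ⟨n + 1, ?_⟩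
    rw [hQs]
    exact Set.inter_subset_right
  have hlim := tendsto_measure_iInter_atTop (μ := μ)
    (fun n => (hQc n).measurableSet.nullMeasurableSet) hanti ⟨0, hfin 0⟩
  rw [hInter] at hlim
  refine ge_of_tendsto' (tendsto_const_nhds.add (ENNReal.Tendsto.const_mul hlim (by simp)))
    fun n => ?_
  refine le_trans ?_ (hstep n)
  gcongr <;> exact hKQ n

end DifferenceBody

section Support

/-- The unit vector of the plane at angle `θ`. -/
noncomputable def dirVec (θ : ℝ) : Plane := !₂[Real.cos θ, Real.sin θ]

/-- The support function of `K` in the direction of angle `θ`. -/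
noncomputable def supportAt (K : Set Plane) (θ : ℝ) : ℝ := sSup ((fun x => ⟪dirVec θ, x⟫) '' K)

/-- The width of `K` in the direction of angle `θ`. -/
noncomputable def widthAt (K : Set Plane) (θ : ℝ) : ℝ :=
  supportAt K θ + supportAt K (θ + Real.pi)

lemma inner_dirVec (θ : ℝ) (x : Plane) :
    ⟪dirVec θ, x⟫ = Real.cos θ * x 0 + Real.sin θ * x 1 := by
  simp [dirVec, PiLp.inner_apply, Fin.sum_univ_two, mul_comm]

lemma inner_dirVec_dirVec (θ φ : ℝ) : ⟪dirVec θ, dirVec φ⟫ = Real.cos (θ - φ) := by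
  rw [inner_dirVec, Real.cos_sub]
  simp [dirVec]

lemma norm_dirVec (θ : ℝ) : ‖dirVec θ‖ = 1 := by
  have h : ⟪dirVec θ, dirVec θ⟫ = 1 := by rw [inner_dirVec_dirVec]; simp
  rw [real_inner_self_eq_norm_sq] at h
  exact (pow_eq_one_iff_of_nonneg (norm_nonneg _) two_ne_zero).1 h

lemma dirVec_add_pi (θ : ℝ) : dirVec (θ + Real.pi) = -dirVec θ := by
  ext i
  fin_cases i <;> simp [dirVec]

lemma inner_dirVec_add (θ δ : ℝ) (x : Plane) :
    ⟪dirVec (θ + δ), x⟫ =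
      Real.cos δ * ⟪dirVec θ, x⟫ + Real.sin δ * ⟪dirVec (θ + Real.pi / 2), x⟫ := by
  simp only [inner_dirVec, Real.cos_add, Real.sin_add, Real.cos_pi_div_two, Real.sin_pi_div_two]
  ring

lemma eq_inner_dirVec_smul_add (θ : ℝ) (x : Plane) :
    x = ⟪dirVec θ, x⟫ • dirVec θ + ⟪dirVec (θ + Real.pi / 2), x⟫ • dirVec (θ + Real.pi / 2) := by
  have h := Real.sin_sq_add_cos_sq θ
  simp only [inner_dirVec]
  ext i
  fin_cases i
  · simp [dirVec, Real.cos_add_pi_div_two, Real.sin_add_pi_div_two]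
    linear_combination (-(x 0)) * h
  · simp [dirVec, Real.cos_add_pi_div_two, Real.sin_add_pi_div_two]
    linear_combination (-(x 1)) * h

lemma exists_eq_norm_smul_dirVec (u : Plane) : ∃ θ, u = ‖u‖ • dirVec θ := by
  refine ⟨Complex.arg ⟨u 0, u 1⟩, ?_⟩
  have hn : ‖u‖ = ‖(⟨u 0, u 1⟩ : ℂ)‖ := by
    rw [EuclideanSpace.norm_eq, Complex.norm_eq_sqrt_sq_add_sq]
    simp [Fin.sum_univ_two]
  ext i
  rw [hn]
  fin_cases i
  · simp [dirVec, Complex.norm_mul_cos_arg]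
  · simp [dirVec, Complex.norm_mul_sin_arg]

lemma continuous_dirVec : Continuous dirVec := by
  unfold dirVec
  fun_prop

variable {K : Set Plane}

lemma continuous_supportAt (hK : IsCompact K) : Continuous (supportAt K) :=
  hK.continuous_sSup (f := fun θ x => ⟪dirVec θ, x⟫)
    ((continuous_dirVec.comp continuous_fst).inner continuous_snd)

lemma continuous_widthAt (hK : IsCompact K) : Continuous (widthAt K) :=
  (continuous_supportAt hK).add ((continuous_supportAt hK).comp (continuous_id.add_const _))

lemma inner_le_supportAt (hK : IsCompact K) (θ : ℝ) {x : Plane} (hx : x ∈ K) :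
    ⟪dirVec θ, x⟫ ≤ supportAt K θ :=
  le_csSup (hK.image (by fun_prop)).bddAbove ⟨x, hx, rfl⟩

lemma exists_inner_eq_supportAt (hK : IsCompact K) (hn : K.Nonempty) (θ : ℝ) :
    ∃ x ∈ K, ⟪dirVec θ, x⟫ = supportAt K θ :=
  (hK.image (f := fun x => ⟪dirVec θ, x⟫) (by fun_prop)).sSup_mem (hn.image _)

lemma supportAt_add_two_pi (θ : ℝ) : supportAt K (θ + 2 * Real.pi) = supportAt K θ := by
  simp [supportAt, dirVec]

lemma widthAt_le_diam (hK : IsCompact K) (hn : K.Nonempty) (θ : ℝ) :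
    widthAt K θ ≤ Metric.diam K := by
  obtain ⟨x, hx, hx'⟩ := exists_inner_eq_supportAt hK hn θ
  obtain ⟨y, hy, hy'⟩ := exists_inner_eq_supportAt hK hn (θ + Real.pi)
  rw [widthAt, ← hx', ← hy', dirVec_add_pi, inner_neg_left, ← sub_eq_add_neg, ← inner_sub_right]
  calc _ ≤ ‖dirVec θ‖ * ‖x - y‖ := real_inner_le_norm _ _
    _ = dist x y := by rw [norm_dirVec, one_mul, dist_eq_norm]
    _ ≤ _ := Metric.dist_le_diam_of_mem hK.isBounded hx hy

/-- The difference body of a convex body of constant width `1` contains the unit disc. -/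
lemma closedBall_subset_sub_self (hK : IsCompact K) (hKc : Convex ℝ K) (hn : K.Nonempty)
    (hw : ∀ θ, widthAt K θ = 1) : Metric.closedBall 0 1 ⊆ K - K := by
  intro x hx
  by_contra hxK
  obtain ⟨f, c, hf, hfx⟩ := geometric_hahn_banach_closed_point (hKc.sub hKc)
    (sub_eq_add_neg K K ▸ hK.add hK.neg).isClosed hxK
  set u := (InnerProductSpace.toDual ℝ Plane).symm f with hu
  have hfu : ∀ z, f z = ⟪u, z⟫ := fun z => by simp [hu]
  obtain ⟨θ, hθ⟩ := exists_eq_norm_smul_dirVec u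
  obtain ⟨a, ha, ha'⟩ := exists_inner_eq_supportAt hK hn θ
  obtain ⟨b, hb, hb'⟩ := exists_inner_eq_supportAt hK hn (θ + Real.pi)
  have h1 := hf (a - b) (Set.sub_mem_sub ha hb)
  have h2 : ⟪dirVec θ, a - b⟫ = 1 := by
    rw [← hw θ, widthAt, ← ha', ← hb', dirVec_add_pi, inner_neg_left, inner_sub_right]
    ring
  rw [hfu, hθ, inner_smul_left, h2] at h1
  have h3 : ‖x‖ ≤ 1 := by simpa using hx
  rw [hfu] at hfx
  have h4 := real_inner_le_norm u x
  have h5 : ‖u‖ * ‖x‖ ≤ ‖u‖ * 1 := by gcongr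
  simp at h1
  linarith

end Support

section Hexagon

/-- The regular hexagon of width `1` centred at the origin, one side of which is orthogonal to the
direction of angle `θ`. -/
def hexagon (θ : ℝ) : Set Plane :=
  {x | |⟪dirVec θ, x⟫| ≤ 1 / 2 ∧ |⟪dirVec (θ + Real.pi / 3), x⟫| ≤ 1 / 2 ∧
    |⟪dirVec (θ + 2 * (Real.pi / 3)), x⟫| ≤ 1 / 2}

lemma isClosed_hexagon (θ : ℝ) : IsClosed (hexagon θ) := by
  simp only [hexagon, Set.ofPred_and]
  refine (isClosed_le ?_ ?_).inter ((isClosed_le ?_ ?_).inter (isClosed_le ?_ ?_)) <;> fun_prop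

lemma cos_two_mul_pi_div_three : Real.cos (2 * (Real.pi / 3)) = -(1 / 2) := by
  rw [Real.cos_two_mul, Real.cos_pi_div_three]
  norm_num

lemma sin_two_mul_pi_div_three : Real.sin (2 * (Real.pi / 3)) = √3 / 2 := by
  rw [Real.sin_two_mul, Real.cos_pi_div_three, Real.sin_pi_div_three]
  ring

lemma abs_inner_dirVec_le_of_mem_hexagon {θ : ℝ} {x : Plane} (hx : x ∈ hexagon θ) :
    √3 * |⟪dirVec (θ + Real.pi / 2), x⟫| ≤ 1 - |⟪dirVec θ, x⟫| := by
  obtain ⟨-, h1, h2⟩ := hx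
  rw [inner_dirVec_add, Real.cos_pi_div_three, Real.sin_pi_div_three] at h1
  rw [inner_dirVec_add, cos_two_mul_pi_div_three, sin_two_mul_pi_div_three] at h2
  rw [abs_le] at h1 h2
  rcases abs_cases ⟪dirVec (θ + Real.pi / 2), x⟫ with h | h <;>
  rcases abs_cases ⟪dirVec θ, x⟫ with h' | h' <;> rw [h.1, h'.1] <;> linarith

lemma isCompact_hexagon (θ : ℝ) : IsCompact (hexagon θ) := by
  refine Metric.isCompact_of_isClosed_isBounded (isClosed_hexagon θ)
    ((Metric.isBounded_closedBall (x := (0 : Plane)) (r := 2)).subset fun x hx => ?_)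
  rw [mem_closedBall_zero_iff, eq_inner_dirVec_smul_add θ x]
  have h1 := abs_inner_dirVec_le_of_mem_hexagon hx
  have h2 : 1 * |⟪dirVec (θ + Real.pi / 2), x⟫| ≤ √3 * |⟪dirVec (θ + Real.pi / 2), x⟫| := by
    gcongr
    exact Real.one_le_sqrt.2 (by norm_num)
  refine (norm_add_le _ _).trans ?_
  simp only [norm_smul, norm_dirVec, Real.norm_eq_abs, mul_one]
  linarith

/-- Coordinates with respect to a rotated orthonormal frame preserve area. -/
lemma measurePreserving_inner_dirVec (θ : ℝ) :
    MeasurePreserving (fun x : Plane => (⟪dirVec θ, x⟫, ⟪dirVec (θ + Real.pi / 2), x⟫)) := by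
  have ho : Orthonormal ℝ ![dirVec θ, dirVec (θ + Real.pi / 2)] := by
    rw [orthonormal_iff_ite]
    intro i j
    fin_cases i <;> fin_cases j <;> simp [inner_dirVec_dirVec, norm_dirVec]
  obtain ⟨b, hb⟩ : ∃ b : OrthonormalBasis (Fin 2) ℝ Plane,
      ⇑b = ![dirVec θ, dirVec (θ + Real.pi / 2)] :=
    ⟨(basisOfOrthonormalOfCardEqFinrank ho (by simp)).toOrthonormalBasis (by simpa using ho),
      by simp⟩
  have h := ((volume_preserving_finTwoArrow ℝ).comp
    (PiLp.volume_preserving_ofLp (Fin 2))).comp b.measurePreserving_repr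
  have hf : (fun x : Plane => (⟪dirVec θ, x⟫, ⟪dirVec (θ + Real.pi / 2), x⟫)) =
      (MeasurableEquiv.finTwoArrow ∘ WithLp.ofLp) ∘ b.repr := by
    funext x
    simp [OrthonormalBasis.repr_apply_apply, hb]
  rw [hf]
  exact h

lemma measurableSet_region_hexagon :
    MeasurableSet {p : ℝ × ℝ | |p.1| ≤ 1 / 2 ∧ √3 * |p.2| ≤ 1 - |p.1|} := by
  rw [Set.ofPred_and]
  refine ((isClosed_le ?_ ?_).inter (isClosed_le ?_ ?_)).measurableSet <;> fun_prop

lemma volume_region_hexagon_le :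
    volume {p : ℝ × ℝ | |p.1| ≤ 1 / 2 ∧ √3 * |p.2| ≤ 1 - |p.1|} ≤ ENNReal.ofReal (√3 / 2) := by
  have h3 : 0 < √3 := by positivity
  have hm := measurableSet_region_hexagon
  rw [Measure.volume_eq_prod, Measure.prod_apply hm]
  have hle : ∀ x : ℝ, volume (Prod.mk x ⁻¹' {p : ℝ × ℝ | |p.1| ≤ 1 / 2 ∧ √3 * |p.2| ≤ 1 - |p.1|}) ≤
      (Set.Icc (-(1 / 2) : ℝ) (1 / 2)).indicator
        (fun x => ENNReal.ofReal (2 / √3 * (1 - |x|))) x := by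
    intro x
    by_cases hx : x ∈ Set.Icc (-(1 / 2) : ℝ) (1 / 2)
    · rw [Set.indicator_of_mem hx]
      have : Prod.mk x ⁻¹' {p : ℝ × ℝ | |p.1| ≤ 1 / 2 ∧ √3 * |p.2| ≤ 1 - |p.1|} ⊆
          Set.Icc (-((1 - |x|) / √3)) ((1 - |x|) / √3) := by
        rintro y ⟨-, hy⟩
        rw [Set.mem_Icc, ← abs_le, le_div_iff₀ h3, mul_comm]
        exact hy
      refine (measure_mono this).trans ?_
      rw [Real.volume_Icc]
      apply le_of_eq
      congr 1
      ring
    · rw [Set.indicator_of_notMem hx]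
      have : Prod.mk x ⁻¹' {p : ℝ × ℝ | |p.1| ≤ 1 / 2 ∧ √3 * |p.2| ≤ 1 - |p.1|} = ∅ := by
        refine Set.eq_empty_of_forall_notMem ?_
        rintro y ⟨hy, -⟩
        exact hx (abs_le.1 hy)
      rw [this, measure_empty]
  refine (lintegral_mono hle).trans ?_
  have hc : Continuous fun x : ℝ => 2 / √3 * (1 - |x|) := by fun_prop
  rw [lintegral_indicator measurableSet_Icc, ← ofReal_integral_eq_lintegral_ofReal
    (hc.integrableOn_Icc)]
  · apply ENNReal.ofReal_le_ofReal
    rw [integral_Icc_eq_integral_Ioc, ← intervalIntegral.integral_of_le (by norm_num),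
      intervalIntegral.integral_const_mul]
    have habs : ∫ x in (-(1 / 2) : ℝ)..(1 / 2), (1 - |x|) = 3 / 4 := by
      have hc' : Continuous fun x : ℝ => 1 - |x| := by fun_prop
      rw [← intervalIntegral.integral_add_adjacent_intervals (b := 0)
        (hc'.intervalIntegrable _ _) (hc'.intervalIntegrable _ _)]
      have e1 : ∫ x in (-(1 / 2) : ℝ)..0, (1 - |x|) = ∫ x in (-(1 / 2) : ℝ)..0, (1 + x) := by
        refine intervalIntegral.integral_congr fun x hx => ?_
        rw [Set.uIcc_of_le (by norm_num)] at hx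
        simp [abs_of_nonpos hx.2]
      have e2 : ∫ x in (0 : ℝ)..(1 / 2), (1 - |x|) = ∫ x in (0 : ℝ)..(1 / 2), (1 - x) := by
        refine intervalIntegral.integral_congr fun x hx => ?_
        rw [Set.uIcc_of_le (by norm_num)] at hx
        simp [abs_of_nonneg hx.1]
      rw [e1, e2, intervalIntegral.integral_add (by simp) (by simp),
        intervalIntegral.integral_sub (by simp) (by simp)]
      norm_num [integral_id]
    rw [habs, div_mul_eq_mul_div, div_le_div_iff₀ h3 two_pos, Real.mul_self_sqrt (by norm_num)]
    norm_num
  · refine (ae_restrict_iff' measurableSet_Icc).2 (Filter.Eventually.of_forall fun x hx => ?_)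
    have : |x| ≤ 1 / 2 := abs_le.2 hx
    have : 0 ≤ 1 - |x| := by linarith
    positivity

lemma volume_hexagon_le (θ : ℝ) : volume (hexagon θ) ≤ ENNReal.ofReal (√3 / 2) := by
  refine le_trans ?_ volume_region_hexagon_le
  have hm := measurableSet_region_hexagon
  rw [← (measurePreserving_inner_dirVec θ).measure_preimage hm.nullMeasurableSet]
  exact measure_mono fun x hx => ⟨hx.1, abs_inner_dirVec_le_of_mem_hexagon hx⟩

/-- A convex body of constant width `1` is inscribed in a regular hexagon of width `1`. -/
lemma exists_subset_hexagon {K : Set Plane} (hK : IsCompact K) (hw : ∀ θ, widthAt K θ = 1) :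
    ∃ (θ : ℝ) (c : Plane), ∀ x ∈ K, x - c ∈ hexagon θ := by
  let m : ℝ → ℝ := fun θ => supportAt K θ - 1 / 2
  have hmc : Continuous m := (continuous_supportAt hK).sub continuous_const
  have hmpi : ∀ θ, m (θ + Real.pi) = -m θ := fun θ => by
    have := hw θ
    simp only [widthAt] at this
    simp only [m]
    linarith
  let F : ℝ → ℝ := fun θ => m θ - m (θ + Real.pi / 3) + m (θ + 2 * (Real.pi / 3))
  have hFc : Continuous F := by fun_prop
  have hF : F (Real.pi / 3) = -F 0 := by
    have h1 : Real.pi / 3 + Real.pi / 3 = 2 * (Real.pi / 3) := by ring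
    have h2 : Real.pi / 3 + 2 * (Real.pi / 3) = 0 + Real.pi := by ring
    simp only [F, h1, h2, hmpi]
    simp only [zero_add]
    ring
  obtain ⟨θ, hθ⟩ : ∃ θ, F θ = 0 := by
    rcases le_total (F 0) 0 with h | h
    · exact mem_range_of_exists_le_of_exists_ge hFc ⟨0, h⟩ ⟨Real.pi / 3, by linarith⟩
    · exact mem_range_of_exists_le_of_exists_ge hFc ⟨Real.pi / 3, by linarith⟩ ⟨0, h⟩
  have hmem : ∀ (φ : ℝ) (c x : Plane), x ∈ K → ⟪dirVec φ, c⟫ = m φ →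
      |⟪dirVec φ, x - c⟫| ≤ 1 / 2 := by
    intro φ c x hx hc
    have h1 := inner_le_supportAt hK φ hx
    have h2 := inner_le_supportAt hK (φ + Real.pi) hx
    have h3 := hw φ
    simp only [widthAt] at h3
    rw [dirVec_add_pi, inner_neg_left] at h2
    rw [inner_sub_right, hc, abs_le]
    constructor <;> simp only [m] <;> linarith
  have h0 : ⟪dirVec θ, dirVec (θ + 2 * (Real.pi / 3))⟫ = -(1 / 2) := by
    rw [inner_dirVec_dirVec, sub_add_cancel_left, Real.cos_neg, cos_two_mul_pi_div_three]
  have h1 : ⟪dirVec (θ + Real.pi / 3), dirVec θ⟫ = 1 / 2 := by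
    rw [inner_dirVec_dirVec, add_sub_cancel_left, Real.cos_pi_div_three]
  have h2 : ⟪dirVec (θ + Real.pi / 3), dirVec (θ + 2 * (Real.pi / 3))⟫ = 1 / 2 := by
    rw [inner_dirVec_dirVec, ← Real.cos_neg, ← Real.cos_pi_div_three]
    congr 1
    ring
  have hself : ∀ φ, ⟪dirVec φ, dirVec φ⟫ = 1 := fun φ => by
    rw [inner_dirVec_dirVec, sub_self, Real.cos_zero]
  set m₀ := m θ with hm₀
  set m₂ := m (θ + 2 * (Real.pi / 3)) with hm₂
  have hm₁ : m (θ + Real.pi / 3) = m₀ + m₂ := by simp only [F] at hθ; linarith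
  refine ⟨θ, (4 / 3 * (m₀ + m₂ / 2)) • dirVec θ +
    (4 / 3 * (m₂ + m₀ / 2)) • dirVec (θ + 2 * (Real.pi / 3)), fun x hx =>
    ⟨hmem _ _ _ hx ?_, hmem _ _ _ hx ?_, hmem _ _ _ hx ?_⟩⟩
  · rw [inner_add_right, inner_smul_right, inner_smul_right, h0, hself, ← hm₀]
    ring
  · rw [inner_add_right, inner_smul_right, inner_smul_right, h1, h2, hm₁]
    ring
  · rw [inner_add_right, inner_smul_right, inner_smul_right, real_inner_comm, h0, hself, ← hm₂]
    ring

/-- **Blaschke–Lebesgue theorem**: a convex body of constant width `1` has area at least that of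
the Reuleaux triangle. -/
lemma reuleaux_le_volume {K : Set Plane} (hK : IsCompact K) (hKc : Convex ℝ K) (hn : K.Nonempty)
    (hw : ∀ θ, widthAt K θ = 1) : (Real.pi - √3) / 2 ≤ (volume K).toReal := by
  obtain ⟨θ, c, hc⟩ := exists_subset_hexagon hK hw
  set H : Set Plane := (fun x => x + -c) ⁻¹' hexagon θ with hH
  have hHvol : volume H = volume (hexagon θ) := measure_preimage_add_right _ _ _
  have hHcomp : IsCompact H :=
    (Homeomorph.addRight (-c)).isCompact_preimage.2 (isCompact_hexagon θ)
  have hKH : K ⊆ H := fun x hx => by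
    change x + -c ∈ hexagon θ
    rw [← sub_eq_add_neg]
    exact hc x hx
  have hHH : H - H ⊆ (2 : ℝ) • hexagon θ := by
    rintro _ ⟨a, ha, b, hb, rfl⟩
    rw [Set.mem_smul_set_iff_inv_smul_mem₀ two_ne_zero]
    have key : ∀ φ, |⟪dirVec φ, a + -c⟫| ≤ 1 / 2 → |⟪dirVec φ, b + -c⟫| ≤ 1 / 2 →
        |⟪dirVec φ, (2 : ℝ)⁻¹ • (a - b)⟫| ≤ 1 / 2 := by
      intro φ h1 h2
      simp only [inner_smul_right, inner_sub_right, inner_add_right, abs_le] at h1 h2 ⊢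
      constructor <;> linarith
    exact ⟨key _ ha.1 hb.1, key _ ha.2.1 hb.2.1, key _ ha.2.2 hb.2.2⟩
  have hHH' : volume (H - H) ≤ 4 * volume (hexagon θ) := by
    refine (measure_mono hHH).trans ?_
    rw [Measure.addHaar_smul]
    norm_num
  have hball : ENNReal.ofReal Real.pi ≤ volume (K - K) := by
    refine le_trans ?_ (measure_mono (closedBall_subset_sub_self hK hKc hn hw))
    rw [InnerProductSpace.volume_closedBall_of_dim_even (k := 1) (by simp)]
    simp
  have hmono := measure_sub_self_add_le (μ := volume) hK hKc hn hHcomp hKH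
  rw [hHvol] at hmono
  have hvfin : volume (hexagon θ) ≠ ∞ := (isCompact_hexagon θ).measure_lt_top.ne
  have hKfin : volume K ≠ ∞ := hK.measure_lt_top.ne
  have hle := (add_le_add_left hball _).trans (hmono.trans (add_le_add_left hHH' _))
  have hreal := ENNReal.toReal_mono (by finiteness) hle
  have hhex := ENNReal.toReal_mono (by simp) (volume_hexagon_le θ)
  rw [ENNReal.toReal_ofReal (by positivity)] at hhex
  rw [ENNReal.toReal_add (by simp) (by finiteness), ENNReal.toReal_add (by finiteness)
    (by finiteness), ENNReal.toReal_mul, ENNReal.toReal_mul, ENNReal.toReal_mul,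
    ENNReal.toReal_ofReal Real.pi_nonneg] at hreal
  simp only [ENNReal.toReal_ofNat] at hreal
  linarith

end Hexagon

section Perimeter

/-- At a frontier point, a convex body has a nonzero outer normal vector. -/
lemma exists_outer_normal {E : Type*} [NormedAddCommGroup E] [InnerProductSpace ℝ E]
    [CompleteSpace E] {K : Set E} (hKc : Convex ℝ K) (hi : (interior K).Nonempty) {x : E}
    (hx : x ∈ frontier K) : ∃ u : E, u ≠ 0 ∧ ∀ z ∈ K, ⟪u, z - x⟫ ≤ 0 := by
  obtain ⟨f, hf⟩ := geometric_hahn_banach_open_point hKc.interior isOpen_interior hx.2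
  set u := (InnerProductSpace.toDual ℝ E).symm f with hu
  have hfu : ∀ z, f z = ⟪u, z⟫ := fun z => by simp [hu]
  refine ⟨u, ?_, fun z hz => ?_⟩
  · rintro h0
    obtain ⟨a, ha⟩ := hi
    have := hf a ha
    simp [hfu, h0] at this
  · have hz' : z ∈ closure (interior K) := by
      rw [hKc.closure_interior_eq_closure_of_nonempty_interior hi]
      exact subset_closure hz
    have : f z ≤ f x := closure_minimal (fun a ha => (hf a ha).le)
      (isClosed_le f.continuous continuous_const) hz'
    rw [hfu, hfu] at this
    rw [inner_sub_right]
    linarith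

/-- If every outer normal ray of a convex body meets `S`, then the perimeter of the body is at most
the length of `S`: the nearest point projection is a contraction. -/
lemma hausdorffMeasure_frontier_le {E : Type*} [NormedAddCommGroup E] [InnerProductSpace ℝ E]
    [CompleteSpace E] [MeasurableSpace E] [BorelSpace E] {K S : Set E} (hK : IsClosed K)
    (hKc : Convex ℝ K) (hi : (interior K).Nonempty)
    (hS : ∀ x ∈ K, ∀ u : E, u ≠ 0 → ∃ t : ℝ, 0 ≤ t ∧ x + t • u ∈ S) :
    μH[1] (frontier K) ≤ μH[1] S := by
  choose! u hu0 hu using fun x (hx : x ∈ frontier K) => exists_outer_normal hKc hi hx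
  choose! t ht0 ht using hS
  have hsub : frontier K ⊆ K := hK.frontier_subset
  let g : frontier K → E := fun x => x.1 + t x.1 (u x.1) • u x.1
  have hg : AntilipschitzWith 1 g := by
    refine AntilipschitzWith.of_le_mul_dist fun x y => ?_
    obtain ⟨x, hx⟩ := x
    obtain ⟨y, hy⟩ := y
    rw [NNReal.coe_one, one_mul, Subtype.dist_eq, dist_eq_norm, dist_eq_norm]
    have h1 := mul_nonpos_of_nonneg_of_nonpos (ht0 x (hsub hx) (u x) (hu0 x hx))
      (hu x hx y (hsub hy))
    have h2 := mul_nonpos_of_nonneg_of_nonpos (ht0 y (hsub hy) (u y) (hu0 y hy))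
      (hu y hy x (hsub hx))
    have h3 : ⟪x + t x (u x) • u x - (y + t y (u y) • u y), x - y⟫ =
        ‖x - y‖ ^ 2 - t x (u x) * ⟪u x, y - x⟫ - t y (u y) * ⟪u y, x - y⟫ := by
      rw [← real_inner_self_eq_norm_sq, ← neg_sub x y, inner_neg_right,
        mul_neg, ← real_inner_smul_left, ← real_inner_smul_left, sub_neg_eq_add, ← inner_add_left,
        ← inner_sub_left]
      congr 1
      abel
    have h4 := real_inner_le_norm (x + t x (u x) • u x - (y + t y (u y) • u y)) (x - y)
    change ‖x - y‖ ≤ ‖x + t x (u x) • u x - (y + t y (u y) • u y)‖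
    rcases (norm_nonneg (x - y)).eq_or_lt with h0 | h0
    · rw [← h0]
      exact norm_nonneg _
    · refine le_of_mul_le_mul_right ?_ h0
      nlinarith
  have h1 := hg.le_hausdorffMeasure_image zero_le_one Set.univ
  rw [ENNReal.coe_one, ENNReal.one_rpow, one_mul] at h1
  have h2 := (isometry_subtype_coe (s := frontier K)).hausdorffMeasure_image (d := 1)
    (Or.inl zero_le_one) Set.univ
  rw [Set.image_univ, Subtype.range_coe] at h2
  rw [h2]
  refine h1.trans (measure_mono ?_)
  rintro _ ⟨x, -, rfl⟩
  exact ht x.1 (hsub x.2) _ (hu0 x.1 x.2)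

variable {K : Set Plane}

/-- The edge in direction `θ` of a circumscribed polygon of `K` with adjacent sides at angle `δ`. -/
def circumscribedEdge (K : Set Plane) (θ δ : ℝ) : Set Plane :=
  {y | ⟪dirVec θ, y⟫ = supportAt K θ ∧ ⟪dirVec (θ + δ), y⟫ ≤ supportAt K (θ + δ) ∧
    ⟪dirVec (θ - δ), y⟫ ≤ supportAt K (θ - δ)}

/-- The length of `circumscribedEdge K θ δ`. -/
noncomputable def edgeLength (K : Set Plane) (θ δ : ℝ) : ℝ :=
  (supportAt K (θ + δ) + supportAt K (θ - δ) - 2 * Real.cos δ * supportAt K θ) / Real.sin δ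

lemma inner_dirVec_sub (θ δ : ℝ) (x : Plane) :
    ⟪dirVec (θ - δ), x⟫ =
      Real.cos δ * ⟪dirVec θ, x⟫ - Real.sin δ * ⟪dirVec (θ + Real.pi / 2), x⟫ := by
  rw [sub_eq_add_neg, inner_dirVec_add, Real.cos_neg, Real.sin_neg]
  ring

lemma edgeLength_nonneg (hK : IsCompact K) (hn : K.Nonempty) (θ : ℝ) {δ : ℝ}
    (hδ : 0 < Real.sin δ) : 0 ≤ edgeLength K θ δ := by
  obtain ⟨x, hx, hx'⟩ := exists_inner_eq_supportAt hK hn θ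
  have h1 := inner_le_supportAt hK (θ + δ) hx
  have h2 := inner_le_supportAt hK (θ - δ) hx
  rw [inner_dirVec_add, hx'] at h1
  rw [inner_dirVec_sub, hx'] at h2
  refine div_nonneg ?_ hδ.le
  linarith

lemma hausdorffMeasure_circumscribedEdge_le (K : Set Plane) (θ : ℝ) {δ : ℝ}
    (hδ : 0 < Real.sin δ) :
    μH[1] (circumscribedEdge K θ δ) ≤ ENNReal.ofReal (edgeLength K θ δ) := by
  set h := supportAt K θ with hh
  let a := (supportAt K (θ + δ) - Real.cos δ * h) / Real.sin δ
  let b := (Real.cos δ * h - supportAt K (θ - δ)) / Real.sin δ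
  let f : ℝ → Plane := fun t => h • dirVec θ + t • dirVec (θ + Real.pi / 2)
  have hf : LipschitzWith 1 f := by
    refine LipschitzWith.of_dist_le_mul fun s t => ?_
    simp only [f]
    rw [dist_add_left, dist_eq_norm, ← sub_smul, norm_smul, norm_dirVec, mul_one, NNReal.coe_one,
      one_mul, Real.dist_eq, Real.norm_eq_abs]
  have hsub : circumscribedEdge K θ δ ⊆ f '' Set.Icc b a := by
    rintro y ⟨h0, h1, h2⟩
    rw [inner_dirVec_add, h0] at h1
    rw [inner_dirVec_sub, h0] at h2
    refine ⟨⟪dirVec (θ + Real.pi / 2), y⟫, ⟨?_, ?_⟩, ?_⟩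
    · rw [div_le_iff₀ hδ]
      linarith
    · rw [le_div_iff₀ hδ]
      linarith
    · simp only [f, hh]
      rw [← h0]
      exact (eq_inner_dirVec_smul_add θ y).symm
  refine (measure_mono hsub).trans ((hf.hausdorffMeasure_image_le zero_le_one _).trans ?_)
  rw [ENNReal.coe_one, ENNReal.one_rpow, one_mul, hausdorffMeasure_real, Real.volume_Icc]
  apply le_of_eq
  congr 1
  simp only [a, b, edgeLength, ← hh]
  ring

lemma eq_zero_of_inner_dirVec_eq_zero {φ δ : ℝ} (hδ : Real.sin δ ≠ 0) {u : Plane}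
    (h0 : ⟪dirVec φ, u⟫ = 0) (h1 : ⟪dirVec (φ + δ), u⟫ = 0) : u = 0 := by
  rw [inner_dirVec_add, h0, mul_zero, zero_add, mul_eq_zero] at h1
  rw [eq_inner_dirVec_smul_add φ u, h0, h1.resolve_left hδ]
  simp

/-- Every ray from a point of `K` meets the boundary of the circumscribed equiangular `2n`-gon. -/
lemma exists_mem_circumscribedEdge (hK : IsCompact K) {n : ℕ} (hn : 2 ≤ n) (φ : ℝ)
    {x u : Plane} (hx : x ∈ K) (hu : u ≠ 0) :
    ∃ t : ℝ, 0 ≤ t ∧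
      x + t • u ∈ ⋃ j ∈ Finset.range (2 * n),
        circumscribedEdge K (φ + j * (Real.pi / n)) (Real.pi / n) := by
  set δ : ℝ := Real.pi / n with hδ
  have hn0 : (n : ℝ) ≠ 0 := by positivity
  have hnδ : n * δ = Real.pi := by rw [hδ]; field_simp
  have hn2 : (2 : ℝ) ≤ n := by exact_mod_cast hn
  have hδ0 : 0 < δ := by positivity
  have hδpi : δ < Real.pi := by nlinarith
  have hsin : 0 < Real.sin δ := Real.sin_pos_of_pos_of_lt_pi hδ0 hδpi
  let θ : ℕ → ℝ := fun j => φ + j * δ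
  let s : Finset ℕ := (Finset.range (2 * n)).filter fun j => 0 < ⟪dirVec (θ j), u⟫
  have hθn : ∀ j, θ (j + n) = θ j + Real.pi := fun j => by
    simp only [θ]
    push_cast
    linear_combination hnδ
  have hs : s.Nonempty := by
    by_contra hse
    have hle : ∀ j < 2 * n, ⟪dirVec (θ j), u⟫ ≤ 0 := fun j hj => by
      by_contra hpos
      exact hse ⟨j, Finset.mem_filter.2 ⟨Finset.mem_range.2 hj, not_le.1 hpos⟩⟩
    have hz : ∀ j < n, ⟪dirVec (θ j), u⟫ = 0 := fun j hj => by
      have h1 := hle j (by omega)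
      have h2 := hle (j + n) (by omega)
      rw [hθn, dirVec_add_pi, inner_neg_left] at h2
      linarith
    refine hu (eq_zero_of_inner_dirVec_eq_zero hsin.ne' (hz 0 (by omega)) ?_)
    have h1 : θ 0 + δ = θ 1 := by simp [θ]
    rw [h1]
    exact hz 1 (by omega)
  let r : ℕ → ℝ := fun j => (supportAt K (θ j) - ⟪dirVec (θ j), x⟫) / ⟪dirVec (θ j), u⟫
  obtain ⟨i, his, hmin⟩ := s.exists_min_image r hs
  have hi := Finset.mem_filter.1 his
  have hri : 0 ≤ r i :=
    div_nonneg (sub_nonneg.2 (inner_le_supportAt hK _ hx)) hi.2.le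
  have hP : ∀ j < 2 * n, ⟪dirVec (θ j), x + r i • u⟫ ≤ supportAt K (θ j) := by
    intro j hj
    rw [inner_add_right, inner_smul_right]
    by_cases hpos : 0 < ⟪dirVec (θ j), u⟫
    · have := hmin j (Finset.mem_filter.2 ⟨Finset.mem_range.2 hj, hpos⟩)
      rw [le_div_iff₀ hpos] at this
      linarith
    · have h1 := inner_le_supportAt hK (θ j) hx
      have h2 := mul_nonpos_of_nonneg_of_nonpos hri (not_lt.1 hpos)
      linarith
  have hper : ∀ α : ℝ, ⟪dirVec α, x + r i • u⟫ ≤ supportAt K α ↔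
      ⟪dirVec (α + 2 * Real.pi), x + r i • u⟫ ≤ supportAt K (α + 2 * Real.pi) := fun α => by
    rw [supportAt_add_two_pi, two_mul, ← add_assoc, dirVec_add_pi, dirVec_add_pi, neg_neg]
  have hilt : i < 2 * n := Finset.mem_range.1 hi.1
  refine ⟨r i, hri, Set.mem_biUnion hi.1 ⟨?_, ?_, ?_⟩⟩
  · change ⟪dirVec (θ i), x + r i • u⟫ = supportAt K (θ i)
    rw [inner_add_right, inner_smul_right, div_mul_cancel₀ _ hi.2.ne']
    ring
  · rcases Nat.lt_or_ge (i + 1) (2 * n) with h | h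
    · have h1 : φ + i * δ + δ = θ (i + 1) := by
        simp only [θ]
        push_cast
        ring
      rw [h1]
      exact hP (i + 1) h
    · have hin : i + 1 = 2 * n := by omega
      have hin' : (i : ℝ) + 1 = 2 * n := by exact_mod_cast hin
      have h1 : φ + i * δ + δ = θ 0 + 2 * Real.pi := by
        simp only [θ]
        push_cast
        linear_combination δ * hin' + 2 * hnδ
      rw [h1]
      exact (hper _).1 (hP 0 (by omega))
  · rcases Nat.eq_zero_or_pos i with h | h
    · have h1 : φ + i * δ - δ + 2 * Real.pi = θ (2 * n - 1) := by
        simp only [θ, h]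
        push_cast [Nat.cast_sub (show 1 ≤ 2 * n by omega)]
        linear_combination -2 * hnδ
      rw [hper, h1]
      exact hP (2 * n - 1) (by omega)
    · have h1 : φ + i * δ - δ = θ (i - 1) := by
        simp only [θ]
        push_cast [Nat.cast_sub h]
        ring
      rw [h1]
      exact hP (i - 1) (by omega)

lemma sum_edgeLength {n : ℕ} (hn : 0 < n) (φ : ℝ) :
    ∑ j ∈ Finset.range (2 * n), edgeLength K (φ + j * (Real.pi / n)) (Real.pi / n) =
      (2 - 2 * Real.cos (Real.pi / n)) / Real.sin (Real.pi / n) *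
        ∑ j ∈ Finset.range n, widthAt K (φ + j * (Real.pi / n)) := by
  set δ : ℝ := Real.pi / n with hδ
  have hn0 : (n : ℝ) ≠ 0 := by positivity
  have hnδ : n * δ = Real.pi := by rw [hδ]; field_simp
  have hper : supportAt K (φ + (2 * n : ℕ) * δ) = supportAt K φ := by
    rw [← supportAt_add_two_pi φ]
    congr 1
    push_cast
    linear_combination 2 * hnδ
  have hper' : supportAt K (φ + (2 * n : ℕ) * δ - δ) = supportAt K (φ - δ) := by
    rw [← supportAt_add_two_pi (φ - δ)]
    congr 1
    push_cast
    linear_combination 2 * hnδ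
  have e1 : ∑ j ∈ Finset.range (2 * n), supportAt K (φ + j * δ + δ) =
      ∑ j ∈ Finset.range (2 * n), supportAt K (φ + j * δ) := by
    have h1 := Finset.sum_range_succ (fun j : ℕ => supportAt K (φ + j * δ)) (2 * n)
    rw [Finset.sum_range_succ'] at h1
    simp only [hper, Nat.cast_zero, zero_mul, add_zero, add_left_inj] at h1
    rw [← h1]
    refine Finset.sum_congr rfl fun j _ => ?_
    congr 1
    push_cast
    ring
  have e2 : ∑ j ∈ Finset.range (2 * n), supportAt K (φ + j * δ - δ) =
      ∑ j ∈ Finset.range (2 * n), supportAt K (φ + j * δ) := by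
    have h1 := Finset.sum_range_succ (fun j : ℕ => supportAt K (φ + j * δ - δ)) (2 * n)
    rw [Finset.sum_range_succ'] at h1
    simp only [hper', Nat.cast_zero, zero_mul, add_zero, add_left_inj] at h1
    rw [← h1]
    refine Finset.sum_congr rfl fun j _ => ?_
    congr 1
    push_cast
    ring
  have e3 : ∑ j ∈ Finset.range (2 * n), supportAt K (φ + j * δ) =
      ∑ j ∈ Finset.range n, widthAt K (φ + j * δ) := by
    rw [two_mul, Finset.sum_range_add, ← Finset.sum_add_distrib]
    refine Finset.sum_congr rfl fun j _ => ?_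
    rw [widthAt]
    congr 2
    push_cast
    linear_combination hnδ
  simp only [edgeLength]
  rw [← Finset.sum_div, Finset.sum_sub_distrib, Finset.sum_add_distrib, ← Finset.mul_sum, e1, e2,
    e3]
  ring

/-- The perimeter of a convex body is at most that of the circumscribed equiangular `2n`-gon. -/
lemma hausdorffMeasure_frontier_le_sum_widthAt (hK : IsCompact K) (hKc : Convex ℝ K)
    (hi : (interior K).Nonempty) {n : ℕ} (hn : 2 ≤ n) (φ : ℝ) :
    μH[1] (frontier K) ≤ ENNReal.ofReal
      ((2 - 2 * Real.cos (Real.pi / n)) / Real.sin (Real.pi / n) *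
        ∑ j ∈ Finset.range n, widthAt K (φ + j * (Real.pi / n))) := by
  have hsin : 0 < Real.sin (Real.pi / n) := by
    refine Real.sin_pos_of_pos_of_lt_pi (by positivity) (div_lt_self Real.pi_pos ?_)
    exact_mod_cast hn
  rw [← sum_edgeLength (by omega), ENNReal.ofReal_sum_of_nonneg fun j _ =>
    edgeLength_nonneg hK (hi.mono interior_subset) _ hsin]
  refine (hausdorffMeasure_frontier_le hK.isClosed hKc hi fun x hx u hu =>
    exists_mem_circumscribedEdge hK hn φ hx hu).trans ?_
  refine (measure_biUnion_finset_le _ _).trans (Finset.sum_le_sum fun j _ => ?_)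
  exact hausdorffMeasure_circumscribedEdge_le K _ hsin

/-- A convex body of width at most `1` and perimeter at least `π` has constant width `1`. -/
lemma widthAt_eq_one (hK : IsCompact K) (hKc : Convex ℝ K) (hi : (interior K).Nonempty)
    (hw : ∀ θ, widthAt K θ ≤ 1) (hper : ENNReal.ofReal Real.pi ≤ μH[1] (frontier K)) (φ : ℝ) :
    widthAt K φ = 1 := by
  by_contra hne
  have hlt : widthAt K φ < 1 := lt_of_le_of_ne (hw φ) hne
  obtain ⟨c, hc, hc1⟩ := exists_between hlt
  obtain ⟨η, hη, hηc⟩ := Metric.eventually_nhds_iff.1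
    ((continuous_widthAt hK).continuousAt.eventually_lt_const hc)
  obtain ⟨m, hm⟩ := exists_nat_gt (Real.pi / η)
  have hmpos : (0 : ℝ) < m := lt_trans (by positivity) hm
  have hm0 : 0 < m := by exact_mod_cast hmpos
  obtain ⟨k, hk⟩ := exists_nat_gt (max 4 (Real.pi ^ 2 / (4 * (1 - c))))
  have hk4 : (4 : ℝ) < k := (le_max_left _ _).trans_lt hk
  have hkc : Real.pi ^ 2 / (4 * (1 - c)) < k := (le_max_right _ _).trans_lt hk
  have h1c : 0 < 1 - c := by linarith
  rw [div_lt_iff₀ (by positivity)] at hkc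
  have hk4' : 4 < k := by exact_mod_cast hk4
  have hm1 : (1 : ℝ) ≤ m := by exact_mod_cast hm0
  set n := k * m with hn
  have hncast : (n : ℝ) = k * m := by rw [hn]; push_cast; ring
  have hn2 : 2 ≤ n := by nlinarith
  have hn4 : (4 : ℝ) < n := by rw [hncast]; nlinarith
  set δ : ℝ := Real.pi / n with hδ
  have hnδ : n * δ = Real.pi := by rw [hδ]; field_simp
  have hδ0 : 0 < δ := by positivity
  have hδ1 : δ ≤ 1 := by
    rw [hδ, div_le_one (by linarith)]
    linarith [Real.pi_le_four]
  have hsum : ∑ j ∈ Finset.range n, widthAt K (φ + j * δ) ≤ n - k * (1 - c) := by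
    have hkn : k ≤ n := by nlinarith
    obtain ⟨p, hp⟩ := Nat.exists_eq_add_of_le hkn
    rw [hp, Finset.sum_range_add]
    have s1 : ∑ j ∈ Finset.range k, widthAt K (φ + j * δ) ≤ ∑ j ∈ Finset.range k, c := by
      refine Finset.sum_le_sum fun j hj => (hηc ?_).le
      have hjk : (j : ℝ) < k := by exact_mod_cast Finset.mem_range.1 hj
      rw [Real.dist_eq, add_sub_cancel_left, abs_of_nonneg (by positivity)]
      have h1 : k * δ * m = Real.pi := by rw [← hnδ, hncast]; ring
      rw [div_lt_iff₀ hη] at hm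
      have h2 : k * δ < η := by
        refine lt_of_mul_lt_mul_right ?_ hmpos.le
        linarith
      nlinarith
    have s2 : ∑ j ∈ Finset.range p, widthAt K (φ + (k + j : ℕ) * δ) ≤
        ∑ j ∈ Finset.range p, (1 : ℝ) := Finset.sum_le_sum fun j _ => hw _
    simp only [Finset.sum_const, Finset.card_range, nsmul_eq_mul] at s1 s2
    push_cast at s2 ⊢
    linarith
  have hmain := hper.trans (hausdorffMeasure_frontier_le_sum_widthAt hK hKc hi hn2 φ)
  rw [← hδ] at hmain
  have hsin : δ - δ ^ 3 / 6 < Real.sin δ := Real.sin_gt_sub_cube hδ0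
  have hsin0 : 0 < Real.sin δ := Real.sin_pos_of_pos_of_lt_pi hδ0 (by linarith [Real.pi_gt_three])
  have hcos : 2 - 2 * Real.cos δ ≤ δ ^ 2 := by linarith [Real.one_sub_sq_div_two_le_cos (x := δ)]
  have hcos0 : 0 ≤ 2 - 2 * Real.cos δ := by linarith [Real.cos_le_one δ]
  rw [ENNReal.ofReal_le_ofReal_iff', or_iff_left (not_le.2 Real.pi_pos), div_mul_eq_mul_div,
    le_div_iff₀ hsin0] at hmain
  have hS0 : 0 ≤ n - k * (1 - c) := by
    by_contra hneg
    have := mul_nonpos_of_nonneg_of_nonpos hcos0 (hsum.trans (not_le.1 hneg).le)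
    nlinarith [Real.pi_pos]
  have hbound : Real.pi * (δ - δ ^ 3 / 6) ≤ δ ^ 2 * (n - k * (1 - c)) :=
    calc _ ≤ Real.pi * Real.sin δ := by gcongr
      _ ≤ _ := hmain
      _ ≤ (2 - 2 * Real.cos δ) * (n - k * (1 - c)) := by gcongr
      _ ≤ _ := by gcongr
  have hbound' : δ ^ 2 * (k * (1 - c)) ≤ δ ^ 2 * (Real.pi * δ / 6) := by
    have : δ ^ 2 * n = Real.pi * δ := by rw [← hnδ]; ring
    linarith
  have hfin := le_of_mul_le_mul_left hbound' (by positivity)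
  nlinarith [Real.pi_pos]

end Perimeter

/-- If `K` is a compact convex planar body of perimeter `π` whose area is strictly smaller
than `(π − √3)/2` — the area of the Reuleaux triangle of width `1` — then the diameter of `K`
is strictly greater than `1`. -/
theorem diam_gt_one_of_area_lt_reuleaux
    (K : Set (EuclideanSpace ℝ (Fin 2)))
    (hKcomp : IsCompact K) (hKconv : Convex ℝ K) (hKint : (interior K).Nonempty)
    (hper : (μH[1] (frontier K)).toReal = Real.pi)
    (harea : (volume K).toReal < (Real.pi - Real.sqrt 3) / 2) :
    1 < Metric.diam K := by
  by_contra hdiam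
  have hne : K.Nonempty := hKint.mono interior_subset
  have hw : ∀ θ, widthAt K θ = 1 := widthAt_eq_one hKcomp hKconv hKint
    (fun θ => (widthAt_le_diam hKcomp hne θ).trans (not_lt.1 hdiam))
    (hper ▸ ENNReal.ofReal_toReal_le)
  exact (reuleaux_le_volume hKcomp hKconv hne hw).not_gt harea
end

section
/- For every compact convex set K ⊆ ℝ² with nonempty interior, there exist two closed disks of equal radius in ℝ² whose intersection L (a symmetric lens) satisfies: area(L) = area(K), perimeter(L) = perimeter(K), and diam(L) ≥ diam(K). In other words, among planar convex bodies of specified area and perimeter, the diameter is maximized by a symmetric lens formed as the intersection of two congruent disks. -/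
open MeasureTheory

/-- The Euclidean plane. -/
local notation "ℝ²" => EuclideanSpace ℝ (Fin 2)

theorem le_of_forall_small_increment {a b : ℝ} (hab : a ≤ b) {G : ℝ → ℝ}
    (hG : ∀ ε > 0, ∃ δ > 0, ∀ s t, a ≤ s → s ≤ t → t ≤ b → t - s < δ →
      -(ε * (t - s)) ≤ G t - G s) : G a ≤ G b := by
  refine le_of_forall_pos_le_add fun ε hε => ?_
  obtain ⟨δ, hδ, h⟩ := hG (ε / (b - a + 1)) (by have := sub_nonneg.2 hab; positivity)
  obtain ⟨n, hn⟩ := exists_nat_gt ((b - a) / δ)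
  have hn0 : (0 : ℝ) < n := lt_of_le_of_lt (div_nonneg (sub_nonneg.2 hab) hδ.le) hn
  set w := (b - a) / n with hw
  have hw0 : 0 ≤ w := div_nonneg (sub_nonneg.2 hab) hn0.le
  have hwn : n * w = b - a := by rw [hw]; field_simp
  have hwδ : w < δ := by
    rw [hw, div_lt_iff₀ hn0]; rw [div_lt_iff₀ hδ] at hn; linarith
  have key : ∀ k : ℕ, k ≤ n → -(ε / (b - a + 1) * (k * w)) ≤ G (a + k * w) - G a := by
    intro k
    induction k with
    | zero => simp
    | succ k ih =>
      intro hk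
      have h1 := ih (by omega)
      have hk' : ((k : ℝ) + 1) * w ≤ n * w := by
        apply mul_le_mul_of_nonneg_right _ hw0
        exact_mod_cast hk
      have h2 := h (a + k * w) (a + (k + 1 : ℕ) * w)
        (by have := mul_nonneg k.cast_nonneg hw0; linarith)
        (by push_cast; linarith) (by push_cast; linarith) (by push_cast; linarith)
      push_cast at h2 ⊢
      linarith
  have := key n le_rfl
  rw [hwn, add_sub_cancel] at this
  have h3 : ε / (b - a + 1) * (b - a) ≤ ε := by
    have : 0 ≤ b - a := sub_nonneg.2 hab
    rw [div_mul_eq_mul_div, div_le_iff₀ (by linarith)]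
    nlinarith
  linarith

theorem euclideanPlane_dist_sq (p q : ℝ²) :
    dist p q ^ 2 = (p 0 - q 0) ^ 2 + (p 1 - q 1) ^ 2 := by
  rw [EuclideanSpace.dist_eq, Real.sq_sqrt (by positivity)]
  simp [Fin.sum_univ_two, Real.dist_eq, sq_abs]

/-- A graph is at least as long as its extent in any direction. -/
theorem ofReal_le_hausdorffMeasure_graph {s t : ℝ} (hst : s ≤ t) {f : ℝ → ℝ}
    (hf : ContinuousOn f (Set.Icc s t)) {α β : ℝ} (hαβ : α ^ 2 + β ^ 2 ≤ 1) :
    ENNReal.ofReal (α * (t - s) + β * (f t - f s)) ≤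
      μH[1] ((fun x => (!₂[x, f x] : ℝ²)) '' Set.Ioo s t) := by
  set ℓ : ℝ² → ℝ := fun p => α * p 0 + β * p 1 with hℓ
  have hlip : LipschitzWith 1 ℓ := by
    refine LipschitzWith.of_dist_le_mul fun p q => ?_
    rw [NNReal.coe_one, one_mul, Real.dist_eq]
    refine abs_le_of_sq_le_sq ?_ dist_nonneg
    rw [euclideanPlane_dist_sq]
    simp only [hℓ]
    nlinarith [sq_nonneg (α * (p 1 - q 1) - β * (p 0 - q 0)),
      mul_nonneg (sub_nonneg.2 hαβ)
        (add_nonneg (sq_nonneg (p 0 - q 0)) (sq_nonneg (p 1 - q 1)))]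
  have h1 := hlip.hausdorffMeasure_image_le zero_le_one
    ((fun x => (!₂[x, f x] : ℝ²)) '' Set.Ioo s t)
  rw [hausdorffMeasure_real] at h1
  simp only [ENNReal.coe_one, ENNReal.one_rpow, one_mul] at h1
  refine le_trans ?_ h1
  rw [Set.image_image]
  have h2 := intermediate_value_Ioo hst (f := fun x => α * x + β * f x) (by fun_prop)
  calc _ = volume (Set.Ioo (α * s + β * f s) (α * t + β * f t)) := by
        rw [Real.volume_Ioo]; congr 1; ring
    _ ≤ _ := measure_mono (by simpa [hℓ] using h2)

/-- The calibration inequality of a circle of radius `r`, for the graph of `σ * f`. -/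
theorem integral_add_integral_le_mul_hausdorffMeasure_graph {a r σ : ℝ} (ha : 0 ≤ a)
    (har : a ≤ r) (hr : 0 < r) (hσ : σ ^ 2 = 1) {f : ℝ → ℝ} (hf : ContinuousOn f (Set.Icc (-a) a))
    (hfl : f (-a) = 0) (hfr : f a = 0)
    (hfin : μH[1] ((fun x => (!₂[x, σ * f x] : ℝ²)) '' Set.Ioo (-a) a) ≠ ⊤) :
    (∫ x in -a..a, √(r ^ 2 - x ^ 2)) + ∫ x in -a..a, f x ≤
      r * (μH[1] ((fun x => (!₂[x, σ * f x] : ℝ²)) '' Set.Ioo (-a) a)).toReal := by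
  set γ : ℝ → ℝ² := fun x => !₂[x, σ * f x] with hγ
  set Γ := γ '' Set.Ioo (-a) a
  have hcoord : Measurable (fun p : ℝ² => p 0) := by fun_prop
  set ν : Measure ℝ := (μH[1].restrict Γ).map (fun p : ℝ² => p 0) with hν
  have hνu : ν Set.univ = μH[1] Γ := by
    rw [hν, Measure.map_apply hcoord MeasurableSet.univ]; simp
  have : IsFiniteMeasure ν := ⟨by rw [hνu]; exact hfin.lt_top⟩
  have hfσ : ContinuousOn (fun x => σ * f x) (Set.Icc (-a) a) := by fun_prop
  have hincr : ∀ s t, -a ≤ s → s ≤ t → t ≤ a → ∀ α β : ℝ, α ^ 2 + β ^ 2 ≤ 1 →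
      α * (t - s) + β * (f t - f s) ≤ ν.real (Set.Iic t) - ν.real (Set.Iic s) := by
    intro s t hs hst ht α β hαβ
    have h1 := ofReal_le_hausdorffMeasure_graph hst (hfσ.mono (Set.Icc_subset_Icc hs ht))
      (α := α) (β := β * σ) (by rw [mul_pow, hσ, mul_one]; exact hαβ)
    have h2 : μH[1] (γ '' Set.Ioo s t) ≤ ν (Set.Ioc s t) := by
      rw [hν, Measure.map_apply hcoord measurableSet_Ioc,
        Measure.restrict_apply (hcoord measurableSet_Ioc)]
      refine measure_mono ?_
      rintro _ ⟨x, hx, rfl⟩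
      exact ⟨⟨by simpa [hγ] using hx.1, by simpa [hγ] using hx.2.le⟩, x,
        ⟨by linarith [hx.1], by linarith [hx.2]⟩, rfl⟩
    have h3 : α * (t - s) + β * σ * (σ * f t - σ * f s) ≤ ν.real (Set.Ioc s t) :=
      (ENNReal.ofReal_le_iff_le_toReal (measure_ne_top _ _)).1 (h1.trans h2)
    have h4 : ν.real (Set.Iic t) = ν.real (Set.Iic s) + ν.real (Set.Ioc s t) := by
      rw [← Set.Iic_union_Ioc_eq_Iic hst, measureReal_union _ measurableSet_Ioc]
      exact Set.disjoint_left.2 fun x hx hx' => absurd hx'.1 (not_lt.2 hx)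
    have h5 : β * σ * (σ * f t - σ * f s) = β * (f t - f s) := by
      linear_combination β * (f t - f s) * hσ
    linarith
  set c : ℝ → ℝ := fun x => √(r ^ 2 - x ^ 2) with hc
  have hccont : Continuous c := by fun_prop
  have hfi : ∀ s t, -a ≤ s → s ≤ t → t ≤ a → IntervalIntegrable f volume s t := by
    intro s t hs hst ht
    refine (hf.mono ?_).intervalIntegrable
    rw [Set.uIcc_of_le hst]
    exact Set.Icc_subset_Icc hs ht
  have haa : -a ≤ a := by linarith
  have key := le_of_forall_small_increment haa (G := fun t => r * ν.real (Set.Iic t) -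
      (∫ x in -a..t, c x) - (∫ x in -a..t, f x) + t * f t) (by
    intro ε hε
    obtain ⟨δ₁, hδ₁, h₁⟩ := Metric.uniformContinuousOn_iff.1
      (isCompact_Icc.uniformContinuousOn_of_continuous hf) (ε / 2) (by positivity)
    obtain ⟨δ₂, hδ₂, h₂⟩ := Metric.uniformContinuousOn_iff.1
      (isCompact_Icc.uniformContinuousOn_of_continuous (hccont.continuousOn (s := Set.Icc (-a) a)))
      (ε / 2) (by positivity)
    refine ⟨min δ₁ δ₂, lt_min hδ₁ hδ₂, fun s t hs hst ht hd => ?_⟩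
    have hd₁ := hd.trans_le (min_le_left _ _)
    have hd₂ := hd.trans_le (min_le_right _ _)
    have hsr : 0 ≤ r ^ 2 - s ^ 2 := by nlinarith
    have hcs : c s ^ 2 = r ^ 2 - s ^ 2 := Real.sq_sqrt hsr
    have hi := hincr s t hs hst ht (c s / r) (-s / r) (by
      rw [div_pow, div_pow, hcs]; field_simp; linarith)
    have hi' : c s * (t - s) - s * (f t - f s) ≤
        r * (ν.real (Set.Iic t) - ν.real (Set.Iic s)) := by
      have := mul_le_mul_of_nonneg_left hi hr.le
      refine le_trans (le_of_eq ?_) this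
      field_simp
      ring
    have hI₁ : (∫ x in -a..t, c x) - (∫ x in -a..s, c x) = ∫ x in s..t, c x :=
      intervalIntegral.integral_interval_sub_left (hccont.intervalIntegrable _ _)
        (hccont.intervalIntegrable _ _)
    have hI₂ : (∫ x in -a..t, f x) - (∫ x in -a..s, f x) = ∫ x in s..t, f x :=
      intervalIntegral.integral_interval_sub_left (hfi _ _ le_rfl (hs.trans hst) ht)
        (hfi _ _ le_rfl hs (hst.trans ht))
    have hJ₁ : (∫ x in s..t, c x) ≤ (c s + ε / 2) * (t - s) := by
      have := intervalIntegral.integral_mono_on hst (hccont.intervalIntegrable s t)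
        (intervalIntegrable_const (μ := volume) (c := c s + ε / 2)) (fun x hx => by
          have := h₂ x ⟨hs.trans hx.1, hx.2.trans ht⟩ s ⟨hs, hst.trans ht⟩
            (by rw [Real.dist_eq, abs_of_nonneg (by linarith [hx.1])]; linarith [hx.2])
          rw [Real.dist_eq] at this
          linarith [(abs_lt.1 this).2])
      rw [intervalIntegral.integral_const, smul_eq_mul] at this
      linarith
    have hJ₂ : (∫ x in s..t, f x) ≤ (f t + ε / 2) * (t - s) := by
      have := intervalIntegral.integral_mono_on hst (hfi s t hs hst ht)
        (intervalIntegrable_const (μ := volume) (c := f t + ε / 2)) (fun x hx => by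
          have := h₁ x ⟨hs.trans hx.1, hx.2.trans ht⟩ t ⟨hs.trans hst, ht⟩
            (by rw [Real.dist_eq, abs_sub_comm, abs_of_nonneg (by linarith [hx.2])]
                linarith [hx.1])
          rw [Real.dist_eq] at this
          linarith [(abs_lt.1 this).2])
      rw [intervalIntegral.integral_const, smul_eq_mul] at this
      linarith
    linarith)
  simp only [intervalIntegral.integral_same, hfl, hfr] at key
  have hle : ν.real (Set.Iic a) ≤ (μH[1] Γ).toReal := by
    rw [← hνu]; exact measureReal_mono (Set.subset_univ _)
  have h0 : 0 ≤ r * ν.real (Set.Iic (-a)) := mul_nonneg hr.le measureReal_nonneg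
  have := mul_le_mul_of_nonneg_left hle hr.le
  linarith

theorem integral_sqrt_sq_sub_sq {R θ : ℝ} (hR : 0 ≤ R) (hθ : 0 ≤ θ) (hθ' : θ ≤ Real.pi / 2) :
    ∫ x in -(R * Real.sin θ)..R * Real.sin θ, √(R ^ 2 - x ^ 2) =
      R ^ 2 * (θ + Real.sin θ * Real.cos θ) := by
  have h := intervalIntegral.integral_comp_mul_deriv (a := -θ) (b := θ)
    (f := fun u => R * Real.sin u) (f' := fun u => R * Real.cos u)
    (g := fun x => √(R ^ 2 - x ^ 2)) (fun x _ => (Real.hasDerivAt_sin x).const_mul R)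
    (by fun_prop) (by fun_prop)
  simp only [Real.sin_neg, mul_neg] at h
  rw [← h]
  have h2 : ∫ x in -θ..θ, ((fun x => √(R ^ 2 - x ^ 2)) ∘ fun u => R * Real.sin u) x *
      (R * Real.cos x) = ∫ x in -θ..θ, R ^ 2 * Real.cos x ^ 2 := by
    refine intervalIntegral.integral_congr fun x hx => ?_
    rw [Set.uIcc_of_le (by linarith)] at hx
    have hcos : 0 ≤ Real.cos x :=
      Real.cos_nonneg_of_mem_Icc ⟨by linarith [hx.1], by linarith [hx.2]⟩
    have : R ^ 2 - (R * Real.sin x) ^ 2 = (R * Real.cos x) ^ 2 := by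
      linear_combination -R ^ 2 * Real.sin_sq_add_cos_sq x
    simp only [Function.comp, this, Real.sqrt_sq (mul_nonneg hR hcos)]
    ring
  rw [h2, intervalIntegral.integral_const_mul, integral_cos_sq, Real.cos_neg, Real.sin_neg]
  ring

theorem exists_continuousOn_isGreatest_section {a : ℝ} (ha : 0 < a) {S : Set (ℝ × ℝ)}
    (hS : IsClosed S) (hconv : Convex ℝ S) (hl : (-a, 0) ∈ S) (hr : (a, 0) ∈ S)
    (hbl : ∀ p ∈ S, (p.1 + a) ^ 2 + p.2 ^ 2 ≤ 4 * a ^ 2)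
    (hbr : ∀ p ∈ S, (p.1 - a) ^ 2 + p.2 ^ 2 ≤ 4 * a ^ 2) :
    ∃ f : ℝ → ℝ, ContinuousOn f (Set.Icc (-a) a) ∧ f (-a) = 0 ∧ f a = 0 ∧
      ∀ x ∈ Set.Icc (-a) a, IsGreatest {y | (x, y) ∈ S} (f x) := by
  have hzero : ∀ x ∈ Set.Icc (-a) a, (x, (0 : ℝ)) ∈ S := by
    intro x hx
    have := hconv hl hr (a := (a - x) / (2 * a)) (b := (a + x) / (2 * a))
      (div_nonneg (by linarith [hx.2]) (by linarith))
      (div_nonneg (by linarith [hx.1]) (by linarith)) (by field_simp; ring)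
    convert this using 1
    simp only [Prod.smul_mk, smul_eq_mul, Prod.mk_add_mk, mul_zero, add_zero, Prod.mk.injEq,
      and_true]
    field_simp
    ring
  set f : ℝ → ℝ := fun x => sSup {y | (x, y) ∈ S}
  have hgr : ∀ x ∈ Set.Icc (-a) a, IsGreatest {y | (x, y) ∈ S} (f x) := by
    intro x hx
    refine IsCompact.isGreatest_sSup ?_ ⟨0, hzero x hx⟩
    refine (isCompact_Icc (a := -(2 * a)) (b := 2 * a)).of_isClosed_subset
      (hS.preimage (by fun_prop : Continuous fun y : ℝ => (x, y))) fun y hy => ?_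
    have := hbl _ hy
    exact abs_le.1 (abs_le_of_sq_le_sq (by nlinarith [sq_nonneg (x + a)]) (by linarith))
  have hnn : ∀ x ∈ Set.Icc (-a) a, 0 ≤ f x := fun x hx => (hgr x hx).2 (hzero x hx)
  have hla : -a ∈ Set.Icc (-a) a := ⟨le_rfl, by linarith⟩
  have hra : a ∈ Set.Icc (-a) a := ⟨by linarith, le_rfl⟩
  have hfl : f (-a) = 0 := by
    have := hbr _ (hgr _ hla).1
    exact pow_eq_zero_iff two_ne_zero |>.1
      (le_antisymm (by simp only at this; nlinarith) (sq_nonneg _))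
  have hfr : f a = 0 := by
    have := hbl _ (hgr _ hra).1
    exact pow_eq_zero_iff two_ne_zero |>.1
      (le_antisymm (by simp only at this; nlinarith) (sq_nonneg _))
  have hconc : ConcaveOn ℝ (Set.Icc (-a) a) f := by
    refine ⟨convex_Icc _ _, fun x hx y hy s t hs ht hst => ?_⟩
    exact (hgr _ (convex_Icc _ _ hx hy hs ht hst)).2
      (hconv (hgr x hx).1 (hgr y hy).1 hs ht hst)
  have hend : ∀ e b : ℝ, f e = 0 → (e - b) ^ 2 = 4 * a ^ 2 →
      (∀ p ∈ S, (p.1 - b) ^ 2 + p.2 ^ 2 ≤ 4 * a ^ 2) →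
      ContinuousWithinAt f (Set.Icc (-a) a) e := by
    intro e b he heb hS'
    have hlim : Filter.Tendsto (fun x => √(4 * a ^ 2 - (x - b) ^ 2)) (nhdsWithin e (Set.Icc (-a) a))
        (nhds 0) := by
      have : Continuous fun x => √(4 * a ^ 2 - (x - b) ^ 2) := by fun_prop
      have h := this.continuousWithinAt (s := Set.Icc (-a) a) (x := e)
      simpa [ContinuousWithinAt, heb] using h
    rw [ContinuousWithinAt, he]
    refine tendsto_of_tendsto_of_tendsto_of_le_of_le' tendsto_const_nhds hlim ?_ ?_
    · filter_upwards [self_mem_nhdsWithin] with x hx using hnn x hx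
    · filter_upwards [self_mem_nhdsWithin] with x hx
      exact Real.le_sqrt_of_sq_le (by linarith [hS' _ (hgr x hx).1])
  refine ⟨f, fun x hx => ?_, hfl, hfr, hgr⟩
  rcases eq_or_lt_of_le hx.1 with h | h
  · rw [← h]; exact hend _ a hfl (by ring) hbr
  rcases eq_or_lt_of_le hx.2 with h' | h'
  · rw [h']; exact hend _ (-a) hfr (by ring) (by simpa using hbl)
  · have hx' : x ∈ interior (Set.Icc (-a) a) := by rw [interior_Icc]; exact ⟨h, h'⟩
    exact (hconc.continuousOn_interior.continuousAt
      (isOpen_interior.mem_nhds hx')).continuousWithinAt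

theorem volume_eq_volume_coordinates (K : Set ℝ²) :
    volume K = volume {q : ℝ × ℝ | (!₂[q.1, q.2] : ℝ²) ∈ K} := by
  have h : MeasurePreserving (fun q : ℝ × ℝ => (!₂[q.1, q.2] : ℝ²)) volume volume :=
    (PiLp.volume_preserving_toLp (Fin 2)).comp
      (MeasurePreserving.symm _ (volume_preserving_finTwoArrow ℝ))
  have he : MeasurableEmbedding (fun q : ℝ × ℝ => (!₂[q.1, q.2] : ℝ²)) :=
    (MeasurableEquiv.finTwoArrow.symm.trans
      (MeasurableEquiv.toLp 2 (Fin 2 → ℝ))).measurableEmbedding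
  exact (h.measure_preimage_emb he K).symm

theorem volume_between_graphs {a b : ℝ} (hab : a ≤ b) {S : Set (ℝ × ℝ)} (hS : IsClosed S)
    {f g : ℝ → ℝ} (hf : ContinuousOn f (Set.Icc a b)) (hg : ContinuousOn g (Set.Icc a b))
    (hgf : ∀ x ∈ Set.Icc a b, g x ≤ f x)
    (hmem : ∀ x y, (x, y) ∈ S ↔ x ∈ Set.Icc a b ∧ y ∈ Set.Icc (g x) (f x)) :
    volume S = ENNReal.ofReal ((∫ x in a..b, f x) - ∫ x in a..b, g x) := by
  rw [Measure.volume_eq_prod, Measure.prod_apply hS.measurableSet]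
  have h1 : ∀ x, volume (Prod.mk x ⁻¹' S) =
      (Set.Icc a b).indicator (fun x => ENNReal.ofReal (f x - g x)) x := by
    intro x
    by_cases hx : x ∈ Set.Icc a b
    · rw [Set.indicator_of_mem hx, ← Real.volume_Icc]
      congr 1
      ext y
      simp only [Set.mem_preimage, hmem, hx, true_and]
    · rw [Set.indicator_of_notMem hx]
      have : Prod.mk x ⁻¹' S = ∅ := by
        ext y
        simp only [Set.mem_preimage, hmem, hx, false_and, Set.mem_empty_iff_false]
      rw [this, measure_empty]
  have hii : ∀ {h : ℝ → ℝ}, ContinuousOn h (Set.Icc a b) → IntervalIntegrable h volume a b :=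
    fun hh => (hh.mono (by rw [Set.uIcc_of_le hab])).intervalIntegrable
  simp_rw [h1]
  rw [lintegral_indicator measurableSet_Icc, ← intervalIntegral.integral_sub (hii hf) (hii hg),
    intervalIntegral.integral_of_le hab, ← integral_Icc_eq_integral_Ioc]
  refine (ofReal_integral_eq_lintegral_ofReal ?_ ?_).symm
  · exact (hf.sub hg).integrableOn_Icc
  · filter_upwards [ae_restrict_mem measurableSet_Icc] with x hx
    exact sub_nonneg.2 (hgf x hx)

theorem mem_frontier_of_forall_add_notMem {K : Set ℝ²} {p v : ℝ²} (hp : p ∈ K)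
    (hv : ∀ t : ℝ, 0 < t → p + t • v ∉ K) : p ∈ frontier K := by
  refine ⟨subset_closure hp, fun hint => ?_⟩
  have hc : Continuous fun t : ℝ => p + t • v := by fun_prop
  have h0 : ∀ᶠ t in nhds (0 : ℝ), p + t • v ∈ K :=
    hc.continuousAt.eventually_mem (by simpa using mem_interior_iff_mem_nhds.1 hint)
  obtain ⟨t, ht, ht'⟩ := ((h0.filter_mono nhdsWithin_le_nhds).and
    (self_mem_nhdsWithin (s := Set.Ioi (0 : ℝ)))).exists
  exact hv t ht' ht

/-- The isoperimetric-type inequality for a convex body whose diameter is attained by the segment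
from `(-a, 0)` to `(a, 0)`, obtained by comparison with circular arcs of radius `R` and
half-angle `θ` on this segment. -/
theorem volume_add_le_mul_perimeter {a R θ : ℝ} (ha : 0 < a) (hR : 0 < R) (hθ : 0 ≤ θ)
    (hθ' : θ ≤ Real.pi / 2) (haR : a = R * Real.sin θ) {K : Set ℝ²} (hK : IsClosed K)
    (hconv : Convex ℝ K) (hl : !₂[-a, 0] ∈ K) (hr : !₂[a, 0] ∈ K)
    (hbl : ∀ p ∈ K, (p 0 + a) ^ 2 + p 1 ^ 2 ≤ 4 * a ^ 2)
    (hbr : ∀ p ∈ K, (p 0 - a) ^ 2 + p 1 ^ 2 ≤ 4 * a ^ 2)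
    (hne : ∃ p ∈ K, p 1 ≠ 0) (hfin : μH[1] (frontier K) ≠ ⊤) :
    (volume K).toReal + 2 * R ^ 2 * (θ + Real.sin θ * Real.cos θ) ≤
      R * (μH[1] (frontier K)).toReal := by
  have hsection : ∀ σ : ℝ, ∃ f : ℝ → ℝ, ContinuousOn f (Set.Icc (-a) a) ∧ f (-a) = 0 ∧
      f a = 0 ∧ ∀ x ∈ Set.Icc (-a) a, σ ^ 2 = 1 →
        IsGreatest {y | (!₂[x, σ * y] : ℝ²) ∈ K} (f x) := by
    intro σ
    by_cases hσ : σ ^ 2 = 1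
    swap
    · exact ⟨0, continuousOn_const, rfl, rfl, fun _ _ h => absurd h hσ⟩
    obtain ⟨f, h1, h2, h3, h4⟩ := exists_continuousOn_isGreatest_section ha
      (S := {q : ℝ × ℝ | (!₂[q.1, σ * q.2] : ℝ²) ∈ K})
      (hK.preimage (by fun_prop)) (by
        intro p hp q hq s t hs ht hst
        have := hconv hp hq hs ht hst
        simp only [Set.mem_ofPred_eq]
        convert this using 1
        ext i
        fin_cases i <;> simp
        ring) (by simpa using hl) (by simpa using hr)
      (fun p hp => by simpa [mul_pow, hσ] using hbl _ hp)
      (fun p hp => by simpa [mul_pow, hσ] using hbr _ hp)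
    exact ⟨f, h1, h2, h3, fun x hx _ => h4 x hx⟩
  obtain ⟨f, hfc, hfl, hfr, hfg⟩ := hsection 1
  obtain ⟨g, hgc, hgl, hgr, hgg⟩ := hsection (-1)
  have hfmem : ∀ x ∈ Set.Icc (-a) a, (!₂[x, f x] : ℝ²) ∈ K := fun x hx => by
    simpa using (hfg x hx (by norm_num)).1
  have hgmem : ∀ x ∈ Set.Icc (-a) a, (!₂[x, -g x] : ℝ²) ∈ K := fun x hx => by
    simpa using (hgg x hx (by norm_num)).1
  have hfle : ∀ x ∈ Set.Icc (-a) a, ∀ y, (!₂[x, y] : ℝ²) ∈ K → y ≤ f x := fun x hx y hy =>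
    (hfg x hx (by norm_num)).2 (by simpa using hy)
  have hgle : ∀ x ∈ Set.Icc (-a) a, ∀ y, (!₂[x, -y] : ℝ²) ∈ K → y ≤ g x := fun x hx y hy =>
    (hgg x hx (by norm_num)).2 (by simpa using hy)
  have haa : -a ≤ a := by linarith
  have hstrip : ∀ p ∈ K, p 0 ∈ Set.Icc (-a) a := by
    intro p hp
    have h1 := hbl p hp
    have h2 := hbr p hp
    have h3 := abs_le_of_sq_le_sq' (a := p 0 + a) (b := 2 * a)
      (by nlinarith [sq_nonneg (p 1)]) (by linarith)
    have h4 := abs_le_of_sq_le_sq' (a := p 0 - a) (b := 2 * a)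
      (by nlinarith [sq_nonneg (p 1)]) (by linarith)
    exact ⟨by linarith [h4.1], by linarith [h3.2]⟩
  have hseg : ∀ p ∈ K, ∀ q ∈ K, ∀ t : ℝ, 0 ≤ t → t ≤ 1 →
      (!₂[(1 - t) * p 0 + t * q 0, (1 - t) * p 1 + t * q 1] : ℝ²) ∈ K := by
    intro p hp q hq t h0 h1
    convert hconv hp hq (sub_nonneg.2 h1) h0 (by ring) using 1
    ext i
    fin_cases i <;> simp
  have hzero : ∀ x ∈ Set.Icc (-a) a, (!₂[x, 0] : ℝ²) ∈ K := by
    intro x hx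
    have h := hseg _ hl _ hr ((x + a) / (2 * a)) (div_nonneg (by linarith [hx.1]) (by linarith))
      (by rw [div_le_one (by linarith)]; linarith [hx.2])
    convert h using 2
    ext i
    fin_cases i
    · simp; field_simp; ring
    · simp
  have hf0 : ∀ x ∈ Set.Icc (-a) a, 0 ≤ f x :=
    fun x hx => hfle x hx 0 (hzero x hx)
  have hg0 : ∀ x ∈ Set.Icc (-a) a, 0 ≤ g x :=
    fun x hx => hgle x hx 0 (by simpa using hzero x hx)
  -- The two graphs are disjoint over the open interval.
  have hpos : ∀ x ∈ Set.Ioo (-a) a, f x ≠ - g x := by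
    intro x hx hxfg
    have hx' := Set.Ioo_subset_Icc_self hx
    have hfx : f x = 0 := by linarith [hf0 x hx', hg0 x hx']
    have hgx : g x = 0 := by linarith [hf0 x hx', hg0 x hx']
    obtain ⟨p, hp, hp1⟩ := hne
    obtain ⟨e, t, ht0, ht1, he, hxe⟩ : ∃ e t : ℝ, 0 ≤ t ∧ t < 1 ∧ (!₂[e, 0] : ℝ²) ∈ K ∧
        x = (1 - t) * p 0 + t * e := by
      have hp0 := hstrip p hp
      rcases le_total x (p 0) with h | h
      · have hd : 0 < p 0 + a := by linarith [hx.1]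
        refine ⟨-a, (p 0 - x) / (p 0 + a), div_nonneg (by linarith) hd.le, ?_, hl, ?_⟩
        · rw [div_lt_one hd]; linarith [hx.1]
        · field_simp; ring
      · have hd : 0 < a - p 0 := by linarith [hx.2]
        refine ⟨a, (x - p 0) / (a - p 0), div_nonneg (by linarith) hd.le, ?_, hr, ?_⟩
        · rw [div_lt_one hd]; linarith [hx.2]
        · field_simp; ring
    have hmem := hseg p hp _ he t ht0 ht1.le
    simp only [Matrix.cons_val_zero, Matrix.cons_val_one, mul_zero, add_zero,
      ← hxe] at hmem
    have h1 := hfle x hx' _ hmem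
    have h2 := hgle x hx' (-((1 - t) * p 1)) (by simpa using hmem)
    have : (1 - t) * p 1 = 0 := by linarith
    rcases mul_eq_zero.1 this with h | h
    · linarith
    · exact hp1 h
  have hvol : (volume K).toReal = (∫ x in -a..a, f x) + ∫ x in -a..a, g x := by
    have h1 := volume_between_graphs haa (S := {q : ℝ × ℝ | (!₂[q.1, q.2] : ℝ²) ∈ K})
      (hK.preimage (by fun_prop)) hfc hgc.neg
      (fun x hx => by simp only [Pi.neg_apply]; linarith [hf0 x hx, hg0 x hx]) (by
        intro x y
        simp only [Set.mem_ofPred_eq, Pi.neg_apply]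
        constructor
        · intro h
          have hx : x ∈ Set.Icc (-a) a := by simpa using hstrip _ h
          refine ⟨hx, ?_, hfle x hx y h⟩
          linarith [hgle x hx (-y) (by simpa using h)]
        · rintro ⟨hx, hy1, hy2⟩
          rcases eq_or_lt_of_le (hy1.trans hy2) with h | h
          · rw [show y = f x by linarith]
            exact hfmem x hx
          · have hd : 0 < f x + g x := by linarith
            have := hseg _ (hgmem x hx) _ (hfmem x hx) ((y + g x) / (f x + g x))
              (div_nonneg (by linarith) hd.le)
              (by rw [div_le_one hd]; linarith)
            convert this using 2
            ext i
            fin_cases i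
            · simp; ring
            · simp; field_simp; ring)
    rw [volume_eq_volume_coordinates, h1, ENNReal.toReal_ofReal]
    · simp only [Pi.neg_apply, intervalIntegral.integral_neg]; ring
    · have hi : 0 ≤ ∫ x in -a..a, f x := intervalIntegral.integral_nonneg haa hf0
      have hj : 0 ≤ ∫ x in -a..a, g x := intervalIntegral.integral_nonneg haa hg0
      simp only [Pi.neg_apply, intervalIntegral.integral_neg]
      linarith
  set Γf := (fun x => (!₂[x, 1 * f x] : ℝ²)) '' Set.Ioo (-a) a
  set Γg := (fun x => (!₂[x, (-1) * g x] : ℝ²)) '' Set.Ioo (-a) a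
  have hsubf : Γf ⊆ frontier K := by
    rintro _ ⟨x, hx, rfl⟩
    have hx' := Set.Ioo_subset_Icc_self hx
    refine mem_frontier_of_forall_add_notMem (v := !₂[0, 1])
      (by simpa using hfmem x hx') fun t ht hmem => ?_
    have := hfle x hx' (f x + t) (by
      convert hmem using 1
      ext i
      fin_cases i <;> simp)
    linarith
  have hsubg : Γg ⊆ frontier K := by
    rintro _ ⟨x, hx, rfl⟩
    have hx' := Set.Ioo_subset_Icc_self hx
    refine mem_frontier_of_forall_add_notMem (v := !₂[0, -1])
      (by simpa using hgmem x hx') fun t ht hmem => ?_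
    have := hgle x hx' (g x + t) (by
      convert hmem using 1
      ext i
      fin_cases i <;> simp
      ring)
    linarith
  have hdisj : Disjoint Γf Γg := by
    rw [Set.disjoint_left]
    rintro _ ⟨x, hx, rfl⟩ ⟨y, hy, hxy⟩
    have h0 : y = x := by simpa using congrArg (fun p : ℝ² => p 0) hxy
    have h1 : -g y = f x := by simpa using congrArg (fun p : ℝ² => p 1) hxy
    subst h0
    exact hpos y hx h1.symm
  have hmeas : MeasurableSet Γg := by
    have hcomp : IsCompact ((fun x => (!₂[x, (-1) * g x] : ℝ²)) '' Set.Icc (-a) a) :=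
      isCompact_Icc.image_of_continuousOn (by fun_prop)
    have : Γg = ((fun x => (!₂[x, (-1) * g x] : ℝ²)) '' Set.Icc (-a) a) ∩
        (fun p : ℝ² => p 0) ⁻¹' Set.Ioo (-a) a := by
      ext p
      constructor
      · rintro ⟨x, hx, rfl⟩
        exact ⟨⟨x, Set.Ioo_subset_Icc_self hx, rfl⟩, by simpa using hx⟩
      · rintro ⟨⟨x, hx, rfl⟩, hx'⟩
        exact ⟨x, by simpa using hx', rfl⟩
    rw [this]
    exact hcomp.measurableSet.inter
      ((by fun_prop : Measurable fun p : ℝ² => p 0) measurableSet_Ioo)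
  have hadd : (μH[1] Γf).toReal + (μH[1] Γg).toReal ≤ (μH[1] (frontier K)).toReal := by
    rw [← ENNReal.toReal_add (measure_ne_top_of_subset hsubf hfin)
      (measure_ne_top_of_subset hsubg hfin), ← measure_union hdisj hmeas]
    exact ENNReal.toReal_mono hfin (measure_mono (Set.union_subset hsubf hsubg))
  have haR' : a ≤ R := by
    rw [haR]; nlinarith [Real.sin_le_one θ]
  have hF := integral_add_integral_le_mul_hausdorffMeasure_graph ha.le haR' hR
    (σ := 1) (by norm_num) hfc hfl hfr (measure_ne_top_of_subset hsubf hfin)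
  have hG := integral_add_integral_le_mul_hausdorffMeasure_graph ha.le haR' hR
    (σ := -1) (by norm_num) hgc hgl hgr (measure_ne_top_of_subset hsubg hfin)
  have hI : ∫ x in -a..a, √(R ^ 2 - x ^ 2) = R ^ 2 * (θ + Real.sin θ * Real.cos θ) := by
    rw [haR]; exact integral_sqrt_sq_sub_sq hR.le hθ hθ'
  rw [hI] at hF hG
  have := mul_le_mul_of_nonneg_left hadd hR.le
  rw [hvol]
  linarith

/-- The two arcs of radius `r` and half-angle `θ` forming the boundary of a symmetric lens have
total length at most `4 * r * θ`. -/
theorem hausdorffMeasure_arcs_le {r θ : ℝ} (hr : 0 < r) (hθ : 0 ≤ θ) (hθ' : θ ≤ Real.pi / 2) :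
    μH[1] {p : ℝ² | p 0 ^ 2 + (|p 1| + r * Real.cos θ) ^ 2 = r ^ 2} ≤
      ENNReal.ofReal (4 * r * θ) := by
  set h := r * Real.cos θ with hh
  have hh0 : 0 ≤ h :=
    mul_nonneg hr.le (Real.cos_nonneg_of_mem_Icc ⟨by linarith, hθ'⟩)
  have harc : ∀ σ : ℝ, σ ^ 2 = 1 → μH[1] ((fun u : ℝ =>
      (!₂[r * Real.sin u, σ * (r * Real.cos u - h)] : ℝ²)) '' Set.Icc (-θ) θ) ≤
        ENNReal.ofReal (2 * r * θ) := by
    intro σ hσ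
    have hlip : LipschitzWith r.toNNReal (fun u : ℝ =>
        (!₂[r * Real.sin u, σ * (r * Real.cos u - h)] : ℝ²)) := by
      refine LipschitzWith.of_dist_le_mul fun u v => ?_
      rw [Real.coe_toNNReal _ hr.le, Real.dist_eq]
      refine abs_le_of_sq_le_sq' ?_ (by positivity) |>.2
      rw [euclideanPlane_dist_sq, mul_pow, sq_abs]
      simp only [Matrix.cons_val_zero, Matrix.cons_val_one]
      have h1 := Real.one_sub_sq_div_two_le_cos (x := u - v)
      rw [Real.cos_sub] at h1
      have h2 : (r * Real.sin u - r * Real.sin v) ^ 2 +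
          (σ * (r * Real.cos u - h) - σ * (r * Real.cos v - h)) ^ 2 =
          r ^ 2 * (2 - 2 * (Real.cos u * Real.cos v + Real.sin u * Real.sin v)) := by
        linear_combination r ^ 2 * (Real.cos u - Real.cos v) ^ 2 * hσ +
          r ^ 2 * Real.sin_sq_add_cos_sq u + r ^ 2 * Real.sin_sq_add_cos_sq v
      rw [h2]
      exact mul_le_mul_of_nonneg_left (by linarith) (sq_nonneg r)
    refine (hlip.hausdorffMeasure_image_le zero_le_one _).trans (le_of_eq ?_)
    rw [hausdorffMeasure_real, Real.volume_Icc, ENNReal.rpow_one, ENNReal.ofNNReal_toNNReal,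
      ← ENNReal.ofReal_mul hr.le]
    congr 1
    ring
  have hsub : {p : ℝ² | p 0 ^ 2 + (|p 1| + h) ^ 2 = r ^ 2} ⊆
      (fun u : ℝ => (!₂[r * Real.sin u, 1 * (r * Real.cos u - h)] : ℝ²)) '' Set.Icc (-θ) θ ∪
      (fun u : ℝ => (!₂[r * Real.sin u, (-1) * (r * Real.cos u - h)] : ℝ²)) '' Set.Icc (-θ) θ := by
    intro p hp
    have hp' : p 0 ^ 2 + (|p 1| + h) ^ 2 = r ^ 2 := hp
    have hcs : h ^ 2 + (r * Real.sin θ) ^ 2 = r ^ 2 := by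
      rw [hh]; linear_combination r ^ 2 * Real.sin_sq_add_cos_sq θ
    have hsin : 0 ≤ r * Real.sin θ :=
      mul_nonneg hr.le (Real.sin_nonneg_of_nonneg_of_le_pi hθ (by linarith [Real.pi_pos]))
    have hx := abs_le_of_sq_le_sq' (a := p 0) (b := r * Real.sin θ)
      (by nlinarith [abs_nonneg (p 1)]) hsin
    have hx1 : p 0 / r ≤ Real.sin θ := by rw [div_le_iff₀ hr]; linarith [hx.2]
    have hx2 : -Real.sin θ ≤ p 0 / r := by rw [le_div_iff₀ hr]; linarith [hx.1]
    set u := Real.arcsin (p 0 / r) with hu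
    have hsu : r * Real.sin u = p 0 := by
      rw [hu, Real.sin_arcsin (by linarith [Real.sin_le_one θ]) (by linarith [Real.sin_le_one θ])]
      field_simp
    have hcu : r * Real.cos u = |p 1| + h := by
      refine (pow_left_inj₀ (mul_nonneg hr.le (Real.cos_arcsin_nonneg _)) (by positivity)
        two_ne_zero).1 ?_
      linear_combination r ^ 2 * Real.sin_sq_add_cos_sq u - hp' -
        (r * Real.sin u + p 0) * hsu
    have hmem : u ∈ Set.Icc (-θ) θ := by
      constructor
      · rw [← Real.arcsin_sin (x := -θ) (by linarith) (by linarith), Real.sin_neg]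
        exact Real.monotone_arcsin hx2
      · rw [← Real.arcsin_sin (x := θ) (by linarith) hθ']
        exact Real.monotone_arcsin hx1
    rcases abs_cases (p 1) with ⟨h1, _⟩ | ⟨h1, _⟩
    · refine Or.inl ⟨u, hmem, ?_⟩
      ext i
      fin_cases i
      · simpa using hsu
      · simp [hcu, h1]
    · refine Or.inr ⟨u, hmem, ?_⟩
      ext i
      fin_cases i
      · simpa using hsu
      · simp [hcu, h1]
  refine (measure_mono hsub).trans ((measure_union_le _ _).trans
    ((add_le_add (harc 1 (by norm_num)) (harc (-1) (by norm_num))).trans (le_of_eq ?_)))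
  rw [← ENNReal.ofReal_add (by positivity) (by positivity)]
  congr 1
  ring

theorem mem_lens_iff {r h : ℝ} (hr : 0 ≤ r) (hh : 0 ≤ h) (p : ℝ²) :
    p ∈ Metric.closedBall (!₂[0, -h] : ℝ²) r ∩ Metric.closedBall (!₂[0, h] : ℝ²) r ↔
      p 0 ^ 2 + (|p 1| + h) ^ 2 ≤ r ^ 2 := by
  rw [Set.mem_inter_iff, Metric.mem_closedBall, Metric.mem_closedBall,
    ← pow_le_pow_iff_left₀ dist_nonneg hr two_ne_zero,
    ← pow_le_pow_iff_left₀ dist_nonneg hr two_ne_zero,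
    euclideanPlane_dist_sq, euclideanPlane_dist_sq]
  simp only [Matrix.cons_val_zero, Matrix.cons_val_one, sub_zero, sub_neg_eq_add]
  constructor
  · rintro ⟨h1, h2⟩
    rcases abs_cases (p 1) with ⟨h3, _⟩ | ⟨h3, _⟩ <;> rw [h3] <;> nlinarith
  · intro h1
    have h2 := sq_abs (p 1)
    constructor
    · nlinarith [mul_nonneg hh (sub_nonneg.2 (le_abs_self (p 1)))]
    · nlinarith [mul_nonneg hh (neg_le_iff_add_nonneg.1 (neg_abs_le (p 1)))]

/-- Area, perimeter and diameter of the symmetric lens of radius `r` and half-angle `θ`. -/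
theorem lens_area_perimeter_diam {r θ : ℝ} (hr : 0 < r) (hθ : 0 < θ) (hθ' : θ ≤ Real.pi / 2) :
    ∃ c₁ c₂ : ℝ², dist c₁ c₂ < 2 * r ∧
      volume (Metric.closedBall c₁ r ∩ Metric.closedBall c₂ r) =
        ENNReal.ofReal (2 * r ^ 2 * (θ - Real.sin θ * Real.cos θ)) ∧
      μH[1] (frontier (Metric.closedBall c₁ r ∩ Metric.closedBall c₂ r)) =
        ENNReal.ofReal (4 * r * θ) ∧
      2 * (r * Real.sin θ) ≤ Metric.diam (Metric.closedBall c₁ r ∩ Metric.closedBall c₂ r) := by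
  set h := r * Real.cos θ with hh
  set c := r * Real.sin θ with hc
  have hcs : c ^ 2 + h ^ 2 = r ^ 2 := by
    rw [hh, hc]; linear_combination r ^ 2 * Real.sin_sq_add_cos_sq θ
  have hc0 : 0 < c :=
    mul_pos hr (Real.sin_pos_of_pos_of_lt_pi hθ (by linarith [Real.pi_pos]))
  have hh0 : 0 ≤ h :=
    mul_nonneg hr.le (Real.cos_nonneg_of_mem_Icc ⟨by linarith, hθ'⟩)
  have hhr : h < r := by nlinarith
  set L : Set ℝ² := Metric.closedBall (!₂[0, -h] : ℝ²) r ∩ Metric.closedBall (!₂[0, h] : ℝ²) r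
  have hmem : ∀ p : ℝ², p ∈ L ↔ p 0 ^ 2 + (|p 1| + h) ^ 2 ≤ r ^ 2 := mem_lens_iff hr.le hh0
  have hclosed : IsClosed L := Metric.isClosed_closedBall.inter Metric.isClosed_closedBall
  have hLl : (!₂[-c, 0] : ℝ²) ∈ L := by rw [hmem]; simp [hcs]
  have hLr : (!₂[c, 0] : ℝ²) ∈ L := by rw [hmem]; simp [hcs]
  have hball : ∀ p ∈ L, p 0 ^ 2 + p 1 ^ 2 ≤ c ^ 2 := by
    intro p hp
    have h1 := (hmem p).1 hp
    nlinarith [sq_abs (p 1), mul_nonneg hh0 (abs_nonneg (p 1))]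
  have hvol : volume L = ENNReal.ofReal (2 * r ^ 2 * (θ - Real.sin θ * Real.cos θ)) := by
    have hcont : Continuous fun x : ℝ => √(r ^ 2 - x ^ 2) - h := by fun_prop
    rw [volume_eq_volume_coordinates, volume_between_graphs (a := -c) (b := c) (by linarith)
      (S := {q : ℝ × ℝ | (!₂[q.1, q.2] : ℝ²) ∈ L})
      (f := fun x => √(r ^ 2 - x ^ 2) - h) (g := fun x => -(√(r ^ 2 - x ^ 2) - h))
      (hclosed.preimage (by fun_prop)) hcont.continuousOn hcont.neg.continuousOn]
    · have hI : ∫ x in -c..c, √(r ^ 2 - x ^ 2) = r ^ 2 * (θ + Real.sin θ * Real.cos θ) :=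
        integral_sqrt_sq_sub_sq hr.le hθ.le hθ'
      rw [intervalIntegral.integral_neg, intervalIntegral.integral_sub
        (Continuous.intervalIntegrable (by fun_prop) _ _) intervalIntegrable_const, hI,
        intervalIntegral.integral_const, smul_eq_mul, hc, hh]
      congr 1
      ring
    · intro x hx
      have : h ≤ √(r ^ 2 - x ^ 2) := Real.le_sqrt_of_sq_le (by nlinarith [hx.1, hx.2])
      linarith
    · intro x y
      simp only [Set.mem_ofPred_eq, hmem, Matrix.cons_val_zero,
        Matrix.cons_val_one, Set.mem_Icc, ← abs_le]
      constructor
      · intro h1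
        refine ⟨abs_le_of_sq_le_sq ?_ hc0.le, ?_⟩
        · nlinarith [abs_nonneg y]
        · have := Real.le_sqrt_of_sq_le (x := |y| + h) (y := r ^ 2 - x ^ 2) (by linarith)
          linarith
      · rintro ⟨h1, h2⟩
        have hx : x ^ 2 ≤ c ^ 2 := sq_le_sq' (abs_le.1 h1).1 (abs_le.1 h1).2
        have h3 : |y| + h ≤ √(r ^ 2 - x ^ 2) := by linarith
        have h4 := pow_le_pow_left₀ (by positivity) h3 2
        rw [Real.sq_sqrt (by nlinarith)] at h4
        linarith
  have hupper : μH[1] (frontier L) ≤ ENNReal.ofReal (4 * r * θ) := by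
    refine (measure_mono fun p hp => ?_).trans (hausdorffMeasure_arcs_le hr hθ.le hθ')
    have hpL : p ∈ L := hclosed.frontier_subset hp
    refine le_antisymm ((hmem p).1 hpL) (not_lt.1 fun hlt => hp.2 ?_)
    have hopen : IsOpen {q : ℝ² | q 0 ^ 2 + (|q 1| + h) ^ 2 < r ^ 2} :=
      isOpen_lt (by fun_prop) continuous_const
    refine mem_interior_iff_mem_nhds.2 ?_
    filter_upwards [hopen.mem_nhds hlt] with q hq
    exact (hmem q).2 (le_of_lt hq)
  have hfin : μH[1] (frontier L) ≠ ⊤ := (hupper.trans_lt ENNReal.ofReal_lt_top).ne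
  have hpos : 0 ≤ 2 * r ^ 2 * (θ - Real.sin θ * Real.cos θ) := by
    have h1 := Real.sin_le (x := 2 * θ) (by linarith)
    rw [Real.sin_two_mul] at h1
    exact mul_nonneg (by positivity) (by linarith)
  refine ⟨!₂[0, -h], !₂[0, h], ?_, hvol, le_antisymm hupper ?_, ?_⟩
  · refine abs_lt_of_sq_lt_sq' ?_ (by linarith) |>.2
    rw [euclideanPlane_dist_sq]
    simp only [Matrix.cons_val_zero, Matrix.cons_val_one]
    nlinarith
  · have hkey := volume_add_le_mul_perimeter hc0 hr hθ.le hθ' hc hclosed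
      ((convex_closedBall _ _).inter (convex_closedBall _ _)) hLl hLr
      (fun p hp => by
        have := hball p hp
        nlinarith [sq_nonneg (p 0 - c), sq_nonneg (p 1)])
      (fun p hp => by
        have := hball p hp
        nlinarith [sq_nonneg (p 0 + c), sq_nonneg (p 1)])
      ⟨!₂[0, r - h], by
        rw [hmem]
        simp [abs_of_nonneg (sub_nonneg.2 hhr.le)], by simp; linarith⟩ hfin
    rw [hvol, ENNReal.toReal_ofReal hpos] at hkey
    rw [ENNReal.ofReal_le_iff_le_toReal hfin]
    refine le_of_mul_le_mul_left ?_ hr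
    linarith
  · have hd := Metric.dist_le_diam_of_mem
      (Metric.isBounded_closedBall.subset Set.inter_subset_left) hLl hLr
    refine le_trans ?_ hd
    refine (abs_le_of_sq_le_sq' ?_ dist_nonneg).2
    rw [euclideanPlane_dist_sq]
    simp only [Matrix.cons_val_zero, Matrix.cons_val_one]
    linarith

theorem hausdorffMeasure_frontier_ne_top {K : Set ℝ²} (hK : IsCompact K) (hconv : Convex ℝ K)
    (hint : (interior K).Nonempty) : μH[1] (frontier K) ≠ ⊤ := by
  have hne : K.Nonempty := hint.mono interior_subset
  have hproj : ∀ u : ℝ², ∃ v ∈ K, ∀ w ∈ K, inner ℝ (u - v) (w - v) ≤ 0 := fun u => by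
    obtain ⟨v, hv, h⟩ := exists_norm_eq_iInf_of_complete_convex hne hK.isComplete hconv u
    exact ⟨v, hv, (norm_eq_iInf_iff_real_inner_le_zero hconv hv).1 h⟩
  choose π hπK hπ using hproj
  have hlip : LipschitzWith 1 π := by
    refine LipschitzWith.of_dist_le_mul fun u v => ?_
    rw [NNReal.coe_one, one_mul, dist_eq_norm, dist_eq_norm]
    have h1 := hπ u _ (hπK v)
    have h2 := hπ v _ (hπK u)
    have h3 : ‖π u - π v‖ ^ 2 ≤ inner ℝ (u - v) (π u - π v) := by
      rw [← real_inner_self_eq_norm_sq]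
      simp only [inner_sub_left, inner_sub_right] at h1 h2 ⊢
      linarith
    have h4 := real_inner_le_norm (u - v) (π u - π v)
    by_contra hlt
    push Not at hlt
    nlinarith [norm_nonneg (u - v)]
  obtain ⟨M, hM0, hM⟩ : ∃ M > 0, ∀ p ∈ K, ‖p‖ ≤ M := by
    obtain ⟨M, hM⟩ := hK.isBounded.exists_norm_le
    exact ⟨max M 1, by positivity, fun p hp => (hM p hp).trans (le_max_left _ _)⟩
  have hsub : frontier K ⊆ π '' {p : ℝ² | ‖p‖ = M} := by
    intro x hx
    have hxK : x ∈ K := hK.isClosed.frontier_subset hx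
    obtain ⟨φ, hφ⟩ := geometric_hahn_banach_open_point hconv.interior isOpen_interior hx.2
    set n := (InnerProductSpace.toDual ℝ ℝ²).symm φ
    have hinner : ∀ p, inner ℝ n p = φ p := fun p => InnerProductSpace.toDual_symm_apply
    have hle : ∀ p ∈ K, φ p ≤ φ x := by
      intro p hp
      have hp' : p ∈ closure (interior K) := by
        rw [hconv.closure_interior_eq_closure_of_nonempty_interior hint]
        exact subset_closure hp
      exact closure_minimal (fun q hq => (hφ q hq).le)
        (isClosed_le φ.continuous continuous_const) hp'
    have hn0 : n ≠ 0 := by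
      intro h0
      obtain ⟨q, hq⟩ := hint
      have := hφ q hq
      rw [← hinner, ← hinner, h0, inner_zero_left, inner_zero_left] at this
      exact lt_irrefl _ this
    have hnpos : 0 < ‖n‖ := norm_pos_iff.2 hn0
    have hcont : ContinuousOn (fun t : ℝ => ‖x + t • n‖) (Set.Icc 0 (2 * M / ‖n‖)) := by fun_prop
    obtain ⟨t, ht, htM⟩ := intermediate_value_Icc (by positivity) hcont
      (show M ∈ Set.Icc _ _ from ⟨by simpa using hM x hxK, by
        have h1 : ‖(2 * M / ‖n‖) • n‖ = 2 * M := by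
          rw [norm_smul, Real.norm_of_nonneg (by positivity)]; field_simp
        have h2 := norm_sub_le (x + (2 * M / ‖n‖) • n) x
        rw [add_sub_cancel_left, h1] at h2
        linarith [hM x hxK]⟩)
    refine ⟨x + t • n, htM, ?_⟩
    have h1 := hπ (x + t • n) x hxK
    have h2 : inner ℝ n (π (x + t • n) - x) ≤ 0 := by
      rw [hinner, map_sub]; linarith [hle _ (hπK (x + t • n))]
    have h3 : ‖x - π (x + t • n)‖ ^ 2 ≤ 0 := by
      set q := π (x + t • n)
      rw [← real_inner_self_eq_norm_sq]
      have h4 := mul_nonpos_of_nonneg_of_nonpos ht.1 h2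
      have h5 : inner ℝ (x + t • n - q) (x - q) =
          inner ℝ (x - q) (x - q) - t * inner ℝ n (q - x) := by
        rw [show x + t • n - q = (x - q) + t • n by abel, inner_add_left, real_inner_smul_left,
          ← neg_sub q x, inner_neg_right (𝕜 := ℝ) n]
        ring
      linarith
    have h6 : ‖x - π (x + t • n)‖ = 0 := by
      have := norm_nonneg (x - π (x + t • n))
      nlinarith
    exact (sub_eq_zero.1 (norm_eq_zero.1 h6)).symm
  have hcircle : μH[1] {p : ℝ² | ‖p‖ = M} ≠ ⊤ := by
    have h := hausdorffMeasure_arcs_le hM0 (θ := Real.pi / 2) (by positivity) le_rfl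
    refine ((measure_mono fun p hp => ?_).trans_lt (h.trans_lt ENNReal.ofReal_lt_top)).ne
    have h1 := euclideanPlane_dist_sq p 0
    rw [dist_zero_right, show ‖p‖ = M from hp] at h1
    simpa using h1.symm
  have h := hlip.hausdorffMeasure_image_le zero_le_one {p : ℝ² | ‖p‖ = M}
  simp only [ENNReal.coe_one, ENNReal.one_rpow, one_mul] at h
  exact ((measure_mono hsub).trans_lt (h.trans_lt hcircle.lt_top)).ne

/-- The parameters of the symmetric lens of area `A` and perimeter `P`. -/
theorem exists_lens_parameters {A P a : ℝ} (hA : 0 < A) (ha : 0 < a)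
    (H : ∀ R θ : ℝ, 0 < R → 0 ≤ θ → θ ≤ Real.pi / 2 → a = R * Real.sin θ →
      A + 2 * R ^ 2 * (θ + Real.sin θ * Real.cos θ) ≤ R * P) :
    ∃ r θ : ℝ, 0 < r ∧ 0 < θ ∧ θ ≤ Real.pi / 2 ∧ 4 * r * θ = P ∧
      2 * r ^ 2 * (θ - Real.sin θ * Real.cos θ) = A ∧ a ≤ r * Real.sin θ := by
  have hπ := Real.pi_pos
  have hiso := H a (Real.pi / 2) ha (by positivity) le_rfl (by simp)
  simp only [Real.sin_pi_div_two, Real.cos_pi_div_two, mul_zero, add_zero] at hiso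
  have hP : 0 < P := by
    by_contra hP
    push Not at hP
    nlinarith [mul_pos (mul_pos ha ha) hπ]
  have hiso' : 4 * Real.pi * A ≤ P ^ 2 := by
    have h1 : (A + Real.pi * a ^ 2) ^ 2 ≤ (a * P) ^ 2 :=
      pow_le_pow_left₀ (by positivity) (by linarith) 2
    have h2 : a ^ 2 * (4 * Real.pi * A) ≤ a ^ 2 * P ^ 2 := by
      nlinarith [sq_nonneg (A - Real.pi * a ^ 2)]
    exact le_of_mul_le_mul_left h2 (by positivity)
  set F : ℝ → ℝ := fun θ => P ^ 2 * (θ - Real.sin θ * Real.cos θ) - 8 * A * θ ^ 2 with hF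
  obtain ⟨ε, hε0, hεπ, hFε⟩ : ∃ ε, 0 < ε ∧ ε ≤ Real.pi / 2 ∧ F ε ≤ 0 := by
    refine ⟨min (Real.pi / 2) (A / P ^ 2), by positivity, min_le_left _ _, ?_⟩
    set ε := min (Real.pi / 2) (A / P ^ 2)
    have hε : 0 < ε := by positivity
    have h1 := Real.sin_gt_sub_cube (x := 2 * ε) (by positivity)
    rw [Real.sin_two_mul] at h1
    have h2 : P ^ 2 * ε ≤ A := by
      have := min_le_right (Real.pi / 2) (A / P ^ 2)
      rw [le_div_iff₀ (by positivity)] at this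
      linarith
    have h3 : ε - Real.sin ε * Real.cos ε ≤ ε ^ 3 := by nlinarith [pow_pos hε 3]
    have h4 := mul_le_mul_of_nonneg_left h3 (sq_nonneg P)
    have h5 := mul_le_mul_of_nonneg_right h2 (sq_nonneg ε)
    have h6 : 0 ≤ A * ε ^ 2 := by positivity
    simp only [hF]
    nlinarith
  have hFπ : 0 ≤ F (Real.pi / 2) := by
    simp only [hF, Real.cos_pi_div_two, mul_zero, sub_zero]
    nlinarith
  obtain ⟨θ, ⟨hεθ, hθ'⟩, hFθ⟩ := intermediate_value_Icc hεπ (f := F) (by fun_prop) ⟨hFε, hFπ⟩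
  have hθ : 0 < θ := hε0.trans_le hεθ
  simp only [hF] at hFθ
  set r := P / (4 * θ) with hrdef
  have hr : 0 < r := by positivity
  have hPr : 4 * r * θ = P := by rw [hrdef]; field_simp
  have hAr : 2 * r ^ 2 * (θ - Real.sin θ * Real.cos θ) = A := by
    refine mul_left_cancel₀ (by positivity : 8 * θ ^ 2 ≠ 0) ?_
    rw [← hPr] at hFθ
    linear_combination hFθ
  refine ⟨r, θ, hr, hθ, hθ', hPr, hAr, ?_⟩
  have hsin : 0 < Real.sin θ := Real.sin_pos_of_pos_of_lt_pi hθ (by linarith)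
  have hcos : 0 ≤ Real.cos θ := Real.cos_nonneg_of_mem_Icc ⟨by linarith, hθ'⟩
  by_contra hlt
  push Not at hlt
  have hR : r < a / Real.sin θ := by rwa [lt_div_iff₀ hsin]
  have hH := H (a / Real.sin θ) θ (hr.trans hR) hθ.le hθ' (by field_simp)
  set R := a / Real.sin θ
  rw [← hPr, ← hAr] at hH
  have hsc := mul_nonneg hsin.le hcos
  nlinarith [mul_pos (sub_pos.2 hR) (sub_pos.2 hR), mul_nonneg (sub_nonneg.2 hR.le) hr.le,
    mul_nonneg (mul_nonneg (sub_nonneg.2 hR.le) (hr.trans hR).le) hsc,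
    mul_nonneg (mul_nonneg (sub_nonneg.2 hR.le) hr.le) hsc,
    mul_pos hθ (mul_pos (sub_pos.2 hR) (sub_pos.2 hR))]

/-- A planar convex body can be moved so that its diameter lies along the first axis, centered at
the origin. -/
theorem exists_isometryEquiv_diameter {K : Set ℝ²} (hK : IsCompact K)
    (hint : (interior K).Nonempty) :
    ∃ (a : ℝ) (m : ℝ²) (Ψ : ℝ² ≃ₗᵢ[ℝ] ℝ²), 0 < a ∧ Metric.diam K = 2 * a ∧
      Ψ !₂[-a, 0] + m ∈ K ∧ Ψ !₂[a, 0] + m ∈ K := by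
  have hne : K.Nonempty := hint.mono interior_subset
  obtain ⟨⟨x, y⟩, ⟨hx, hy⟩, hmax⟩ := (hK.prod hK).exists_isMaxOn (hne.prod hne)
    (f := fun q : ℝ² × ℝ² => dist q.1 q.2) (by fun_prop)
  have hle : ∀ p ∈ K, ∀ q ∈ K, dist p q ≤ dist x y := fun p hp q hq =>
    isMaxOn_iff.1 hmax (p, q) (Set.mk_mem_prod hp hq)
  have hdiam : Metric.diam K = dist x y :=
    le_antisymm (Metric.diam_le_of_forall_dist_le dist_nonneg hle)
      (Metric.dist_le_diam_of_mem hK.isBounded hx hy)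
  have hpos : 0 < dist x y := by
    refine lt_of_le_of_ne dist_nonneg fun h0 => ?_
    have hsub : K ⊆ {x} := fun p hp => dist_le_zero.1 ((hle p hp x hx).trans h0.symm.le)
    obtain ⟨q, hq⟩ := hint
    have := interior_mono hsub hq
    rw [interior_singleton] at this
    exact this
  set a := dist x y / 2 with ha
  have ha0 : 0 < a := by positivity
  have hnorm : ‖(!₂[a, 0] : ℝ²)‖ = ‖(1 / 2 : ℝ) • (y - x)‖ := by
    rw [norm_smul, ← dist_eq_norm, dist_comm, EuclideanSpace.norm_eq]
    simp only [Fin.sum_univ_two, Matrix.cons_val_zero, Matrix.cons_val_one,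
      Real.norm_eq_abs, sq_abs]
    rw [zero_pow two_ne_zero, add_zero, Real.sqrt_sq ha0.le, ha, abs_of_pos (by norm_num)]
    ring
  obtain ⟨Ψ, hΨ⟩ : ∃ Ψ : ℝ² ≃ₗᵢ[ℝ] ℝ², Ψ !₂[a, 0] = (1 / 2 : ℝ) • (y - x) :=
    ⟨_, Submodule.reflection_sub hnorm⟩
  have hneg : (!₂[-a, 0] : ℝ²) = -!₂[a, 0] := by
    ext i
    fin_cases i <;> simp
  refine ⟨a, (1 / 2 : ℝ) • (x + y), Ψ, ha0, by rw [hdiam, ha]; ring, ?_, ?_⟩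
  · rw [hneg, map_neg, hΨ]
    convert hx using 1
    module
  · rw [hΨ]
    convert hy using 1
    module

/-- Among planar convex bodies of specified area and perimeter, the diameter is maximized by a
symmetric lens: for every compact convex planar body `K` there are two closed disks of equal
radius (with centers at distance less than twice the radius) whose intersection `L` has the
same area and perimeter as `K` and diameter at least that of `K`. -/
theorem symmetric_lens_maximizes_diameter
    (K : Set (EuclideanSpace ℝ (Fin 2)))
    (hKcomp : IsCompact K) (hKconv : Convex ℝ K) (hKint : (interior K).Nonempty) :
    ∃ (c₁ c₂ : EuclideanSpace ℝ (Fin 2)) (r : ℝ),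
      dist c₁ c₂ < 2 * r ∧
      volume (Metric.closedBall c₁ r ∩ Metric.closedBall c₂ r) = volume K ∧
      μH[1] (frontier (Metric.closedBall c₁ r ∩ Metric.closedBall c₂ r)) =
        μH[1] (frontier K) ∧
      Metric.diam K ≤ Metric.diam (Metric.closedBall c₁ r ∩ Metric.closedBall c₂ r) := by
  obtain ⟨a, m, Ψ, ha, hdiam, hl, hr⟩ := exists_isometryEquiv_diameter hKcomp hKint
  set e : ℝ² ≃ᵢ ℝ² := Ψ.toIsometryEquiv.trans (IsometryEquiv.addRight m)
  have he : ∀ p, e p = Ψ p + m := fun _ => rfl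
  set K' := e ⁻¹' K with hK'
  have hvol : volume K' = volume K :=
    ((measurePreserving_add_right volume m).comp Ψ.measurePreserving).measure_preimage
      hKcomp.measurableSet.nullMeasurableSet
  have hfront : μH[1] (frontier K') = μH[1] (frontier K) := by
    rw [← e.hausdorffMeasure_preimage 1 (frontier K)]
    congr 1
    exact (e.toHomeomorph.preimage_frontier K).symm
  have hfin := hausdorffMeasure_frontier_ne_top hKcomp hKconv hKint
  have hclosed : IsClosed K' := hKcomp.isClosed.preimage e.continuous
  have hconv : Convex ℝ K' := by
    intro p hp q hq s t hs ht hst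
    have := hKconv hp hq hs ht hst
    rw [he, he] at this
    change Ψ (s • p + t • q) + m ∈ K
    convert this using 1
    rw [map_add, map_smul, map_smul]
    nth_rewrite 1 [← one_smul ℝ m]
    rw [← hst]
    module
  have hdist : ∀ p ∈ K', ∀ q ∈ K', dist p q ^ 2 ≤ 4 * a ^ 2 := by
    intro p hp q hq
    have h1 := Metric.dist_le_diam_of_mem hKcomp.isBounded hp hq
    rw [e.dist_eq, hdiam] at h1
    have := pow_le_pow_left₀ dist_nonneg h1 2
    linarith
  have hne : ∃ p ∈ K', p 1 ≠ 0 := by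
    obtain ⟨q, hq⟩ := hKint
    have hp : e.symm q ∈ interior K' := by
      rw [hK', ← IsometryEquiv.coe_toHomeomorph, ← Homeomorph.preimage_interior]
      simpa using hq
    by_contra hall
    push Not at hall
    refine (mem_frontier_of_forall_add_notMem (v := !₂[0, 1]) (interior_subset hp)
      fun t ht hmem => ?_).2 hp
    have h1 := hall _ (interior_subset hp)
    have h2 := hall _ hmem
    simp [h1] at h2
    exact ht.ne' h2
  have hA : 0 < (volume K).toReal :=
    ENNReal.toReal_pos (Measure.measure_pos_of_nonempty_interior volume hKint).ne'
      hKcomp.measure_lt_top.ne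
  obtain ⟨r, θ, hr0, hθ, hθ', hP, hArea, har⟩ := exists_lens_parameters hA ha
    (P := (μH[1] (frontier K)).toReal) fun R θ hR h0 h1 haR => by
      have := volume_add_le_mul_perimeter ha hR h0 h1 haR hclosed hconv hl hr
        (fun p hp => by
          have := hdist p hp _ hl
          rw [euclideanPlane_dist_sq] at this
          simpa using this)
        (fun p hp => by
          have := hdist p hp _ hr
          rw [euclideanPlane_dist_sq] at this
          simpa using this) hne (by rwa [hfront])
      rwa [hvol, hfront] at this
  obtain ⟨c₁, c₂, h1, h2, h3, h4⟩ := lens_area_perimeter_diam hr0 hθ hθ'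
  refine ⟨c₁, c₂, r, h1, ?_, ?_, ?_⟩
  · rw [h2, hArea, ENNReal.ofReal_toReal hKcomp.measure_lt_top.ne]
  · rw [h3, hP, ENNReal.ofReal_toReal hfin]
  · rw [hdiam]; linarith
end

section
/- There exist seven closed axis-aligned rectangles in ℝ² with dimensions 10 × 9.5, 16 × 3.5, 6 × 13.5, 15.5 × 4, 5.5 × 14, 18.5 × 1, and 2.5 × 17 — all of the same perimeter 39 but with pairwise distinct areas — which can be placed (by translations, allowing 90° rotations) with pairwise disjoint interiors so that their union is a 24 × 18 rectangle. -/
/-- The axis-aligned `w × h` rectangle `[0,w] × [0,h]` in the plane. -/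
def rectWH (w h : ℝ) : Set (ℝ × ℝ) := Set.Icc 0 w ×ˢ Set.Icc 0 h

/-- `S` is a placement of a `w × h` rectangle: a translate of `[0,w] × [0,h]`, optionally
preceded by a 90° rotation (which interchanges the roles of `w` and `h`). -/
def IsPlacement (w h : ℝ) (S : Set (ℝ × ℝ)) : Prop :=
  ∃ v : ℝ × ℝ, S = (fun p => p + v) '' rectWH w h ∨ S = (fun p => p + v) '' rectWH h w

/-- The dimensions of the seven isoperimetric tiles. -/
def dims8 : Fin 7 → ℝ × ℝ :=
  ![(10, 9.5), (16, 3.5), (6, 13.5), (15.5, 4), (5.5, 14), (18.5, 1), (2.5, 17)]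

/-- The lower-left corners of the seven tiles in a tiling of `[0,24] × [0,18]`. -/
def tileCorner : Fin 7 → ℝ × ℝ :=
  ![(8.5, 4.5), (2.5, 1), (2.5, 4.5), (8.5, 14), (18.5, 0), (0, 0), (0, 1)]

theorem image_add_rectWH (w h : ℝ) (v : ℝ × ℝ) :
    (fun p => p + v) '' rectWH w h = Set.Icc v.1 (w + v.1) ×ˢ Set.Icc v.2 (h + v.2) := by
  rw [rectWH, Set.Icc_prod_Icc, Set.image_add_const_Icc, Set.Icc_prod_eq]
  simp

/-- The seven rectangles of dimensions `10 × 9.5`, `16 × 3.5`, `6 × 13.5`, `15.5 × 4`,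
`5.5 × 14`, `18.5 × 1` and `2.5 × 17` all have perimeter `39` but pairwise distinct areas,
and they can be placed (translations, allowing 90° rotations) with pairwise disjoint
interiors so that their union is a `24 × 18` rectangle. -/
theorem seven_isoperimetric_rectangles_tile_24x18 :
    (∀ i : Fin 7, 2 * ((dims8 i).1 + (dims8 i).2) = 39) ∧
    (∀ i j : Fin 7, i ≠ j → (dims8 i).1 * (dims8 i).2 ≠ (dims8 j).1 * (dims8 j).2) ∧
    ∃ P : Fin 7 → Set (ℝ × ℝ),
      (∀ i, IsPlacement (dims8 i).1 (dims8 i).2 (P i)) ∧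
      (∀ i j, i ≠ j → interior (P i) ∩ interior (P j) = ∅) ∧
      (⋃ i, P i) = rectWH 24 18 := by
  refine ⟨?_, ?_, fun i => (fun p => p + tileCorner i) '' rectWH (dims8 i).1 (dims8 i).2,
    fun i => ⟨tileCorner i, Or.inl rfl⟩, ?_, ?_⟩
  · intro i
    fin_cases i <;> norm_num [dims8]
  · intro i j hij
    fin_cases i <;> fin_cases j <;> first | exact absurd rfl hij | norm_num [dims8]
  · intro i j hij
    simp only [image_add_rectWH, interior_prod_eq, interior_Icc]
    rw [← Set.disjoint_iff_inter_eq_empty, Set.disjoint_prod]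
    simp only [Set.Ioo_disjoint_Ioo]
    fin_cases i <;> fin_cases j <;>
      first | exact absurd rfl hij | norm_num [dims8, tileCorner]
  · ext ⟨x, y⟩
    simp only [image_add_rectWH, Set.mem_iUnion, Set.mem_prod, Set.mem_Icc]
    simp only [rectWH, Set.mem_prod, Set.mem_Icc]
    constructor
    · rintro ⟨i, ⟨hx0, hx1⟩, hy0, hy1⟩
      fin_cases i <;> norm_num [dims8, tileCorner] at hx0 hx1 hy0 hy1 <;>
        refine ⟨⟨?_, ?_⟩, ?_, ?_⟩ <;> linarith
    · rintro ⟨⟨hx0, hx1⟩, hy0, hy1⟩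
      rcases le_total x 18.5 with hx | hx
      · rcases le_total y 1 with hy | hy
        · refine ⟨5, ⟨?_, ?_⟩, ?_, ?_⟩ <;>
            simp only [dims8, tileCorner, Matrix.cons_val] <;> linarith
        rcases le_total x 2.5 with hx₁ | hx₁
        · refine ⟨6, ⟨?_, ?_⟩, ?_, ?_⟩ <;>
            simp only [dims8, tileCorner, Matrix.cons_val] <;> linarith
        rcases le_total y 4.5 with hy₁ | hy₁
        · refine ⟨1, ⟨?_, ?_⟩, ?_, ?_⟩ <;>
            simp only [dims8, tileCorner, Matrix.cons_val] <;> linarith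
        rcases le_total x 8.5 with hx₂ | hx₂
        · refine ⟨2, ⟨?_, ?_⟩, ?_, ?_⟩ <;>
            simp only [dims8, tileCorner, Matrix.cons_val] <;> linarith
        rcases le_total y 14 with hy₂ | hy₂
        · refine ⟨0, ⟨?_, ?_⟩, ?_, ?_⟩ <;>
            simp only [dims8, tileCorner, Matrix.cons_val] <;> linarith
        · refine ⟨3, ⟨?_, ?_⟩, ?_, ?_⟩ <;>
            simp only [dims8, tileCorner, Matrix.cons_val] <;> linarith
      · rcases le_total y 14 with hy | hy
        · refine ⟨4, ⟨?_, ?_⟩, ?_, ?_⟩ <;>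
            simp only [dims8, tileCorner, Matrix.cons_val] <;> linarith
        · refine ⟨3, ⟨?_, ?_⟩, ?_, ?_⟩ <;>
            simp only [dims8, tileCorner, Matrix.cons_val] <;> linarith
end
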